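/- arXiv:2109.11222 — 11 statements merged into one kernel-verified Lean document; each statement's English description precedes it below -/
import Mathlib

section
/- Let Λ be an irrational lattice generated by two linearly independent vectors in ℝ². Suppose B = (α, β) × (0, γ̃) is a maximal empty axis-parallel box amidst Λ such that (0, 0) ∈ Λ, α < 0 < β, 0 < γ̃, and there are points (α, α̃) ∈ Λ, (β, β̃) ∈ Λ, (γ, γ̃) ∈ Λ with 0 < α̃ < γ̃, 0 < β̃ < γ̃, and α < γ < β. Then γ = α + β, γ̃ = α̃ + β̃, and Λ = {m·(β, β̃) + n·(α, α̃) : m, n ∈ ℤ}. -/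
/-- The lattice generated by two vectors `v w : ℝ × ℝ`. -/
def latticeGen (v w : ℝ × ℝ) : Set (ℝ × ℝ) :=
  {p | ∃ m n : ℤ, p = (m : ℝ) • v + (n : ℝ) • w}

/-- `isEmptyBox Λ x₁ x₂ y₁ y₂` means that `(x₁,x₂) × (y₁,y₂)` is an axis-parallel
box (so `x₁ < x₂`, `y₁ < y₂`) containing no point of `Λ`. -/
def isEmptyBox (Λ : Set (ℝ × ℝ)) (x₁ x₂ y₁ y₂ : ℝ) : Prop :=
  x₁ < x₂ ∧ y₁ < y₂ ∧ ∀ p ∈ Λ, p ∉ Set.Ioo x₁ x₂ ×ˢ Set.Ioo y₁ y₂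

/-- The dispersion of a point set `Λ ⊂ ℝ²`: the supremum (in `[0,∞]`) of the areas
of the axis-parallel boxes empty amidst `Λ`. -/
noncomputable def disp (Λ : Set (ℝ × ℝ)) : ENNReal :=
  sSup {A : ENNReal | ∃ x₁ x₂ y₁ y₂ : ℝ, isEmptyBox Λ x₁ x₂ y₁ y₂ ∧
    A = ENNReal.ofReal ((x₂ - x₁) * (y₂ - y₁))}
/-- An empty axis-parallel box amidst `Λ` is maximal if no axis-parallel box
strictly containing it is empty amidst `Λ`. -/
def maximalEmptyBox (Λ : Set (ℝ × ℝ)) (x₁ x₂ y₁ y₂ : ℝ) : Prop :=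
  isEmptyBox Λ x₁ x₂ y₁ y₂ ∧
  ∀ x₁' x₂' y₁' y₂' : ℝ, isEmptyBox Λ x₁' x₂' y₁' y₂' →
    Set.Ioo x₁ x₂ ×ˢ Set.Ioo y₁ y₂ ⊆ Set.Ioo x₁' x₂' ×ˢ Set.Ioo y₁' y₂' →
    Set.Ioo x₁ x₂ ×ˢ Set.Ioo y₁ y₂ = Set.Ioo x₁' x₂' ×ˢ Set.Ioo y₁' y₂'

theorem latticeGen_comb {v w p q : ℝ × ℝ} (hp : p ∈ latticeGen v w) (hq : q ∈ latticeGen v w)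
    (m n : ℤ) : (m : ℝ) • p + (n : ℝ) • q ∈ latticeGen v w := by
  obtain ⟨a, b, rfl⟩ := hp
  obtain ⟨c, d, rfl⟩ := hq
  refine ⟨m * a + n * c, m * b + n * d, ?_⟩
  push_cast
  module

/-- If B = (α,β) × (0,γ̃) is a maximal empty box amidst an irrational lattice Λ,
bounded below by (0,0), on the left by (α,α̃), on the right by (β,β̃) and above
by (γ,γ̃), then (γ,γ̃) = (α,α̃) + (β,β̃) and Λ is generated by (β,β̃) and (α,α̃). -/
theorem stmt8 (v w : ℝ × ℝ) (hvw : LinearIndependent ℝ ![v, w])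
    (hirr : ∀ p ∈ latticeGen v w, ∀ q ∈ latticeGen v w, p ≠ q → p.1 ≠ q.1 ∧ p.2 ≠ q.2)
    (α β γ αt βt γt : ℝ)
    (hmax : maximalEmptyBox (latticeGen v w) α β 0 γt)
    (h00 : ((0 : ℝ), (0 : ℝ)) ∈ latticeGen v w)
    (hα : α < 0) (hβ : 0 < β) (hγt : 0 < γt)
    (hαmem : (α, αt) ∈ latticeGen v w)
    (hβmem : (β, βt) ∈ latticeGen v w)
    (hγmem : (γ, γt) ∈ latticeGen v w)
    (hαt : 0 < αt ∧ αt < γt) (hβt : 0 < βt ∧ βt < γt) (hγ : α < γ ∧ γ < β) :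
    γ = α + β ∧ γt = αt + βt ∧ latticeGen v w = latticeGen (β, βt) (α, αt) := by
  obtain ⟨⟨-, -, hE⟩, -⟩ := hmax
  obtain ⟨ha1, ha2⟩ := hαt
  obtain ⟨hb1, hb2⟩ := hβt
  obtain ⟨hg1, hg2⟩ := hγ
  have hab := latticeGen_comb hαmem hβmem 1 1
  have hd := latticeGen_comb hab hγmem 1 (-1)
  have h1 : γt ≤ αt + βt := by
    by_contra! h
    refine hE _ hab ?_
    simp only [Set.mem_prod, Set.mem_Ioo, Prod.fst_add, Prod.snd_add, Prod.smul_fst,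
      Prod.smul_snd, smul_eq_mul, Int.cast_one]
    refine ⟨⟨?_, ?_⟩, ?_, ?_⟩ <;> linarith
  have h2 : γt = αt + βt := by
    by_contra hne
    have h3 : γt < αt + βt := lt_of_le_of_ne h1 hne
    refine hE _ hd ?_
    simp only [Set.mem_prod, Set.mem_Ioo, Prod.fst_add, Prod.snd_add, Prod.smul_fst,
      Prod.smul_snd, smul_eq_mul, Int.cast_one, Int.cast_neg]
    refine ⟨⟨?_, ?_⟩, ?_, ?_⟩ <;> linarith
  have h3 : γ = α + β := by
    by_contra hne
    refine (hirr _ hab _ hγmem ?_).2 ?_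
    · intro h
      apply hne
      have := congrArg Prod.fst h
      simp at this
      linarith
    · simp [h2]
  refine ⟨h3, h2, Set.Subset.antisymm ?_ ?_⟩
  · intro p hp
    have hD : 0 < β * αt - α * βt := by nlinarith [mul_pos hβ ha1, mul_pos (neg_pos.2 hα) hb1]
    obtain ⟨s, hs⟩ : ∃ s, s = (p.1 * αt - α * p.2) / (β * αt - α * βt) := ⟨_, rfl⟩
    obtain ⟨t, ht⟩ : ∃ t, t = (β * p.2 - βt * p.1) / (β * αt - α * βt) := ⟨_, rfl⟩
    have e1 : p.1 = s * β + t * α := by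
      apply mul_left_cancel₀ hD.ne'
      rw [eq_div_iff hD.ne'] at hs ht
      linear_combination (-β) * hs - α * ht
    have e2 : p.2 = s * βt + t * αt := by
      apply mul_left_cancel₀ hD.ne'
      rw [eq_div_iff hD.ne'] at hs ht
      linear_combination (-βt) * hs - αt * ht
    have hr := latticeGen_comb hp (latticeGen_comb hβmem hαmem ⌊s⌋ ⌊t⌋) 1 (-1)
    have fs0 := Int.fract_nonneg s
    have fs1 := Int.fract_lt_one s
    have ft0 := Int.fract_nonneg t
    have ft1 := Int.fract_lt_one t
    have es := Int.floor_add_fract s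
    have et := Int.floor_add_fract t
    have hnot := hE _ hr
    have r1 : p.1 - (⌊s⌋ * β + ⌊t⌋ * α) = Int.fract s * β + Int.fract t * α := by
      rw [e1]; linear_combination (-β) * es - α * et
    have r2 : p.2 - (⌊s⌋ * βt + ⌊t⌋ * αt) = Int.fract s * βt + Int.fract t * αt := by
      rw [e2]; linear_combination (-βt) * es - αt * et
    simp only [Set.mem_prod, Set.mem_Ioo, Prod.fst_add, Prod.snd_add, Prod.smul_fst,
      Prod.smul_snd, smul_eq_mul, Int.cast_one, Int.cast_neg, one_mul, neg_mul,
      ← sub_eq_add_neg, r1, r2] at hnot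
    have hz : ¬ (0 < Int.fract s * βt + Int.fract t * αt) := by
      intro hpos
      refine hnot ⟨⟨?_, ?_⟩, hpos, ?_⟩ <;> nlinarith
    have q1 : 0 ≤ Int.fract s * βt := by positivity
    have q2 : 0 ≤ Int.fract t * αt := by positivity
    have z1 : Int.fract s = 0 := by
      have : Int.fract s * βt = 0 := by linarith
      exact (mul_eq_zero.1 this).resolve_right hb1.ne'
    have z2 : Int.fract t = 0 := by
      have : Int.fract t * αt = 0 := by linarith
      exact (mul_eq_zero.1 this).resolve_right ha1.ne'
    rw [z1, z2] at r1 r2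
    refine ⟨⌊s⌋, ⌊t⌋, Prod.ext ?_ ?_⟩
    · simp only [Prod.fst_add, Prod.smul_fst, smul_eq_mul]; linarith
    · simp only [Prod.snd_add, Prod.smul_snd, smul_eq_mul]; linarith
  · rintro p ⟨m, n, rfl⟩
    exact latticeGen_comb hβmem hαmem m n
end

section
/- Let Δ ≥ 1 and −1 ≤ Δ̃ < 0, and let Λ be the lattice generated by (1, 1) and (−Δ, −Δ̃). Then the box B₀ = (−Δ, 1) × (0, 1 − Δ̃) is empty amidst Λ, and it is a maximal empty axis-parallel box amidst Λ. -/
/-- For Δ ≥ 1 and −1 ≤ Δ̃ < 0, the box B₀ = (−Δ, 1) × (0, 1 − Δ̃) is a maximal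
empty axis-parallel box amidst the lattice generated by (1,1) and (−Δ,−Δ̃). -/
theorem stmt9 (Δ Δt : ℝ) (hΔ : 1 ≤ Δ) (hΔt1 : -1 ≤ Δt) (hΔt0 : Δt < 0) :
    isEmptyBox (latticeGen (1, 1) (-Δ, -Δt)) (-Δ) 1 0 (1 - Δt) ∧
    maximalEmptyBox (latticeGen (1, 1) (-Δ, -Δt)) (-Δ) 1 0 (1 - Δt) := by
  have hE : isEmptyBox (latticeGen (1, 1) (-Δ, -Δt)) (-Δ) 1 0 (1 - Δt) := by
    refine ⟨by linarith, by linarith, ?_⟩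
    rintro p ⟨m, n, rfl⟩ ⟨⟨h1, h2⟩, ⟨h3, h4⟩⟩
    simp only [Prod.fst_add, Prod.snd_add, Prod.smul_fst, Prod.smul_snd, smul_eq_mul,
      mul_one] at h1 h2 h3 h4
    rcases le_or_gt n 0 with hn | hn <;> rcases le_or_gt m 0 with hm | hm
    · have hn' : (n : ℝ) ≤ 0 := by exact_mod_cast hn
      have hm' : (m : ℝ) ≤ 0 := by exact_mod_cast hm
      nlinarith
    · have hn' : (n : ℝ) ≤ 0 := by exact_mod_cast hn
      have hm' : (1 : ℝ) ≤ m := by exact_mod_cast hm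
      nlinarith
    · have hn' : (1 : ℝ) ≤ n := by exact_mod_cast hn
      have hm' : (m : ℝ) ≤ 0 := by exact_mod_cast hm
      nlinarith
    · have hn' : (1 : ℝ) ≤ n := by exact_mod_cast hn
      have hm' : (1 : ℝ) ≤ m := by exact_mod_cast hm
      nlinarith
  refine ⟨hE, hE, ?_⟩
  rintro a b c d ⟨-, -, h⟩ hsub
  have hx : -Δ < 1 := by linarith
  have hy : 0 < 1 - Δt := by linarith
  obtain ⟨hs1, hs2⟩ := (Set.prod_subset_prod_iff.1 hsub).resolve_right (by
    rintro (h0 | h0)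
    · exact (Set.nonempty_Ioo.2 hx).ne_empty h0
    · exact (Set.nonempty_Ioo.2 hy).ne_empty h0)
  obtain ⟨ha, hb⟩ := (Set.Ioo_subset_Ioo_iff hx).1 hs1
  obtain ⟨hc, hd⟩ := (Set.Ioo_subset_Ioo_iff hy).1 hs2
  have key : ∀ m n : ℤ, ∀ x y : ℝ, x = m - n * Δ → y = m - n * Δt →
      a < x → x < b → c < y → y < d → False := by
    intro m n x y hx hy h1 h2 h3 h4
    refine h (x, y) ⟨m, n, ?_⟩ ⟨⟨h1, h2⟩, ⟨h3, h4⟩⟩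
    ext
    · simp [hx]; ring
    · simp [hy]; ring
  have ea : a = -Δ := by
    refine le_antisymm ha (not_lt.1 fun hlt => ?_)
    exact key 0 1 (-Δ) (-Δt) (by simp) (by simp) hlt (by linarith) (by linarith) (by linarith)
  have eb : b = 1 := by
    refine le_antisymm (not_lt.1 fun hlt => ?_) hb
    exact key 1 0 1 1 (by simp) (by simp) (by linarith) hlt (by linarith) (by linarith)
  have ec : c = 0 := by
    refine le_antisymm hc (not_lt.1 fun hlt => ?_)
    exact key 0 0 0 0 (by simp) (by simp) (by linarith) (by linarith) hlt (by linarith)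
  have ed : d = 1 - Δt := by
    refine le_antisymm (not_lt.1 fun hlt => ?_) hd
    exact key 1 1 (1 - Δ) (1 - Δt) (by simp) (by simp) (by linarith) (by linarith)
      (by linarith) hlt
  rw [ea, eb, ec, ed]
end

section
/- In the two-sided continued fraction setting for irrational Δ > 1 and Δ̃ ∈ (−1, 0), with Λ the lattice generated by (1, 1) and (−Δ, −Δ̃), and with the two-sided convergent sequences (pᵢ), (qᵢ): for every i ∈ ℤ and every integer j with 0 ≤ j < aᵢ, set u = pᵢ − qᵢΔ, v = j(pᵢ − qᵢΔ) + (pᵢ₋₁ − qᵢ₋₁Δ), u′ = pᵢ − qᵢΔ̃, v′ = j(pᵢ − qᵢΔ̃) + (pᵢ₋₁ − qᵢ₋₁Δ̃). Then u′ + v′ > 0, and: if i is odd, then u < 0 < v and the box (u, v) × (0, u′ + v′) is a maximal empty axis-parallel box amidst Λ; if i is even, then v < 0 < u and the box (v, u) × (0, u′ + v′) is a maximal empty axis-parallel box amidst Λ. -/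
lemma box_aux (Λ : Set (ℝ × ℝ)) (u v u' v' : ℝ) (hu : u < 0) (hv : 0 < v) (hu' : 0 < u')
    (hv' : 0 < v') (h1 : ∀ x ∈ Λ, ∃ m n : ℤ, x = (m * u + n * v, m * u' + n * v'))
    (h2 : ∀ m n : ℤ, ((m * u + n * v, m * u' + n * v') : ℝ × ℝ) ∈ Λ) :
    maximalEmptyBox Λ u v 0 (u' + v') := by
  refine ⟨⟨by linarith, by linarith, ?_⟩, ?_⟩
  · intro x hx hmem
    obtain ⟨m, n, rfl⟩ := h1 x hx
    simp only [Set.mem_prod, Set.mem_Ioo] at hmem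
    obtain ⟨⟨ha, hb⟩, hc, hd⟩ := hmem
    rcases le_or_gt m 0 with hm | hm <;> rcases le_or_gt n 0 with hn | hn
    · have hm' : (m : ℝ) ≤ 0 := by exact_mod_cast hm
      have hn' : (n : ℝ) ≤ 0 := by exact_mod_cast hn
      nlinarith
    · have hm' : (m : ℝ) ≤ 0 := by exact_mod_cast hm
      have hn' : (1 : ℝ) ≤ n := by exact_mod_cast hn
      nlinarith
    · have hm' : (1 : ℝ) ≤ m := by exact_mod_cast hm
      have hn' : (n : ℝ) ≤ 0 := by exact_mod_cast hn
      nlinarith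
    · have hm' : (1 : ℝ) ≤ m := by exact_mod_cast hm
      have hn' : (1 : ℝ) ≤ n := by exact_mod_cast hn
      nlinarith
  · rintro x₁ x₂ y₁ y₂ ⟨hx, hy, hE⟩ hsub
    have hne : (Set.Ioo u v ×ˢ Set.Ioo 0 (u' + v')).Nonempty :=
      ⟨(0, u'), ⟨hu, hv⟩, ⟨hu', by simp only; linarith⟩⟩
    replace hsub := (Set.prod_subset_prod_iff.1 hsub).resolve_right (by
      rw [← Set.prod_eq_empty_iff]; exact hne.ne_empty)
    obtain ⟨hs1, hs2⟩ := hsub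
    rw [Set.Ioo_subset_Ioo_iff (by linarith)] at hs1 hs2
    obtain ⟨ha, hb⟩ := hs1
    obtain ⟨hc, hd⟩ := hs2
    have e0 := hE _ (h2 0 0)
    have e1 := hE _ (h2 1 0)
    have e2 := hE _ (h2 0 1)
    have e3 := hE _ (h2 1 1)
    simp only [Set.mem_prod, Set.mem_Ioo, Int.cast_zero, Int.cast_one, zero_mul, one_mul,
      add_zero, zero_add] at e0 e1 e2 e3
    have f1 : x₁ = u := by
      by_contra hne
      have := lt_of_le_of_ne ha hne
      exact e1 ⟨⟨this, by linarith⟩, by linarith, by linarith⟩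
    have f2 : x₂ = v := by
      by_contra hne
      have := lt_of_le_of_ne hb (Ne.symm hne)
      exact e2 ⟨⟨by linarith, this⟩, by linarith, by linarith⟩
    have f3 : y₁ = 0 := by
      by_contra hne
      have := lt_of_le_of_ne hc hne
      exact e0 ⟨⟨by linarith, by linarith⟩, this, by linarith⟩
    have f4 : y₂ = u' + v' := by
      by_contra hne
      have := lt_of_le_of_ne hd (Ne.symm hne)
      exact e3 ⟨⟨by linarith, by linarith⟩, by linarith, this⟩
    rw [f1, f2, f3, f4]

/-- The inductive invariant at index `i`. -/
def CFInv (Δ Δt : ℝ) (Δs Δts : ℤ → ℝ) (p q : ℤ → ℤ) (i : ℤ) : Prop :=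
  1 < Δs i ∧ -1 < Δts i ∧ Δts i < 0 ∧
  ((p (i-1) : ℝ) - q (i-1) * Δ = -Δs i * (p i - q i * Δ)) ∧
  ((p (i-1) : ℝ) - q (i-1) * Δt = -Δts i * (p i - q i * Δt)) ∧
  (0 < (p i : ℝ) - q i * Δt) ∧
  (Even i → 0 < (p i : ℝ) - q i * Δ) ∧
  (Odd i → (p i : ℝ) - q i * Δ < 0) ∧
  (∀ m n : ℤ, ∃ s t : ℤ, m = s * p i + t * p (i-1) ∧ n = s * q i + t * q (i-1))

lemma CFInv_succ (Δ Δt : ℝ) (Δs Δts : ℤ → ℝ) (p q : ℤ → ℤ) (a : ℤ → ℤ) (i : ℤ)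
    (hp : p (i + 1) = a i * p i + p (i - 1)) (hq : q (i + 1) = a i * q i + q (i - 1))
    (h : CFInv Δ Δt Δs Δts p q i) (hirr : Irrational (Δs i))
    (ha : a i = ⌊Δs i⌋) (hs : Δs (i + 1) = 1 / (Δs i - a i))
    (ht : Δts (i + 1) = -1 / (a i - Δts i)) :
    CFInv Δ Δt Δs Δts p q (i + 1) ∧ Irrational (Δs (i + 1)) ∧ (a i : ℝ) < Δs i := by
  obtain ⟨h1, h2, h3, h4, h5, h6, h7, h8, h9⟩ := h
  have hle : (a i : ℝ) ≤ Δs i := by rw [ha]; exact Int.floor_le _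
  have hlt : (a i : ℝ) < Δs i := lt_of_le_of_ne hle (fun hh => hirr ⟨a i, by simpa using hh⟩)
  have hlt2 : Δs i < a i + 1 := by rw [ha]; exact Int.lt_floor_add_one _
  have hone : (1 : ℝ) ≤ a i := by
    have : 1 ≤ a i := by rw [ha]; exact Int.le_floor.2 (by simpa using h1.le)
    exact_mod_cast this
  have hd : 0 < Δs i - a i := by linarith
  have hd2 : 0 < a i - Δts i := by linarith
  have hE : (p (i+1) : ℝ) - q (i+1) * Δ = -(Δs i - a i) * (p i - q i * Δ) := by
    rw [hp, hq]; push_cast; linear_combination h4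
  have hF : (p (i+1) : ℝ) - q (i+1) * Δt = (a i - Δts i) * (p i - q i * Δt) := by
    rw [hp, hq]; push_cast; linear_combination h5
  refine ⟨⟨?_, ?_, ?_, ?_, ?_, ?_, ?_, ?_, ?_⟩, ?_, hlt⟩
  · rw [hs, lt_div_iff₀ hd]; linarith
  · rw [ht, lt_div_iff₀ hd2]; linarith
  · rw [ht]; exact div_neg_of_neg_of_pos (by norm_num) hd2
  · rw [hE, hs, add_sub_cancel_right]; field_simp
  · rw [hF, ht, add_sub_cancel_right]; field_simp
  · rw [hF]; positivity
  · intro he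
    have := h8 (by grind)
    rw [hE]; nlinarith
  · intro he
    have := h7 (by grind)
    rw [hE]; nlinarith
  · intro m n
    obtain ⟨s, t, rfl, rfl⟩ := h9 m n
    refine ⟨t, s - t * a i, ?_, ?_⟩
    · rw [hp, add_sub_cancel_right]; ring
    · rw [hq, add_sub_cancel_right]; ring
  · rw [hs, one_div]
    exact (hirr.sub_intCast _).inv

lemma CFInv_pred (Δ Δt : ℝ) (Δs Δts : ℤ → ℝ) (p q : ℤ → ℤ) (a : ℤ → ℤ) (i : ℤ)
    (hp : p i = a (i-1) * p (i-1) + p (i - 1 - 1)) (hq : q i = a (i-1) * q (i-1) + q (i - 1 - 1))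
    (h : CFInv Δ Δt Δs Δts p q i) (hirr : Irrational (Δts i))
    (ha : a (i-1) = ⌊-1 / Δts i⌋) (ht : Δts (i - 1) = a (i - 1) + 1 / Δts i)
    (hs : Δs (i - 1) = a (i - 1) + 1 / Δs i) :
    CFInv Δ Δt Δs Δts p q (i - 1) ∧ Irrational (Δts (i - 1)) ∧ (a (i - 1) : ℝ) < Δs (i - 1) := by
  obtain ⟨h1, h2, h3, h4, h5, h6, h7, h8, h9⟩ := h
  have hpos : 0 < 1 / Δs i := by positivity
  have hirr' : Irrational (-1 / Δts i) := by
    rw [neg_div, one_div]; exact hirr.inv.neg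
  have hneg : -1 / Δts i = - (1 / Δts i) := by ring
  have hle : (a (i-1) : ℝ) ≤ -1 / Δts i := by rw [ha]; exact Int.floor_le _
  have hlt : (a (i-1) : ℝ) < -1 / Δts i :=
    lt_of_le_of_ne hle (fun hh => hirr' ⟨a (i-1), by simpa using hh⟩)
  have hlt2 : -1 / Δts i < a (i-1) + 1 := by rw [ha]; exact Int.lt_floor_add_one _
  have hone : (1 : ℝ) ≤ a (i-1) := by
    have : 1 ≤ a (i-1) := by
      rw [ha]; apply Int.le_floor.2
      rw [le_div_iff_of_neg h3]; push_cast; linarith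
    exact_mod_cast this
  have hE : (p i : ℝ) - q i * Δ = -(1 / Δs i) * (p (i-1) - q (i-1) * Δ) := by
    rw [h4]; field_simp
  have hF : (p i : ℝ) - q i * Δt = -(1 / Δts i) * (p (i-1) - q (i-1) * Δt) := by
    have := h3.ne
    rw [h5]; field_simp
  have hp' : (p i : ℝ) = a (i-1) * p (i-1) + p (i - 1 - 1) := by exact_mod_cast hp
  have hq' : (q i : ℝ) = a (i-1) * q (i-1) + q (i - 1 - 1) := by exact_mod_cast hq
  refine ⟨⟨?_, ?_, ?_, ?_, ?_, ?_, ?_, ?_, ?_⟩, ?_, ?_⟩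
  · rw [hs]; linarith
  · rw [ht]; linarith
  · rw [ht]; linarith
  · rw [hs]; linear_combination hE - hp' + hq' * Δ
  · rw [ht]; linear_combination hF - hp' + hq' * Δt
  · rw [h5]; nlinarith
  · intro he
    have := h8 (by grind)
    rw [h4]; nlinarith
  · intro he
    have := h7 (by grind)
    rw [h4]; nlinarith
  · intro m n
    obtain ⟨s, t, rfl, rfl⟩ := h9 m n
    refine ⟨s * a (i-1) + t, s, ?_, ?_⟩
    · linear_combination s * hp
    · linear_combination s * hq
  · rw [ht, one_div]
    exact hirr.inv.intCast_add _
  · rw [hs]; linarith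

/-- The maximal empty boxes bounded below by the origin amidst the lattice Λ are
exactly described by the (semi)convergents of the continued fraction expansions of
Δ and −Δ̃. -/
theorem stmt10
    (Δ Δt : ℝ) (hΔirr : Irrational Δ) (hΔtirr : Irrational Δt)
    (hΔ1 : 1 < Δ) (hΔtmem : Δt ∈ Set.Ioo (-1 : ℝ) 0)
    (a : ℤ → ℤ) (Δs Δts : ℤ → ℝ)
    (h0 : Δs 0 = Δ) (h0t : Δts 0 = Δt)
    (hpos : ∀ i : ℤ, 0 ≤ i → a i = ⌊Δs i⌋ ∧ Δs (i + 1) = 1 / (Δs i - a i) ∧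
      Δts (i + 1) = -1 / (a i - Δts i))
    (hneg : ∀ i : ℤ, i ≤ 0 → a (i - 1) = ⌊-1 / Δts i⌋ ∧
      Δts (i - 1) = a (i - 1) + 1 / Δts i ∧ Δs (i - 1) = a (i - 1) + 1 / Δs i)
    (p q : ℤ → ℤ)
    (hpm1 : p (-1) = 0) (hp0 : p 0 = 1) (hqm1 : q (-1) = 1) (hq0 : q 0 = 0)
    (hprec : ∀ i : ℤ, p (i + 1) = a i * p i + p (i - 1))
    (hqrec : ∀ i : ℤ, q (i + 1) = a i * q i + q (i - 1))
    (i j : ℤ) (hj0 : 0 ≤ j) (hj : j < a i) :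
    let u : ℝ := (p i : ℝ) - (q i : ℝ) * Δ
    let v : ℝ := (j : ℝ) * ((p i : ℝ) - (q i : ℝ) * Δ) + ((p (i - 1) : ℝ) - (q (i - 1) : ℝ) * Δ)
    let u' : ℝ := (p i : ℝ) - (q i : ℝ) * Δt
    let v' : ℝ := (j : ℝ) * ((p i : ℝ) - (q i : ℝ) * Δt) + ((p (i - 1) : ℝ) - (q (i - 1) : ℝ) * Δt)
    0 < u' + v' ∧
    (Odd i → u < 0 ∧ 0 < v ∧
      maximalEmptyBox (latticeGen (1, 1) (-Δ, -Δt)) u v 0 (u' + v')) ∧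
    (Even i → v < 0 ∧ 0 < u ∧
      maximalEmptyBox (latticeGen (1, 1) (-Δ, -Δt)) v u 0 (u' + v')) := by
  have I0 : CFInv Δ Δt Δs Δts p q 0 := by
    refine ⟨by rw [h0]; exact hΔ1, by rw [h0t]; exact hΔtmem.1, by rw [h0t]; exact hΔtmem.2,
      ?_, ?_, ?_, ?_, ?_, ?_⟩
    · simp [hpm1, hp0, hqm1, hq0, h0]
    · simp [hpm1, hp0, hqm1, hq0, h0t]
    · simp [hp0, hq0]
    · simp [hp0, hq0]
    · intro h; exact absurd h (by decide)
    · intro m n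
      exact ⟨m, n, by simp [hpm1, hp0], by simp [hqm1, hq0]⟩
  have up : ∀ k : ℕ, CFInv Δ Δt Δs Δts p q k ∧ Irrational (Δs k) := by
    intro k
    induction k with
    | zero => exact ⟨by simpa using I0, by simpa [h0] using hΔirr⟩
    | succ k ih =>
      obtain ⟨x1, x2, x3⟩ := hpos k (by positivity)
      obtain ⟨y1, y2, _⟩ := CFInv_succ Δ Δt Δs Δts p q a k (hprec k) (hqrec k) ih.1 ih.2 x1 x2 x3
      push_cast
      exact ⟨y1, y2⟩
  have down : ∀ k : ℕ, (CFInv Δ Δt Δs Δts p q (-k) ∧ Irrational (Δts (-k))) ∧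
      (a (-(k:ℤ) - 1) : ℝ) < Δs (-(k:ℤ) - 1) := by
    have step : ∀ k : ℕ, (CFInv Δ Δt Δs Δts p q (-k) ∧ Irrational (Δts (-k))) →
      CFInv Δ Δt Δs Δts p q (-(k:ℤ) - 1) ∧ Irrational (Δts (-(k:ℤ) - 1)) ∧
        (a (-(k:ℤ) - 1) : ℝ) < Δs (-(k:ℤ) - 1) := by
      intro k ih
      obtain ⟨x1, x2, x3⟩ := hneg (-(k:ℤ)) (by simp)
      have hp := hprec (-(k:ℤ) - 1)
      have hq := hqrec (-(k:ℤ) - 1)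
      rw [sub_add_cancel] at hp hq
      exact CFInv_pred Δ Δt Δs Δts p q a (-(k:ℤ)) hp hq ih.1 ih.2 x1 x2 x3
    have main : ∀ k : ℕ, (CFInv Δ Δt Δs Δts p q (-k) ∧ Irrational (Δts (-k))) := by
      intro k
      induction k with
      | zero => exact ⟨by simpa using I0, by simpa [h0t] using hΔtirr⟩
      | succ k ih =>
        obtain ⟨y1, y2, _⟩ := step k ih
        have e : -((k + 1 : ℕ) : ℤ) = -(k:ℤ) - 1 := by push_cast; ring
        rw [e]
        exact ⟨y1, y2⟩
    exact fun k => ⟨main k, (step k (main k)).2.2⟩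
  have key : CFInv Δ Δt Δs Δts p q i ∧ (a i : ℝ) < Δs i := by
    rcases le_or_gt 0 i with hi | hi
    · obtain ⟨k, rfl⟩ := Int.eq_ofNat_of_zero_le hi
      obtain ⟨x1, x2, x3⟩ := hpos k hi
      exact ⟨(up k).1,
        (CFInv_succ Δ Δt Δs Δts p q a k (hprec k) (hqrec k) (up k).1 (up k).2 x1 x2 x3).2.2⟩
    · obtain ⟨k, hk⟩ := Int.eq_ofNat_of_zero_le (show 0 ≤ -i - 1 by omega)
      have e1 : i = -((k + 1 : ℕ) : ℤ) := by push_cast; omega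
      have e2 : i = -(k : ℤ) - 1 := by omega
      refine ⟨?_, ?_⟩
      · rw [e1]; exact (down (k + 1)).1.1
      · rw [e2]; exact (down k).2
  obtain ⟨⟨h1, h2, h3, h4, h5, h6, h7, h8, h9⟩, hlt⟩ := key
  intro u v u' v'
  have hjr : (0 : ℝ) ≤ j := by exact_mod_cast hj0
  have hjlt : (j : ℝ) < Δs i := lt_trans (by exact_mod_cast hj) hlt
  have hu' : 0 < u' := h6
  have hv' : 0 < v' := by
    have : v' = (j - Δts i) * u' := by
      simp only [v', u']; rw [h5]; ring
    rw [this]; apply mul_pos _ hu'; linarith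
  have hv : v = -(Δs i - j) * u := by
    simp only [v, u]; rw [h4]; ring
  have L1 : ∀ x ∈ latticeGen (1, 1) (-Δ, -Δt), ∃ m n : ℤ,
      x = (m * u + n * v, m * u' + n * v') := by
    rintro x ⟨m, n, rfl⟩
    obtain ⟨s, t, rfl, rfl⟩ := h9 m n
    refine ⟨s - t * j, t, ?_⟩
    ext <;> simp [u, v, u', v'] <;> ring
  have L2 : ∀ m n : ℤ, ((m * u + n * v, m * u' + n * v') : ℝ × ℝ) ∈
      latticeGen (1, 1) (-Δ, -Δt) := by
    intro m n
    refine ⟨(m + n * j) * p i + n * p (i-1), (m + n * j) * q i + n * q (i-1), ?_⟩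
    ext <;> simp [u, v, u', v'] <;> ring
  refine ⟨by linarith, fun ho => ?_, fun he => ?_⟩
  · have hu : u < 0 := h8 ho
    have hv0 : 0 < v := by rw [hv]; nlinarith
    exact ⟨hu, hv0, box_aux _ u v u' v' hu hv0 hu' hv' L1 L2⟩
  · have hu : 0 < u := h7 he
    have hv0 : v < 0 := by rw [hv]; nlinarith
    refine ⟨hv0, hu, ?_⟩
    rw [add_comm u' v']
    refine box_aux _ v u v' u' hv0 hu hv' hu' ?_ ?_
    · intro x hx
      obtain ⟨m, n, h⟩ := L1 x hx
      exact ⟨n, m, by rw [h]; ext <;> simp <;> ring⟩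
    · intro m n
      have := L2 n m
      rwa [add_comm, add_comm ((n:ℝ) * u')] at this
end

section
/- In the two-sided continued fraction setting for irrational Δ > 1 and Δ̃ ∈ (−1, 0), with Λ the lattice generated by (1, 1) and (−Δ, −Δ̃): for every i ∈ ℤ, let Γᵢ be the lattice generated by (1, 1) and (−Δᵢ, −Δ̃ᵢ). Then Γᵢ has the same normalized dispersion as Λ, i.e. (Δ − Δ̃)·disp(Γᵢ) = (Δᵢ − Δ̃ᵢ)·disp(Λ) (as an equality in [0, ∞], noting det(Λ) = Δ − Δ̃ and det(Γᵢ) = Δᵢ − Δ̃ᵢ). -/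
lemma disp_le_aux (L L' : Set (ℝ × ℝ)) (s t : ℝ) (hs : 0 < s) (ht : 0 < t)
    (h : ∀ p ∈ L', (p.1 * s, -(p.2 * t)) ∈ L) :
    disp L ≤ ENNReal.ofReal (s * t) * disp L' := by
  unfold disp
  apply sSup_le
  rintro A ⟨x₁, x₂, y₁, y₂, ⟨hx, hy, he⟩, rfl⟩
  have hA : (x₂ - x₁) * (y₂ - y₁) = (s * t) * ((x₂ / s - x₁ / s) * (-y₁ / t - -y₂ / t)) := by
    field_simp
    ring
  rw [hA, ENNReal.ofReal_mul (by positivity)]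
  gcongr
  apply le_sSup
  refine ⟨x₁ / s, x₂ / s, -y₂ / t, -y₁ / t, ⟨by gcongr, by gcongr, ?_⟩, rfl⟩
  rintro p hp ⟨⟨h1, h2⟩, h3, h4⟩
  refine he _ (h p hp) ⟨⟨?_, ?_⟩, ?_, ?_⟩
  · exact (div_lt_iff₀ hs).1 h1
  · exact (lt_div_iff₀ hs).1 h2
  · have := (lt_div_iff₀ ht).1 h4
    show y₁ < -(p.2 * t)
    linarith
  · have := (div_lt_iff₀ ht).1 h3
    show -(p.2 * t) < y₂
    linarith

/-- One continued fraction step. -/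
lemma disp_step (c : ℤ) (x y x' y' : ℝ) (hx' : 0 < x') (hy' : y' < 0)
    (hx : x = c + 1 / x') (hy : y = c + 1 / y') :
    disp (latticeGen (1, 1) (-x, -y)) =
      ENNReal.ofReal (x'⁻¹ * (-y')⁻¹) * disp (latticeGen (1, 1) (-x', -y')) := by
  have hyn : 0 < -y' := by linarith
  have hx0 : x' ≠ 0 := hx'.ne'
  have hy0 : y' ≠ 0 := hy'.ne
  apply le_antisymm
  · refine disp_le_aux _ _ _ _ (inv_pos.2 hx') (inv_pos.2 hyn) ?_
    rintro p ⟨m, n, rfl⟩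
    refine ⟨-(m * c) - n, -m, ?_⟩
    subst hx hy
    ext <;> simp <;> field_simp <;> ring
  · have key := disp_le_aux (latticeGen (1, 1) (-x', -y')) (latticeGen (1, 1) (-x, -y))
      x' (-y') hx' hyn (by
        rintro p ⟨m, n, rfl⟩
        refine ⟨-n, n * c - m, ?_⟩
        subst hx hy
        ext <;> simp <;> field_simp <;> ring)
    calc _ ≤ ENNReal.ofReal (x'⁻¹ * (-y')⁻¹) * (ENNReal.ofReal (x' * -y') *
          disp (latticeGen (1, 1) (-x, -y))) := by gcongr
      _ = _ := by
        rw [← mul_assoc, ← ENNReal.ofReal_mul (by positivity)]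
        have : x'⁻¹ * (-y')⁻¹ * (x' * -y') = 1 := by field_simp
        rw [this]; simp

lemma det_step (c : ℤ) (x y x' y' : ℝ) (hx' : 0 < x') (hy' : y' < 0)
    (hx : x = c + 1 / x') (hy : y = c + 1 / y') :
    ENNReal.ofReal (x - y) = ENNReal.ofReal (x'⁻¹ * (-y')⁻¹) * ENNReal.ofReal (x' - y') := by
  have hyn : 0 < -y' := by linarith
  have hx0 : x' ≠ 0 := hx'.ne'
  have hy0 : y' ≠ 0 := hy'.ne
  rw [← ENNReal.ofReal_mul (by positivity)]
  congr 1
  subst hx hy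
  rw [inv_neg]
  field_simp
  ring

/-- Every shifted lattice Γᵢ (generated by (1,1) and (−Δᵢ,−Δ̃ᵢ)) has the same
normalized dispersion as Λ: (Δ−Δ̃)·disp(Γᵢ) = (Δᵢ−Δ̃ᵢ)·disp(Λ). -/
theorem stmt12
    (Δ Δt : ℝ) (hΔirr : Irrational Δ) (hΔtirr : Irrational Δt)
    (hΔ1 : 1 < Δ) (hΔtmem : Δt ∈ Set.Ioo (-1 : ℝ) 0)
    (a : ℤ → ℤ) (Δs Δts : ℤ → ℝ)
    (h0 : Δs 0 = Δ) (h0t : Δts 0 = Δt)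
    (hpos : ∀ i : ℤ, 0 ≤ i → a i = ⌊Δs i⌋ ∧ Δs (i + 1) = 1 / (Δs i - a i) ∧
      Δts (i + 1) = -1 / (a i - Δts i))
    (hneg : ∀ i : ℤ, i ≤ 0 → a (i - 1) = ⌊-1 / Δts i⌋ ∧
      Δts (i - 1) = a (i - 1) + 1 / Δts i ∧ Δs (i - 1) = a (i - 1) + 1 / Δs i) :
    ∀ i : ℤ,
      ENNReal.ofReal (Δ - Δt) * disp (latticeGen (1, 1) (-Δs i, -Δts i)) =
        ENNReal.ofReal (Δs i - Δts i) * disp (latticeGen (1, 1) (-Δ, -Δt)) := by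
  have fwd : ∀ n : ℕ, Irrational (Δs n) ∧ 1 < Δs n ∧ -1 < Δts n ∧ Δts n < 0 ∧
      ENNReal.ofReal (Δ - Δt) * disp (latticeGen (1, 1) (-Δs n, -Δts n)) =
        ENNReal.ofReal (Δs n - Δts n) * disp (latticeGen (1, 1) (-Δ, -Δt)) := by
    intro n
    induction n with
    | zero =>
      simp only [Nat.cast_zero, h0, h0t]
      exact ⟨hΔirr, hΔ1, hΔtmem.1, hΔtmem.2, trivial⟩
    | succ n ih =>
      obtain ⟨hi, h1, hm, hn, hd⟩ := ih
      obtain ⟨ha, hs, ht⟩ := hpos n (by positivity)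
      push_cast
      have ha1 : (1 : ℝ) ≤ a n := by
        rw [ha]
        exact_mod_cast Int.le_floor.2 (by exact_mod_cast h1.le)
      have hle : (a n : ℝ) ≤ Δs n := by rw [ha]; exact Int.floor_le _
      have hlt : Δs n < a n + 1 := by rw [ha]; exact Int.lt_floor_add_one _
      have hirr : Irrational (Δs n - a n) := hi.sub_intCast _
      have hpos' : 0 < Δs n - a n := lt_of_le_of_ne (by linarith) hirr.ne_zero.symm
      have hirr' : Irrational (Δs (n + 1)) := by
        rw [hs, one_div]; exact hirr.inv
      have hx1 : 1 < Δs (n + 1) := by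
        rw [hs, lt_div_iff₀ hpos']; linarith
      have hden : 0 < a n - Δts n := by linarith
      have hy1 : -1 < Δts (n + 1) := by
        rw [ht, lt_div_iff₀ hden]; linarith
      have hy0 : Δts (n + 1) < 0 := by
        rw [ht]; exact div_neg_of_neg_of_pos (by norm_num) hden
      have ex : Δs n = a n + 1 / Δs (n + 1) := by rw [hs]; simp
      have ey : Δts n = a n + 1 / Δts (n + 1) := by
        rw [ht, one_div_div]; ring
      refine ⟨hirr', hx1, hy1, hy0, ?_⟩
      have hx0 : 0 < Δs (n + 1) := by linarith
      rw [disp_step _ _ _ _ _ hx0 hy0 ex ey, det_step _ _ _ _ _ hx0 hy0 ex ey] at hd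
      have hyn : 0 < -Δts (n + 1) := by linarith
      have hk : ENNReal.ofReal ((Δs (n + 1))⁻¹ * (-Δts (n + 1))⁻¹) ≠ 0 := by
        rw [ne_eq, ENNReal.ofReal_eq_zero, not_le]; positivity
      refine (ENNReal.mul_right_inj hk ENNReal.ofReal_ne_top).1 ?_
      rw [mul_left_comm, hd, mul_assoc]
  have bwd : ∀ n : ℕ, Irrational (Δts (-n)) ∧ 1 < Δs (-n) ∧ -1 < Δts (-n) ∧ Δts (-n) < 0 ∧
      ENNReal.ofReal (Δ - Δt) * disp (latticeGen (1, 1) (-Δs (-n), -Δts (-n))) =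
        ENNReal.ofReal (Δs (-n) - Δts (-n)) * disp (latticeGen (1, 1) (-Δ, -Δt)) := by
    intro n
    induction n with
    | zero =>
      simp only [Nat.cast_zero, neg_zero, h0, h0t]
      exact ⟨hΔtirr, hΔ1, hΔtmem.1, hΔtmem.2, trivial⟩
    | succ n ih =>
      obtain ⟨hi, h1, hm, hn, hd⟩ := ih
      obtain ⟨ha, ht, hs⟩ := hneg (-n) (by simp)
      have e : (-((n + 1 : ℕ) : ℤ)) = -n - 1 := by push_cast; ring
      rw [e]
      have hyn : 0 < -Δts (-n) := by linarith
      have hq : -1 / Δts (-n) = 1 / (-Δts (-n)) := by rw [neg_div, div_neg]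
      have hq1 : 1 ≤ -1 / Δts (-n) := by
        rw [hq, le_div_iff₀ hyn]; linarith
      have ha1 : (1 : ℝ) ≤ a (-n - 1) := by
        rw [ha]
        exact_mod_cast Int.le_floor.2 (by exact_mod_cast hq1)
      have hle : (a (-n - 1) : ℝ) ≤ -1 / Δts (-n) := by rw [ha]; exact Int.floor_le _
      have hlt : -1 / Δts (-n) < a (-n - 1) + 1 := by rw [ha]; exact Int.lt_floor_add_one _
      have hq2 : -1 / Δts (-n) = -(1 / Δts (-n)) := neg_div _ _
      have hirr : Irrational (Δts (-n - 1)) := by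
        rw [ht, one_div]; exact hi.inv.intCast_add _
      have hx0 : 0 < Δs (-n) := by linarith
      have hxi : 0 < 1 / Δs (-n) := by positivity
      refine ⟨hirr, by linarith, by linarith, lt_of_le_of_ne (by linarith) hirr.ne_zero, ?_⟩
      rw [disp_step _ _ _ _ _ hx0 hn hs ht, det_step _ _ _ _ _ hx0 hn hs ht,
        mul_left_comm, hd, mul_assoc]
  intro i
  obtain ⟨n, rfl | rfl⟩ := i.eq_nat_or_neg
  · exact (fwd n).2.2.2.2
  · exact (bwd n).2.2.2.2
end

section
/- Let t, m ∈ ℤ with D = t² − 4m > 0 not a perfect square, Δ = (t+√D)/2, Δ̄ = (t−√D)/2, and assume Δ > 1 and −1 < Δ̄ < 0 (so Δ is a purely periodic quadratic integer). Let (aᵢ)ᵢ≥₀ be the continued fraction coefficients of Δ, and let l ≥ 1 be the least integer with Δ_l = Δ (the period length). Then for every i with 0 < i < l: aᵢ ≤ ⌊(Δ − Δ̄)/2⌋ = ⌊a₀/2 − Δ̄⌋; in particular aᵢ ≤ ⌈a₀/2⌉. (Here a₀ = ⌊Δ⌋ = t = Δ + Δ̄.) -/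
/-- Size bound for the continued fraction coefficients of a purely periodic
quadratic integer Δ = (t+√D)/2 with conjugate Δ̄ = (t−√D)/2: within a period,
aᵢ ≤ ⌊(Δ−Δ̄)/2⌋ = ⌊a₀/2 − Δ̄⌋, and in particular aᵢ ≤ ⌈a₀/2⌉. -/
theorem stmt13 (t m : ℤ) (Δ Δb : ℝ)
    (hD : 0 < t ^ 2 - 4 * m) (hsq : ¬∃ k : ℤ, k ^ 2 = t ^ 2 - 4 * m)
    (hΔ : Δ = ((t : ℝ) + Real.sqrt ((t : ℝ) ^ 2 - 4 * (m : ℝ))) / 2)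
    (hΔb : Δb = ((t : ℝ) - Real.sqrt ((t : ℝ) ^ 2 - 4 * (m : ℝ))) / 2)
    (h1 : 1 < Δ) (h2 : -1 < Δb) (h3 : Δb < 0)
    (a : ℕ → ℤ) (Δs : ℕ → ℝ) (h0 : Δs 0 = Δ)
    (hrec : ∀ i : ℕ, a i = ⌊Δs i⌋ ∧ Δs (i + 1) = 1 / (Δs i - a i))
    (l : ℕ) (hl : 1 ≤ l) (hper : Δs l = Δ) (hmin : ∀ k : ℕ, 1 ≤ k → k < l → Δs k ≠ Δ) :
    ∀ i : ℕ, 0 < i → i < l →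
      a i ≤ ⌊(Δ - Δb) / 2⌋ ∧
      ⌊(Δ - Δb) / 2⌋ = ⌊(a 0 : ℝ) / 2 - Δb⌋ ∧
      a i ≤ ⌈(a 0 : ℝ) / 2⌉ := by
  set s := Real.sqrt ((t : ℝ) ^ 2 - 4 * (m : ℝ)) with hs
  have hDR : (0 : ℝ) < (t : ℝ) ^ 2 - 4 * (m : ℝ) := by exact_mod_cast hD
  have hss : s * s = (t : ℝ) ^ 2 - 4 * (m : ℝ) := Real.mul_self_sqrt hDR.le
  have hsum : Δ + Δb = t := by rw [hΔ, hΔb]; ring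
  have hprod : Δ * Δb = m := by rw [hΔ, hΔb]; linear_combination (-1 / 4) * hss
  have hirr : ∀ k : ℤ, (k : ℝ) + Δ ≠ 0 := by
    intro k hk
    apply hsq
    refine ⟨2 * k + t, ?_⟩
    have hsk : s = -(2 * k + t) := by rw [hΔ] at hk; linarith
    rw [hsk] at hss
    have : ((2 * k + t : ℝ)) ^ 2 = (t : ℝ) ^ 2 - 4 * (m : ℝ) := by linarith
    exact_mod_cast this
  have inv : ∀ i : ℕ, ∃ p q : ℤ, 0 < q ∧ q ∣ p ^ 2 + p * t + m ∧
      (q : ℝ) * Δs i = p + Δ ∧ 1 < Δs i ∧ -(q : ℝ) < p + Δb ∧ (p : ℝ) + Δb < 0 := by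
    intro i
    induction i with
    | zero =>
      refine ⟨0, 1, by norm_num, one_dvd _, ?_, ?_, ?_, ?_⟩
      · simp [h0]
      · rw [h0]; exact h1
      · simpa using h2
      · simpa using h3
    | succ i ih =>
      obtain ⟨p, q, hq, hdvd, hx, hx1, hc1, hc2⟩ := ih
      obtain ⟨ha, hn⟩ := hrec i
      have hqR : (0 : ℝ) < q := by exact_mod_cast hq
      have ha1 : 1 ≤ a i := by
        rw [ha]; apply Int.le_floor.mpr; push_cast; exact hx1.le
      have ha1R : (1 : ℝ) ≤ a i := by exact_mod_cast ha1
      have hle : (a i : ℝ) ≤ Δs i := by rw [ha]; exact Int.floor_le _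
      have hlt : Δs i < a i + 1 := by rw [ha]; exact Int.lt_floor_add_one _
      obtain ⟨r, hr⟩ : q ∣ (p - a i * q) ^ 2 + (p - a i * q) * t + m := by
        have : (p - a i * q) ^ 2 + (p - a i * q) * t + m
            = (p ^ 2 + p * t + m) + q * (-2 * p * a i + a i ^ 2 * q - a i * t) := by ring
        rw [this]
        exact dvd_add hdvd (dvd_mul_right _ _)
      have hp' : ((p - a i * q : ℤ) : ℝ) + Δ = q * (Δs i - a i) := by
        push_cast; linear_combination -hx
      generalize hpd : p - a i * q = p' at *
      have hne : Δs i - a i ≠ 0 := by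
        intro h; apply hirr p'; rw [hp', h, mul_zero]
      have hy0 : 0 < Δs i - a i := lt_of_le_of_ne (by linarith) hne.symm
      have hrR : (p' : ℝ) ^ 2 + p' * t + m = q * r := by exact_mod_cast hr
      have hr2 : (r : ℝ) = (p' + Δb) * (Δs i - a i) := by
        apply mul_left_cancel₀ hqR.ne'
        rw [← hrR, ← hsum, ← hprod]
        linear_combination (p' + Δb) * hp'
      have hcb : (p' : ℝ) + Δb < -q := by
        have : (p' : ℝ) = p - a i * q := by rw [← hpd]; push_cast; ring
        rw [this]; nlinarith
      have hrneg : (r : ℝ) < 0 := by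
        rw [hr2]; exact mul_neg_of_neg_of_pos (by linarith) hy0
      refine ⟨-p' - t, -r, ?_, ?_, ?_, ?_, ?_, ?_⟩
      · have : r < 0 := by exact_mod_cast hrneg
        omega
      · refine ⟨-q, ?_⟩
        linear_combination hr
      · rw [hn, mul_one_div, div_eq_iff hne]; push_cast
        rw [hr2, ← hsum]; ring
      · rw [hn, lt_div_iff₀ hy0]; linarith
      · push_cast
        have h := mul_lt_mul_of_pos_right hcb hy0
        rw [← hr2] at h
        linarith
      · push_cast
        have h := mul_pos hqR hy0
        linarith
  have ha0 : a 0 = t := by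
    rw [(hrec 0).1, h0, Int.floor_eq_iff]
    constructor <;> linarith
  intro i hi hil
  have key : (a i : ℝ) ≤ (Δ - Δb) / 2 := by
    obtain ⟨p, q, hq, hdvd, hx, hx1, hc1, hc2⟩ := inv i
    have hle : (a i : ℝ) ≤ Δs i := by rw [(hrec i).1]; exact Int.floor_le _
    have hq2 : 2 ≤ q := by
      by_contra hcon
      have hq1 : q = 1 := by omega
      subst hq1
      push_cast at *
      have hpl : (p : ℝ) < 1 := by linarith
      have hpg : (-1 : ℝ) < p := by linarith
      have hpl' : p < 1 := by exact_mod_cast hpl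
      have hpg' : -1 < p := by exact_mod_cast hpg
      have hp0 : p = 0 := by omega
      subst hp0
      apply hmin i hi hil
      push_cast at hx
      linarith
    have hq2R : (2 : ℝ) ≤ q := by exact_mod_cast hq2
    nlinarith
  have heq : (Δ - Δb) / 2 = (a 0 : ℝ) / 2 - Δb := by rw [ha0, ← hsum]; ring
  refine ⟨Int.le_floor.mpr key, by rw [heq], ?_⟩
  have hc := Int.le_ceil ((a 0 : ℝ) / 2)
  have : (a i : ℝ) < (⌈(a 0 : ℝ) / 2⌉ : ℝ) + 1 := by linarith
  have h' : a i < ⌈(a 0 : ℝ) / 2⌉ + 1 := by exact_mod_cast this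
  omega
end

section
/- Let d ≥ 2 be an integer that is not a perfect square, and let (aᵢ)ᵢ≥₀ be the continued fraction coefficients of √d (so a₀ = ⌊√d⌋). Then for every i ≥ 1, either aᵢ = 2a₀ or aᵢ ≤ a₀. (Equivalently: in the expansion √d = [a₀; a₁, …, a_{l−1}, 2a₀ repeating], all partial quotients within a period other than the final 2a₀ are at most a₀.) -/
/-- In the continued fraction expansion of √d (d not a perfect square), every
partial quotient aᵢ with i ≥ 1 is either 2a₀ or at most a₀ = ⌊√d⌋. -/
theorem stmt14 (d : ℕ) (hd : 2 ≤ d) (hsq : ¬∃ k : ℕ, k ^ 2 = d)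
    (a : ℕ → ℤ) (Δs : ℕ → ℝ) (h0 : Δs 0 = Real.sqrt d)
    (hrec : ∀ i : ℕ, a i = ⌊Δs i⌋ ∧ Δs (i + 1) = 1 / (Δs i - a i)) :
    ∀ i : ℕ, 1 ≤ i → a i = 2 * a 0 ∨ a i ≤ a 0 := by
  have hs2 : Real.sqrt d * Real.sqrt d = d := Real.mul_self_sqrt (Nat.cast_nonneg d)
  have hs1 : 1 < Real.sqrt d := by
    rw [Real.lt_sqrt (by norm_num)]
    have : (2 : ℝ) ≤ d := by exact_mod_cast hd
    linarith
  have hne : ∀ P : ℤ, Real.sqrt d ≠ P := by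
    intro P hP
    rw [hP] at hs2
    have h2 : P * P = (d : ℤ) := by exact_mod_cast hs2
    apply hsq
    refine ⟨P.natAbs, ?_⟩
    zify
    rw [sq_abs, sq, h2]
  generalize Real.sqrt d = s at *
  have key : ∀ i : ℕ, ∃ P Q : ℤ, 0 < Q ∧ (P : ℝ) < s ∧ (Q : ℝ) < P + s ∧
      Q ∣ (d : ℤ) - P ^ 2 ∧ Δs i = (P + s) / Q ∧ (1 ≤ i → s - P < Q) := by
    intro i
    induction i with
    | zero => exact ⟨0, 1, by norm_num, by push_cast; linarith, by push_cast; linarith,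
        by simp, by simp [h0], by simp⟩
    | succ i ih =>
      obtain ⟨P, Q, hQ, hP, hQP, ⟨R, hR⟩, hΔ, -⟩ := ih
      obtain ⟨ha, hn⟩ := hrec i
      generalize a i = A at *
      have hQr : (0 : ℝ) < Q := by exact_mod_cast hQ
      have hA1 : 1 ≤ A := by
        rw [ha, Int.le_floor, hΔ, le_div_iff₀ hQr]
        push_cast; linarith
      have hfl : (A : ℝ) ≤ Δs i := by rw [ha]; exact Int.floor_le _
      have hfu : Δs i < A + 1 := by rw [ha]; exact Int.lt_floor_add_one _
      rw [hΔ, le_div_iff₀ hQr] at hfl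
      rw [hΔ, div_lt_iff₀ hQr] at hfu
      have hA1r : (1 : ℝ) ≤ A := by exact_mod_cast hA1
      have hAQ : (Q : ℝ) ≤ A * Q := by nlinarith
      have hne' := hne (A * Q - P)
      push_cast at hne'
      have hlt : (A * Q - P : ℝ) < s :=
        lt_of_le_of_ne (by linarith) (fun h => hne' h.symm)
      have hprodZ : Q * (R + 2 * A * P - A ^ 2 * Q) = (d : ℤ) - (A * Q - P) ^ 2 := by
        linear_combination -hR
      have hprod : (Q : ℝ) * ((R + 2 * A * P - A ^ 2 * Q : ℤ) : ℝ)
          = (s - (A * Q - P)) * (s + (A * Q - P)) := by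
        have : ((Q * (R + 2 * A * P - A ^ 2 * Q) : ℤ) : ℝ)
          = (((d : ℤ) - (A * Q - P) ^ 2 : ℤ) : ℝ) := by rw [hprodZ]
        rw [Int.cast_mul] at this
        rw [this]; push_cast
        linear_combination -hs2
      generalize R + 2 * A * P - A ^ 2 * Q = Q' at *
      have h1 : 0 < s - (A * Q - P : ℝ) := by linarith
      have h2 : (Q : ℝ) < s + (A * Q - P : ℝ) := by linarith
      have h3 : s - (A * Q - P : ℝ) < Q := by linarith
      have hQ' : (0 : ℝ) < Q' := by
        have : 0 < (Q : ℝ) * Q' := by rw [hprod]; exact mul_pos h1 (by linarith)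
        exact (mul_pos_iff_of_pos_left hQr).1 this
      refine ⟨A * Q - P, Q', by exact_mod_cast hQ', by push_cast; exact hlt, ?_,
        ⟨Q, by rw [← hprodZ]; ring⟩, ?_, fun _ => ?_⟩
      · push_cast
        by_contra hc
        push Not at hc
        nlinarith
      · rw [hn, hΔ]
        have e : (P + s) / Q - A = (s - (A * Q - P : ℝ)) / Q := by field_simp; ring
        rw [e, one_div_div, div_eq_div_iff h1.ne' hQ'.ne', hprod]
        push_cast; ring
      · push_cast
        by_contra hc
        push Not at hc
        nlinarith
  intro i hi
  obtain ⟨P, Q, hQ, hP, hQP, -, hΔ, hlt⟩ := key i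
  have hlt := hlt hi
  have hQr : (0 : ℝ) < Q := by exact_mod_cast hQ
  have ha0 := (hrec 0).1
  rw [h0] at ha0
  have hai := (hrec i).1
  rcases (show Q = 1 ∨ 2 ≤ Q by omega) with h | h
  · left
    subst h
    have hPa : ⌊s⌋ = P := by
      rw [Int.floor_eq_iff]
      push_cast at hlt
      constructor <;> linarith
    rw [hai, hΔ, ha0, Int.cast_one, div_one, Int.floor_intCast_add, hPa]
    ring
  · right
    have h2 : (2 : ℝ) ≤ Q := by exact_mod_cast h
    rw [hai, ha0]
    apply Int.floor_le_floor
    rw [hΔ, div_le_iff₀ hQr]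
    nlinarith
end

section
/- Let t, m ∈ ℤ with D = t² − 4m > 0 not a perfect square, Δ = (t+√D)/2, Δ̄ = (t−√D)/2, and assume Δ > 1 and −1 < Δ̄ < 0 (so Δ is a purely periodic quadratic integer with period length l, the least positive integer with Δ_l = Δ). Let (pᵢ), (qᵢ) be the convergent sequences of Δ. Then for every integer i ≥ 0: (−1)ⁱ·(pᵢ² − t·pᵢqᵢ + m·qᵢ²) = 1 if and only if l divides i. (Here pᵢ² − t pᵢ qᵢ + m qᵢ² = N(pᵢ − qᵢΔ) = (pᵢ − qᵢΔ)(pᵢ − qᵢΔ̄) is the field norm.) -/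
/-- For a purely periodic quadratic integer Δ (root of x² − tx + m) with period
length l and convergents pᵢ/qᵢ (here pᵢ = P (i+1), qᵢ = Q (i+1) with P 0 = p₋₁ = 0,
P 1 = p₀ = 1, Q 0 = q₋₁ = 1, Q 1 = q₀ = 0): (−1)ⁱ·N(pᵢ − qᵢΔ) = 1 iff l ∣ i, where
N(pᵢ − qᵢΔ) = pᵢ² − t·pᵢqᵢ + m·qᵢ². -/
theorem stmt15 (t m : ℤ) (Δ Δb : ℝ)
    (hD : 0 < t ^ 2 - 4 * m) (hsq : ¬∃ k : ℤ, k ^ 2 = t ^ 2 - 4 * m)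
    (hΔ : Δ = ((t : ℝ) + Real.sqrt ((t : ℝ) ^ 2 - 4 * (m : ℝ))) / 2)
    (hΔb : Δb = ((t : ℝ) - Real.sqrt ((t : ℝ) ^ 2 - 4 * (m : ℝ))) / 2)
    (h1 : 1 < Δ) (h2 : -1 < Δb) (h3 : Δb < 0)
    (a : ℕ → ℤ) (Δs : ℕ → ℝ) (h0 : Δs 0 = Δ)
    (hrec : ∀ i : ℕ, a i = ⌊Δs i⌋ ∧ Δs (i + 1) = 1 / (Δs i - a i))
    (l : ℕ) (hl : 1 ≤ l) (hper : Δs l = Δ) (hmin : ∀ k : ℕ, 1 ≤ k → k < l → Δs k ≠ Δ)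
    (P Q : ℕ → ℤ) (hP0 : P 0 = 0) (hP1 : P 1 = 1) (hQ0 : Q 0 = 1) (hQ1 : Q 1 = 0)
    (hPrec : ∀ i : ℕ, P (i + 2) = a i * P (i + 1) + P i)
    (hQrec : ∀ i : ℕ, Q (i + 2) = a i * Q (i + 1) + Q i) :
    ∀ i : ℕ,
      ((-1 : ℤ) ^ i * (P (i + 1) ^ 2 - t * P (i + 1) * Q (i + 1) + m * Q (i + 1) ^ 2) = 1
        ↔ l ∣ i) := by
  have hcast : (t : ℝ) ^ 2 - 4 * (m : ℝ) = ((t ^ 2 - 4 * m : ℤ) : ℝ) := by push_cast; ring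
  have hnn : (0 : ℝ) ≤ (t : ℝ) ^ 2 - 4 * (m : ℝ) := by
    rw [hcast]; exact_mod_cast hD.le
  have hsum : Δ + Δb = t := by rw [hΔ, hΔb]; ring
  have hprod : Δ * Δb = m := by
    have := Real.mul_self_sqrt hnn
    rw [hΔ, hΔb]; linear_combination (-1 / 4) * this
  have hirr : Irrational Δ := by
    have h : Irrational (Real.sqrt ((t ^ 2 - 4 * m : ℤ) : ℝ)) := by
      rw [irrational_sqrt_intCast_iff]
      refine ⟨?_, hD.le⟩
      rintro ⟨k, hk⟩
      exact hsq ⟨k, by rw [hk]; ring⟩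
    rw [← hcast] at h
    rintro ⟨r, hr⟩
    refine h ⟨2 * r - t, ?_⟩
    push_cast
    rw [hr, hΔ]; ring
  have hirrs : ∀ i, Irrational (Δs i) := by
    intro i
    induction i with
    | zero => rw [h0]; exact hirr
    | succ n ih =>
      rw [(hrec n).2, one_div]
      exact (ih.sub_intCast (a n)).inv
  have hne : ∀ i, Δs i - a i ≠ 0 := fun i => ((hirrs i).sub_intCast (a i)).ne_zero
  have hgt : ∀ i, 1 < Δs i := by
    intro i
    cases i with
    | zero => rw [h0]; exact h1
    | succ n =>
      have ha := (hrec n).1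
      have hf1 : (a n : ℝ) ≤ Δs n := by rw [ha]; exact Int.floor_le _
      have hf2 : Δs n < a n + 1 := by rw [ha]; exact Int.lt_floor_add_one _
      have hpos : 0 < Δs n - a n := lt_of_le_of_ne (by linarith) (hne n).symm
      rw [(hrec n).2, lt_div_iff₀ hpos]
      linarith
  have ha1 : ∀ i, (1 : ℝ) ≤ a i := by
    intro i
    have : (1 : ℤ) ≤ a i := by
      rw [(hrec i).1, Int.le_floor]; exact_mod_cast (hgt i).le
    exact_mod_cast this
  -- the conjugate quotients
  have hconj : ∀ i, ∃ d : ℝ, -1 < d ∧ d < 0 ∧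
      (P i - Q i * Δb : ℝ) = -d * (P (i + 1) - Q (i + 1) * Δb) := by
    intro i
    induction i with
    | zero => exact ⟨Δb, h2, h3, by simp [hP0, hP1, hQ0, hQ1]⟩
    | succ n ih =>
      obtain ⟨d, hd1, hd2, hd⟩ := ih
      have han := ha1 n
      have hneg : d - a n < 0 := by linarith
      refine ⟨1 / (d - a n), ?_, ?_, ?_⟩
      · rw [lt_div_iff_of_neg hneg]; linarith
      · exact div_neg_of_pos_of_neg one_pos hneg
      · rw [hPrec, hQrec]
        push_cast
        have := hneg.ne
        field_simp
        linear_combination hd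
  have hquot : ∀ i, (P i - Q i * Δ : ℝ) = -Δs i * (P (i + 1) - Q (i + 1) * Δ) := by
    intro i
    induction i with
    | zero => simp [hP0, hP1, hQ0, hQ1, h0]
    | succ n ih =>
      rw [hPrec, hQrec, (hrec n).2]
      push_cast
      have := hne n
      field_simp
      linear_combination ih
  have hdet : ∀ i, P (i + 1) * Q i - P i * Q (i + 1) = (-1) ^ i := by
    intro i
    induction i with
    | zero => simp [hP0, hP1, hQ0, hQ1]
    | succ n ih =>
      rw [hPrec, hQrec, pow_succ, ← ih]; ring
  have hkey : ∀ i, ((-1 : ℤ) ^ i * (P (i + 1) ^ 2 - t * P (i + 1) * Q (i + 1)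
      + m * Q (i + 1) ^ 2) = 1 ↔ Δs i = Δ) := by
    intro i
    obtain ⟨d, hd1, hd2, hd⟩ := hconj i
    have hq := hquot i
    have hdt : ((P (i + 1) * Q i - P i * Q (i + 1) : ℝ)) = (-1) ^ i := by exact_mod_cast hdet i
    have hs : ((-1 : ℝ) ^ i) * (-1) ^ i = 1 := by
      rw [← mul_pow]; simp
    obtain ⟨N, hN⟩ : ∃ N : ℤ, N = (-1 : ℤ) ^ i * (P (i + 1) ^ 2 - t * P (i + 1) * Q (i + 1)
      + m * Q (i + 1) ^ 2) := ⟨_, rfl⟩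
    obtain ⟨C, hC⟩ : ∃ C : ℤ, C = (-1 : ℤ) ^ i * (P i * P (i + 1) - t * P i * Q (i + 1)
      + m * Q i * Q (i + 1)) := ⟨_, rfl⟩
    rw [← hN]
    have hN' : (N : ℝ) = (-1) ^ i * ((P (i + 1) - Q (i + 1) * Δ) * (P (i + 1) - Q (i + 1) * Δb)) := by
      rw [hN]; push_cast; rw [← hsum, ← hprod]; ring
    have hC' : (C : ℝ) = (-1) ^ i * (P i * P (i + 1) - (Δ + Δb) * P i * Q (i + 1)
      + Δ * Δb * Q i * Q (i + 1)) := by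
      rw [hC]; push_cast; rw [← hsum, ← hprod]
    have e1 : N * Δs i = Δ - C := by
      rw [hN', hC']
      linear_combination ((-1) ^ i * (P (i + 1) - Q (i + 1) * Δb)) * hq
        + ((-1) ^ i * Δ) * hdt + Δ * hs
    have e2 : N * d = Δb - C := by
      rw [hN', hC']
      linear_combination ((-1) ^ i * (P (i + 1) - Q (i + 1) * Δ)) * hd
        + ((-1) ^ i * Δb) * hdt + Δb * hs
    constructor
    · intro h
      rw [h] at e1 e2
      push_cast at e1 e2
      have c1 : (C : ℝ) < 1 := by linarith
      have c2 : (-1 : ℝ) < C := by linarith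
      have c1' : C < 1 := by exact_mod_cast c1
      have c2' : -1 < C := by exact_mod_cast c2
      have c0 : C = 0 := by omega
      rw [c0] at e1
      push_cast at e1
      linarith
    · intro h
      rw [h] at e1
      by_contra hN1
      have hz : N - 1 ≠ 0 := sub_ne_zero.mpr hN1
      refine (hirr.intCast_mul hz).ne_int (-C) ?_
      push_cast
      linear_combination e1
  have hstep : ∀ i, Δs (i + l) = Δs i := by
    intro i
    induction i with
    | zero => rw [zero_add, hper, h0]
    | succ n ih =>
      rw [show n + 1 + l = (n + l) + 1 by ring, (hrec (n + l)).2, (hrec n).2,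
        (hrec (n + l)).1, (hrec n).1, ih]
  have hmul : ∀ k i, Δs (i + l * k) = Δs i := by
    intro k
    induction k with
    | zero => intro i; simp
    | succ n ih =>
      intro i
      rw [show i + l * (n + 1) = (i + l * n) + l by ring, hstep, ih]
  intro i
  rw [hkey]
  constructor
  · intro h
    rw [← Nat.mod_add_div i l, hmul] at h
    by_contra hnd
    have hpos : 1 ≤ i % l := Nat.one_le_iff_ne_zero.mpr fun hh => hnd (Nat.dvd_of_mod_eq_zero hh)
    exact hmin _ hpos (Nat.mod_lt _ hl) h
  · rintro ⟨k, rfl⟩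
    have := hmul k 0
    rw [zero_add] at this
    rw [this, h0]
end

section
/- Let Δ be a quadratic irrational (an irrational root of a quadratic polynomial with rational coefficients) with algebraic conjugate Δ̄ (the other root), and assume Δ > 1 and −1 < Δ̄ < 0 (so the continued fraction of Δ is purely periodic). Let (aᵢ)ᵢ≥₀ be its continued fraction coefficients and (pᵢ), (qᵢ) its convergent sequences. Then for every i ≥ 0: (Δ − Δ̄)/(aᵢ + 2) ≤ |(pᵢ − qᵢΔ)(pᵢ − qᵢΔ̄)| ≤ (Δ − Δ̄)/aᵢ. -/
/-- For a purely periodic quadratic irrational Δ with conjugate Δ̄ and convergents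
pᵢ/qᵢ (here pᵢ = P (i+1), qᵢ = Q (i+1) with P 0 = p₋₁ = 0, P 1 = p₀ = 1,
Q 0 = q₋₁ = 1, Q 1 = q₀ = 0):
(Δ − Δ̄)/(aᵢ + 2) ≤ |(pᵢ − qᵢΔ)(pᵢ − qᵢΔ̄)| ≤ (Δ − Δ̄)/aᵢ for every i ≥ 0. -/
theorem stmt16 (Δ Δb : ℝ) (b c : ℚ)
    (hΔirr : Irrational Δ)
    (hroot : Δ ^ 2 + (b : ℝ) * Δ + (c : ℝ) = 0)
    (hrootb : Δb ^ 2 + (b : ℝ) * Δb + (c : ℝ) = 0)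
    (hne : Δ ≠ Δb)
    (h1 : 1 < Δ) (h2 : -1 < Δb) (h3 : Δb < 0)
    (a : ℕ → ℤ) (Δs : ℕ → ℝ) (h0 : Δs 0 = Δ)
    (hrec : ∀ i : ℕ, a i = ⌊Δs i⌋ ∧ Δs (i + 1) = 1 / (Δs i - a i))
    (P Q : ℕ → ℤ) (hP0 : P 0 = 0) (hP1 : P 1 = 1) (hQ0 : Q 0 = 1) (hQ1 : Q 1 = 0)
    (hPrec : ∀ i : ℕ, P (i + 2) = a i * P (i + 1) + P i)
    (hQrec : ∀ i : ℕ, Q (i + 2) = a i * Q (i + 1) + Q i) :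
    ∀ i : ℕ,
      (Δ - Δb) / ((a i : ℝ) + 2) ≤
          |((P (i + 1) : ℝ) - (Q (i + 1) : ℝ) * Δ) * ((P (i + 1) : ℝ) - (Q (i + 1) : ℝ) * Δb)| ∧
      |((P (i + 1) : ℝ) - (Q (i + 1) : ℝ) * Δ) * ((P (i + 1) : ℝ) - (Q (i + 1) : ℝ) * Δb)| ≤
          (Δ - Δb) / (a i : ℝ) := by
  have key : ∀ i : ℕ, Irrational (Δs i) ∧ 1 < Δs i ∧
      ((P i : ℝ) - Q i * Δ) = - Δs i * ((P (i + 1) : ℝ) - Q (i + 1) * Δ) ∧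
      0 < ((P i : ℝ) - Q i * Δb) ∧
      ((P i : ℝ) - Q i * Δb) < ((P (i + 1) : ℝ) - Q (i + 1) * Δb) ∧
      |((P i : ℝ) - Q i * Δ) * ((P (i + 1) : ℝ) - Q (i + 1) * Δb)
        - ((P (i + 1) : ℝ) - Q (i + 1) * Δ) * ((P i : ℝ) - Q i * Δb)| = Δ - Δb := by
    intro i
    induction i with
    | zero =>
      simp only [zero_add, h0, hP0, hP1, hQ0, hQ1]
      refine ⟨hΔirr, h1, by simp, by simpa using h3, by simp; linarith, ?_⟩
      rw [← abs_neg, abs_of_pos] <;> push_cast <;> linarith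
    | succ i ih =>
      obtain ⟨hi, hg, hu, hv, hv', hd⟩ := ih
      obtain ⟨ha, hs⟩ := hrec i
      have hP := hPrec i
      have hQ := hQrec i
      have hP' : (P (i + 2) : ℝ) = a i * P (i + 1) + P i := by exact_mod_cast hP
      have hQ' : (Q (i + 2) : ℝ) = a i * Q (i + 1) + Q i := by exact_mod_cast hQ
      have hirr : Irrational (Δs i - a i) := hi.sub_intCast (a i)
      have hnn : 0 ≤ Δs i - a i := by
        have := Int.floor_le (Δs i)
        rw [ha]; linarith
      have hpos : 0 < Δs i - a i := lt_of_le_of_ne hnn (Ne.symm hirr.ne_zero)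
      have hlt : Δs i - a i < 1 := by
        have := Int.lt_floor_add_one (Δs i)
        rw [ha]; linarith
      have ha1 : (1 : ℝ) ≤ a i := by
        have : (1 : ℤ) ≤ a i := by
          rw [ha]; exact Int.le_floor.mpr (by push_cast; linarith)
        exact_mod_cast this
      have hs1 : Δs (i + 1) * (Δs i - a i) = 1 := by
        rw [hs]; field_simp
      refine ⟨?_, ?_, ?_, by linarith, ?_, ?_⟩
      · rw [hs, one_div]; exact hirr.inv
      · rw [hs]; exact (one_lt_div hpos).mpr hlt
      · show _ = - Δs (i + 1) * ((P (i + 2) : ℝ) - Q (i + 2) * Δ)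
        rw [hP', hQ']
        linear_combination (-((P (i + 1) : ℝ) - Q (i + 1) * Δ)) * hs1 + Δs (i + 1) * hu
      · show _ < ((P (i + 2) : ℝ) - Q (i + 2) * Δb)
        rw [hP', hQ']
        nlinarith
      · show |_ * ((P (i + 2) : ℝ) - Q (i + 2) * Δb) - ((P (i + 2) : ℝ) - Q (i + 2) * Δ) * _| = _
        rw [hP', hQ', ← hd, ← abs_neg]
        congr 1
        ring
  intro i
  obtain ⟨hi, hg, hu, hv, hv', hd⟩ := key i
  have ha := (hrec i).1
  have hle : (a i : ℝ) ≤ Δs i := by rw [ha]; exact Int.floor_le _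
  have hlt : Δs i < a i + 1 := by rw [ha]; exact Int.lt_floor_add_one _
  have ha1 : (1 : ℝ) ≤ a i := by
    have : (1 : ℤ) ≤ a i := by
      rw [ha]; exact Int.le_floor.mpr (by push_cast; linarith)
    exact_mod_cast this
  rw [hu] at hd
  generalize ((P (i + 1) : ℝ) - Q (i + 1) * Δ) = u at *
  generalize ((P (i + 1) : ℝ) - Q (i + 1) * Δb) = w at *
  generalize ((P i : ℝ) - Q i * Δb) = v at *
  have hw : 0 < w := hv.trans hv'
  have hd2 : |u| * (Δs i * w + v) = Δ - Δb := by
    rw [← hd, show -Δs i * u * w - u * v = -(u * (Δs i * w + v)) by ring, abs_neg, abs_mul,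
      abs_of_pos (a := Δs i * w + v) (by positivity)]
  have hu0 := abs_nonneg u
  rw [abs_mul, abs_of_pos hw, div_le_iff₀ (by linarith), le_div_iff₀ (by linarith), ← hd2]
  constructor
  · rw [mul_assoc]
    apply mul_le_mul_of_nonneg_left _ hu0
    nlinarith
  · rw [mul_assoc]
    apply mul_le_mul_of_nonneg_left _ hu0
    nlinarith
end

section
/- The following are equivalent. (i) (Zaremba's conjecture) There exists A ∈ ℕ such that for every integer N ≥ 2 there exists an integer a with 1 ≤ a < N, gcd(a, N) = 1, and a/N has a continued fraction expansion a/N = [0; b₁, …, b_k] with all partial quotients bᵢ ≤ A. (ii) There exists a constant C > 0 such that for every integer n ≥ 2 there exists an integer p with 1 ≤ p < n, gcd(p, n) = 1, and the rank-1 lattice P_{n,p} satisfies disp_T(P_{n,p}) < C/n. -/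
/-- Periodic interval on the torus: I(u,v) = (u,v) if u ≤ v, and
I(u,v) = [0,v) ∪ (u,1) if v < u. -/
noncomputable def perInt (u v : ℝ) : Set ℝ :=
  if u ≤ v then Set.Ioo u v else Set.Ico 0 v ∪ Set.Ioo u 1

/-- Length of the periodic interval I(u,v). -/
noncomputable def perLen (u v : ℝ) : ℝ := if u ≤ v then v - u else 1 - u + v

/-- Periodic dispersion of a point set P ⊆ [0,1)²: the supremum of the areas of
periodic boxes disjoint from P. -/
noncomputable def dispT (P : Set (ℝ × ℝ)) : ENNReal :=
  sSup {A : ENNReal | ∃ x₁ x₂ y₁ y₂ : ℝ,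
    x₁ ∈ Set.Icc (0 : ℝ) 1 ∧ x₂ ∈ Set.Icc (0 : ℝ) 1 ∧
    y₁ ∈ Set.Icc (0 : ℝ) 1 ∧ y₂ ∈ Set.Icc (0 : ℝ) 1 ∧
    (∀ p ∈ P, ¬(p.1 ∈ perInt x₁ x₂ ∧ p.2 ∈ perInt y₁ y₂)) ∧
    A = ENNReal.ofReal (perLen x₁ x₂ * perLen y₁ y₂)}

/-- The rank-1 lattice P_{n,p} = {({kp/n}, k/n) : 0 ≤ k < n}. -/
def rank1Lattice (n p : ℕ) : Set (ℝ × ℝ) :=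
  {x | ∃ k : ℕ, k < n ∧ x = (Int.fract ((k : ℝ) * p / n), (k : ℝ) / n)}

/-- Value of the finite continued fraction [0; b₁, …, b_k] given by the list
[b₁, …, b_k]. -/
def cfVal : List ℕ → ℚ
  | [] => 0
  | b :: rest => 1 / (b + cfVal rest)

lemma perLen_bounds {u v : ℝ} (hu : u ∈ Set.Icc (0 : ℝ) 1) (hv : v ∈ Set.Icc (0 : ℝ) 1) :
    0 ≤ perLen u v ∧ perLen u v ≤ 1 := by
  obtain ⟨h1, h2⟩ := hu
  obtain ⟨h3, h4⟩ := hv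
  unfold perLen
  split_ifs with h <;> constructor <;> linarith

lemma fract_mem_perInt {u v z : ℝ} (hu : u ∈ Set.Icc (0 : ℝ) 1) (hv : v ∈ Set.Icc (0 : ℝ) 1)
    (h1 : u < z) (h2 : z < u + perLen u v) : Int.fract z ∈ perInt u v := by
  obtain ⟨hu0, hu1⟩ := hu
  obtain ⟨hv0, hv1⟩ := hv
  unfold perLen at h2
  unfold perInt
  split_ifs at h2 ⊢ with h
  · have : Int.fract z = z := by
      rw [Int.fract_eq_self]; constructor <;> linarith
    rw [this]; constructor <;> linarith
  · push Not at h
    rcases lt_or_ge z 1 with hz | hz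
    · have : Int.fract z = z := by
        rw [Int.fract_eq_self]; constructor <;> linarith
      rw [this]; right; constructor <;> linarith
    · have : Int.fract z = z - 1 := by
        rw [Int.fract_eq_iff]
        refine ⟨by linarith, by linarith, 1, by simp⟩
      rw [this]; left; constructor <;> linarith

/-- the lifted lattice projects to the rank-1 lattice -/
lemma lift_mem (n p : ℕ) (hn : 0 < n) (s t : ℤ) (h : (n : ℤ) ∣ s * p - t) :
    (Int.fract ((t : ℝ) / n), Int.fract ((s : ℝ) / n)) ∈ rank1Lattice n p := by
  have hnR : (n : ℝ) ≠ 0 := by positivity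
  have hnZ : (0 : ℤ) < n := by exact_mod_cast hn
  obtain ⟨m, hm⟩ := h
  have hk0 := Int.emod_nonneg s hnZ.ne'
  have hk1 := Int.emod_lt_of_pos s hnZ
  have hdm := Int.emod_add_mul_ediv s n
  obtain ⟨k, hk⟩ := Int.eq_ofNat_of_zero_le hk0
  have hkn : k < n := by omega
  have hs : (s : ℝ) = k + n * ((s / n : ℤ) : ℝ) := by
    rw [hk] at hdm; exact_mod_cast hdm.symm
  have ht : (t : ℝ) = s * p - n * m := by
    have : t = s * p - n * m := by linarith
    exact_mod_cast this
  refine ⟨k, hkn, ?_⟩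
  ext
  · simp only
    have : (t : ℝ) / n = (k : ℝ) * p / n + (((s / n) * p - m : ℤ) : ℝ) := by
      rw [ht, hs]; push_cast; field_simp; ring
    rw [this, Int.fract_add_intCast]
  · simp only
    have : (s : ℝ) / n = (k : ℝ) / n + ((s / n : ℤ) : ℝ) := by
      rw [hs]; field_simp
    rw [this, Int.fract_add_intCast, Int.fract_eq_self]
    constructor
    · positivity
    · rw [div_lt_one (by positivity)]; exact_mod_cast hkn

lemma cfVal_nonneg (L : List ℕ) : 0 ≤ cfVal L := by
  induction L with
  | nil => simp [cfVal]
  | cons b L ih => simp only [cfVal]; positivity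

lemma cover (N p q r q' r' : ℕ) (hN : 0 < N) (hdet : q * r' + q' * r = N)
    (ε : ℤ) (hε : ε = 1 ∨ ε = -1) (h1 : (N : ℤ) ∣ q * p - ε * r) (h2 : (N : ℤ) ∣ q' * p + ε * r')
    (X Y cx cy : ℝ) (hX : (r : ℝ) + r' < X) (hY : (q : ℝ) + q' < Y) :
    ∃ s t : ℤ, (N : ℤ) ∣ s * p - t ∧ |cx - t| < X / 2 ∧ |cy - s| < Y / 2 := by
  have hNR : (N : ℝ) ≠ 0 := by positivity
  have hdR : (q : ℝ) * r' + q' * r = N := by exact_mod_cast hdet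
  have hεR : (ε : ℝ) * ε = 1 := by rcases hε with h | h <;> simp [h]
  obtain ⟨α, hα⟩ : ∃ α : ℝ, α = (r' * cy + q' * ε * cx) / N := ⟨_, rfl⟩
  obtain ⟨β, hβ⟩ : ∃ β : ℝ, β = (r * cy - q * ε * cx) / N := ⟨_, rfl⟩
  have e1 : cy = α * q + β * q' := by
    rw [hα, hβ]; field_simp; linear_combination (-cy) * hdR
  have e2 : cx = ε * (α * r - β * r') := by
    rw [hα, hβ]; field_simp
    linear_combination (-cx) * hdR - cx * (q * r' + q' * r) * hεR
  have a1 := abs_le.1 (abs_sub_round α)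
  have b1 := abs_le.1 (abs_sub_round β)
  have hq : (0 : ℝ) ≤ q := by positivity
  have hq' : (0 : ℝ) ≤ q' := by positivity
  have hr : (0 : ℝ) ≤ r := by positivity
  have hr' : (0 : ℝ) ≤ r' := by positivity
  refine ⟨round α * q + round β * q', ε * (round α * r - round β * r'), ?_, ?_, ?_⟩
  · obtain ⟨c, hc⟩ := h1
    obtain ⟨d, hd⟩ := h2
    exact ⟨round α * c + round β * d, by linear_combination round α * hc + round β * hd⟩
  · have : cx - ((ε * (round α * r - round β * r') : ℤ) : ℝ)
        = ε * ((α - round α) * r - (β - round β) * r') := by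
      rw [e2]; push_cast; ring
    have habs : |(ε : ℝ)| = 1 := by rcases hε with h | h <;> simp [h]
    rw [this, abs_mul, habs, one_mul, abs_lt]
    constructor <;> nlinarith
  · have : cy - ((round α * q + round β * q' : ℤ) : ℝ)
        = ((α - round α) * q + (β - round β) * q') := by
      rw [e1]; push_cast; ring
    rw [this, abs_lt]
    constructor <;> nlinarith

lemma cover_induct (A N p : ℕ) (hN : 0 < N) (X Y cx cy : ℝ) (hX : 0 ≤ X) (hYN : Y ≤ N)
    (H : ∀ s t : ℤ, (N : ℤ) ∣ s * p - t → |cx - t| < X / 2 → |cy - s| < Y / 2 → False)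
    (L : List ℕ) : ∀ (q r q' r' : ℕ), (∀ b ∈ L, 1 ≤ b ∧ b ≤ A) → 0 < r' →
      cfVal L = (r : ℚ) / r' → Nat.gcd r r' = 1 → q * r' + q' * r = N → q' ≤ q →
      ∀ ε : ℤ, (ε = 1 ∨ ε = -1) → (N : ℤ) ∣ q * p - ε * r → (N : ℤ) ∣ q' * p + ε * r' →
      (q : ℝ) + q' < Y → X * Y ≤ 2 * (A + 2) * N := by
  induction L with
  | nil =>
    intro q r q' r' _ hr' hcf hg hdet hq ε _ _ _ hY
    have : r = 0 := by
      simp only [cfVal] at hcf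
      have h0 : (r' : ℚ) ≠ 0 := by positivity
      field_simp at hcf
      simpa using hcf.symm
    subst this
    simp at hg
    subst hg
    simp at hdet
    subst hdet
    have : (0 : ℝ) ≤ q' := by positivity
    linarith
  | cons b L ih =>
    intro q r q' r' hb hr' hcf hg hdet hq ε hε h1 h2 hY
    have hXle : X ≤ (r : ℝ) + r' := by
      by_contra hcon
      push Not at hcon
      obtain ⟨s, t, h3, h4, h5⟩ := cover N p q r q' r' hN hdet ε hε h1 h2 X Y cx cy hcon hY
      exact H s t h3 h4 h5
    obtain ⟨hb1, hbA⟩ := hb b (by simp)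
    have hL0 := cfVal_nonneg L
    have hr'Q : (0 : ℚ) < r' := by exact_mod_cast hr'
    have hbQ : (1 : ℚ) ≤ b := by exact_mod_cast hb1
    have hcf2 : (r' : ℚ) = r * (b + cfVal L) := by
      simp only [cfVal] at hcf
      have : (b + cfVal L) ≠ 0 := by positivity
      field_simp at hcf
      linarith
    have hr : 0 < r := by
      rcases Nat.eq_zero_or_pos r with h | h
      · subst h; simp at hcf2; omega
      · exact h
    have hrQ : (0 : ℚ) < r := by exact_mod_cast hr
    have hle : r * b ≤ r' := by
      have : (r : ℚ) * b ≤ r' := by rw [hcf2]; nlinarith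
      exact_mod_cast this
    obtain ⟨r2, hr2⟩ := Nat.exists_eq_add_of_le hle
    rcases le_or_gt Y ((b * q + q' : ℕ) + q : ℝ) with hc | hc
    · have hrr : (r : ℝ) ≤ r' := by
        have : r ≤ r' := by nlinarith
        exact_mod_cast this
      have hY2 : Y ≤ (A + 2) * q := by
        have i1 : (b * q + q' + q : ℕ) ≤ (A + 2) * q := by nlinarith
        have i2 : ((b * q + q' + q : ℕ) : ℝ) ≤ (A + 2) * q := by exact_mod_cast i1
        push_cast at i2 hc
        linarith
      have hqr : (q : ℝ) * r' ≤ N := by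
        have : q * r' ≤ N := by rw [← hdet]; omega
        exact_mod_cast this
      have hY0 : 0 ≤ Y := by
        have : (0 : ℝ) ≤ (q : ℝ) + q' := by positivity
        linarith
      calc X * Y ≤ (2 * r') * ((A + 2) * q) := by
            apply mul_le_mul _ hY2 hY0 (by positivity)
            linarith
        _ = 2 * (A + 2) * (q * r') := by ring
        _ ≤ _ := by gcongr
    · apply ih (b * q + q') r2 q r (fun x hx => hb x (by simp [hx])) hr _ _ _ _ (-ε) _ _ _ hc
      · have : (r' : ℚ) = r * b + r2 := by exact_mod_cast hr2
        rw [eq_div_iff hrQ.ne']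
        nlinarith
      · rw [hr2] at hg
        rw [Nat.gcd_comm]
        simpa using hg
      · rw [← hdet, hr2]; ring
      · nlinarith
      · rcases hε with h | h <;> simp [h]
      · obtain ⟨c, hc'⟩ := h1
        obtain ⟨d, hd⟩ := h2
        refine ⟨b * c + d, ?_⟩
        have : (r' : ℤ) = r * b + r2 := by exact_mod_cast hr2
        rw [this] at hd
        push_cast
        linear_combination b * hc' + hd
      · have : (q : ℤ) * p + -ε * r = q * p - ε * r := by ring
        rw [this]; exact h1

lemma disp_le (A N a : ℕ) (hN : 2 ≤ N) (hg : Nat.gcd a N = 1)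
    (L : List ℕ) (hb : ∀ b ∈ L, 1 ≤ b ∧ b ≤ A) (hcf : cfVal L = (a : ℚ) / N) :
    dispT (rank1Lattice N a) ≤ ENNReal.ofReal (2 * (A + 2) / N) := by
  apply sSup_le
  rintro _ ⟨x₁, x₂, y₁, y₂, hx1, hx2, hy1, hy2, hE, rfl⟩
  apply ENNReal.ofReal_le_ofReal
  have hN0 : 0 < N := by omega
  have hNR : (0 : ℝ) < N := by exact_mod_cast hN0
  obtain ⟨lx0, lx1⟩ := perLen_bounds hx1 hx2
  obtain ⟨ly0, ly1⟩ := perLen_bounds hy1 hy2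
  have hA : (0 : ℝ) ≤ A := by positivity
  suffices h : (N * perLen x₁ x₂) * (N * perLen y₁ y₂) ≤ 2 * (A + 2) * N by
    rw [le_div_iff₀ hNR]
    have : N * (perLen x₁ x₂ * perLen y₁ y₂ * N) ≤ N * (2 * (A + 2)) := by linarith
    exact le_of_mul_le_mul_left this hNR
  rcases le_or_gt (N * perLen y₁ y₂) 1 with hY | hY
  · have : (N * perLen x₁ x₂) * (N * perLen y₁ y₂) ≤ N * 1 := by
      apply mul_le_mul _ hY (by positivity) hNR.le
      nlinarith
    nlinarith
  · refine cover_induct A N a hN0 _ _ (N * x₁ + N * perLen x₁ x₂ / 2)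
      (N * y₁ + N * perLen y₁ y₂ / 2) (by positivity) (by nlinarith) ?_ L 1 a 0 N hb hN0 hcf hg
      (by simp) (by simp) 1 (by simp) (by simp) (by simp) (by simpa using hY)
    intro s t hst ht hs
    rw [abs_lt] at ht hs
    apply hE _ (lift_mem N a hN0 s t hst)
    refine ⟨fract_mem_perInt hx1 hx2 ?_ ?_, fract_mem_perInt hy1 hy2 ?_ ?_⟩
    · rw [lt_div_iff₀ hNR]; linarith [ht.2]
    · rw [div_lt_iff₀ hNR]; linarith [ht.1]
    · rw [lt_div_iff₀ hNR]; linarith [hs.2]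
    · rw [div_lt_iff₀ hNR]; linarith [hs.1]

/-- Small dispersion forbids short lattice vectors. -/
lemma merit (N p : ℕ) (hN : 2 ≤ N) (C : ℝ) (hC : 0 < C)
    (hd : dispT (rank1Lattice N p) < ENNReal.ofReal (C / N))
    (q r : ℕ) (hq : 0 < q) (hr : 0 < r) (ε : ℤ) (hε : ε = 1 ∨ ε = -1)
    (h1 : (N : ℤ) ∣ q * p - ε * r) : (N : ℝ) < 4 * C * (q * r) := by
  have hN0 : 0 < N := by omega
  have hNR : (0 : ℝ) < N := by exact_mod_cast hN0
  have hqR : (1 : ℝ) ≤ q := by exact_mod_cast hq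
  have hrR : (1 : ℝ) ≤ r := by exact_mod_cast hr
  have hq2 : 1 / (2 * (q : ℝ)) ≤ 1 := by rw [div_le_one (by positivity)]; linarith
  have hr2 : 1 / (2 * (r : ℝ)) ≤ 1 := by rw [div_le_one (by positivity)]; linarith
  have hq0 : 0 ≤ 1 / (2 * (q : ℝ)) := by positivity
  have hr0 : 0 ≤ 1 / (2 * (r : ℝ)) := by positivity
  -- arithmetic core
  have key : ∀ k : ℕ, ∀ w : ℤ, 0 < Int.fract ((k : ℝ) * p / N) →
      Int.fract ((k : ℝ) * p / N) < 1 / (2 * q) →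
      0 < -(ε : ℝ) * ((k : ℝ) / N - w) → -(ε : ℝ) * ((k : ℝ) / N - w) < 1 / (2 * r) → False := by
    intro k w f0 f1 g0 g1
    obtain ⟨c, hc⟩ := h1
    have hcR : (q : ℝ) * p - ε * r = N * c := by exact_mod_cast hc
    rw [lt_div_iff₀ (by positivity)] at f1 g1
    obtain ⟨m, hm⟩ : ∃ m : ℤ, Int.fract ((k : ℝ) * p / N) = (k : ℝ) * p / N - m :=
      ⟨_, rfl⟩
    rw [hm] at f0 f1
    have hz : ((k : ℝ) * p / N - m) * q + -(ε : ℝ) * ((k : ℝ) / N - w) * r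
        = ((k * c - m * q + ε * w * r : ℤ) : ℝ) := by
      push_cast
      field_simp
      linear_combination (k : ℝ) * hcR
    have z0 : (0 : ℝ) < ((k * c - m * q + ε * w * r : ℤ) : ℝ) := by
      rw [← hz]; positivity
    have z1 : ((k * c - m * q + ε * w * r : ℤ) : ℝ) < 1 := by
      rw [← hz]; linarith
    have z0' : (0 : ℤ) < k * c - m * q + ε * w * r := by exact_mod_cast z0
    have z1' : k * c - m * q + ε * w * r < (1 : ℤ) := by exact_mod_cast z1
    omega
  have area : 1 / (2 * (q : ℝ)) * (1 / (2 * r)) < C / N := by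
    have hmem : ENNReal.ofReal (1 / (2 * (q : ℝ)) * (1 / (2 * r))) ≤ dispT (rank1Lattice N p) := by
      apply le_sSup
      rcases hε with h | h
      · refine ⟨0, 1 / (2 * q), 1 - 1 / (2 * r), 1, ⟨by simp, by simp⟩, ⟨hq0, hq2⟩,
          ⟨by linarith, by linarith⟩, ⟨by simp, by simp⟩, ?_, ?_⟩
        · rintro _ ⟨k, hk, rfl⟩ ⟨ha, hb⟩
          simp only [perInt, if_pos hq0, if_pos (show 1 - 1 / (2 * (r : ℝ)) ≤ 1 by linarith)] at ha hb
          refine key k 1 ha.1 ha.2 ?_ ?_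
          · rw [h]; push_cast; linarith [hb.2]
          · rw [h]; push_cast; linarith [hb.1]
        · simp only [perLen, if_pos hq0, if_pos (show 1 - 1 / (2 * (r : ℝ)) ≤ 1 by linarith)]
          congr 1; ring
      · refine ⟨0, 1 / (2 * q), 0, 1 / (2 * r), ⟨by simp, by simp⟩, ⟨hq0, hq2⟩,
          ⟨by simp, by simp⟩, ⟨hr0, hr2⟩, ?_, ?_⟩
        · rintro _ ⟨k, hk, rfl⟩ ⟨ha, hb⟩
          simp only [perInt, if_pos hq0, if_pos hr0] at ha hb
          refine key k 0 ha.1 ha.2 ?_ ?_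
          · rw [h]; push_cast; linarith [hb.1]
          · rw [h]; push_cast; linarith [hb.2]
        · simp only [perLen, if_pos hq0, if_pos hr0]
          congr 1; ring
    have := lt_of_le_of_lt hmem hd
    exact (ENNReal.ofReal_lt_ofReal_iff (by positivity)).1 this
  have e : 1 / (2 * (q : ℝ)) * (1 / (2 * r)) = 1 / (4 * (q * r)) := by field_simp; norm_num
  rw [e, div_lt_div_iff₀ (by positivity) hNR] at area
  linarith

lemma build (N p K : ℕ)
    (H : ∀ q r : ℕ, 0 < q → 0 < r → ∀ ε : ℤ, (ε = 1 ∨ ε = -1) → (N : ℤ) ∣ q * p - ε * r →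
      N < K * (q * r)) :
    ∀ r : ℕ, ∀ q q' r' : ℕ, 0 < r → r < r' → 0 < q → q * r' + q' * r = N →
      ∀ ε : ℤ, (ε = 1 ∨ ε = -1) → (N : ℤ) ∣ q * p - ε * r → (N : ℤ) ∣ q' * p + ε * r' →
      ∃ L : List ℕ, L ≠ [] ∧ (∀ b ∈ L, 1 ≤ b ∧ b ≤ K) ∧ cfVal L = (r : ℚ) / r' := by
  intro r
  induction r using Nat.strong_induction_on with
  | _ r ih =>
    intro q q' r' hr hrr hq hdet ε hε h1 h2
    have hdm := Nat.div_add_mod r' r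
    have hml := Nat.mod_lt r' hr
    obtain ⟨b, hb⟩ : ∃ b, b = r' / r := ⟨_, rfl⟩
    obtain ⟨r2, hr2⟩ : ∃ r2, r2 = r' % r := ⟨_, rfl⟩
    rw [← hb, ← hr2] at hdm
    rw [← hr2] at hml
    have hb1 : 1 ≤ b := by rw [hb]; exact Nat.div_pos hrr.le hr
    have hbK : b ≤ K := by
      have h3 := H q r hq hr ε hε h1
      have h4 : b * (q * r) ≤ N := by rw [← hdet, ← hdm]; nlinarith [Nat.zero_le (q * r2), Nat.zero_le (q' * r)]
      by_contra hcon
      push Not at hcon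
      have : K * (q * r) ≤ b * (q * r) := Nat.mul_le_mul_right _ hcon.le
      omega
    have hrQ : (r : ℚ) ≠ 0 := by positivity
    have hdQ : (r' : ℚ) = r * b + r2 := by exact_mod_cast hdm.symm
    rcases Nat.eq_zero_or_pos r2 with h0 | h0
    · refine ⟨[b], by simp, by simp [hb1, hbK], ?_⟩
      have hbQ : (b : ℚ) ≠ 0 := by positivity
      simp only [cfVal, hdQ, h0]
      field_simp
      simp
    · obtain ⟨L, _, hL, hcf⟩ := ih r2 hml (b * q + q') q r h0 hml (by positivity)
        (by rw [← hdet, ← hdm]; ring) (-ε) (by rcases hε with h | h <;> simp [h])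
        (by
          obtain ⟨c, hc'⟩ := h1
          obtain ⟨d, hd⟩ := h2
          refine ⟨b * c + d, ?_⟩
          have : (r' : ℤ) = r * b + r2 := by exact_mod_cast hdm.symm
          rw [this] at hd
          push_cast
          linear_combination b * hc' + hd)
        (by
          have : (q : ℤ) * p + -ε * r = q * p - ε * r := by ring
          rw [this]; exact h1)
      refine ⟨b :: L, by simp, ?_, ?_⟩
      · intro x hx
        rcases List.mem_cons.1 hx with rfl | hx
        · exact ⟨hb1, hbK⟩
        · exact hL x hx
      · simp only [cfVal, hcf, hdQ]
        field_simp

/-- Zaremba's conjecture is equivalent to the existence of a constant C such that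
for every n there is a rank-1 lattice of size n with periodic dispersion < C/n. -/
theorem stmt17 :
    (∃ A : ℕ, ∀ N : ℕ, 2 ≤ N → ∃ a : ℕ, 1 ≤ a ∧ a < N ∧ Nat.gcd a N = 1 ∧
      ∃ L : List ℕ, L ≠ [] ∧ (∀ b ∈ L, 1 ≤ b ∧ b ≤ A) ∧ cfVal L = (a : ℚ) / N) ↔
    (∃ C : ℝ, 0 < C ∧ ∀ n : ℕ, 2 ≤ n → ∃ p : ℕ, 1 ≤ p ∧ p < n ∧ Nat.gcd p n = 1 ∧
      dispT (rank1Lattice n p) < ENNReal.ofReal (C / n)) := by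
  constructor
  · rintro ⟨A, hA⟩
    refine ⟨2 * (A + 2) + 1, by positivity, ?_⟩
    intro n hn
    obtain ⟨a, ha1, han, hg, L, _, hb, hcf⟩ := hA n hn
    refine ⟨a, ha1, han, hg, lt_of_le_of_lt (disp_le A n a hn hg L hb hcf) ?_⟩
    have hnR : (0 : ℝ) < n := by
      have : 0 < n := by omega
      exact_mod_cast this
    rw [ENNReal.ofReal_lt_ofReal_iff (by positivity)]
    gcongr
    linarith
  · rintro ⟨C, hC, h⟩
    obtain ⟨K, hK⟩ := exists_nat_ge (4 * C)
    refine ⟨K, ?_⟩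
    intro N hN
    obtain ⟨p, hp1, hpN, hg, hd⟩ := h N hN
    refine ⟨p, hp1, hpN, hg, ?_⟩
    refine build N p K ?_ p 1 0 N hp1 hpN (by simp) (by simp) 1 (by simp) (by simp) (by simp)
    intro q r hq hr ε hε h1
    have h2 := merit N p hN C hC hd q r hq hr ε hε h1
    have h3 : (N : ℝ) < K * (q * r) := lt_of_lt_of_le h2 (by gcongr)
    exact_mod_cast h3
end

section
/- For every integer m ≥ 3, the Fibonacci lattice 𝓕_m = P_{F_m, F_{m−2}} = {({k F_{m−2}/F_m}, k/F_m) : 0 ≤ k < F_m} satisfies disp_T(𝓕_m) = 2/F_m. Conversely, if n ≥ 2 and p is an integer with 1 ≤ p < n, gcd(p, n) = 1, and disp_T(P_{n,p}) = 2/n, then there exists m ≥ 3 with n = F_m and p ∈ {F_{m−2}, F_m − F_{m−2}}; i.e., up to the reflection x ↦ 1 − x, the Fibonacci lattices are the only rank-1 lattices achieving periodic dispersion 2/n. -/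
/-- membership in the integer lattice -/
def InL (n p x y : ℤ) : Prop := n ∣ x - y * p

lemma InL.add {n p x y x' y' : ℤ} (h : InL n p x y) (h' : InL n p x' y') :
    InL n p (x + x') (y + y') := by
  unfold InL at *
  have e : x + x' - (y + y') * p = (x - y * p) + (x' - y' * p) := by ring
  rw [e]; exact dvd_add h h'

lemma InL.sub {n p x y x' y' : ℤ} (h : InL n p x y) (h' : InL n p x' y') :
    InL n p (x - x') (y - y') := by
  unfold InL at *
  have e : x - x' - (y - y') * p = (x - y * p) - (x' - y' * p) := by ring
  rw [e]; exact dvd_sub h h'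

lemma hit {n p a b c d M : ℤ} (hn : 0 < n) (ha : 0 < a) (hc : 0 < c) (haM : a ≤ M) (hcM : c ≤ M)
    (hb : 1 ≤ b) (hd : 1 ≤ d) (hu : InL n p a b) (hv : InL n p c (-d))
    (X1 X2 Y1 Y2 : ℝ) (hX : (M : ℝ) < X2 - X1) (hY : ((b + d : ℤ) : ℝ) < Y2 - Y1) :
    ∃ x y : ℤ, InL n p x y ∧ X1 < x ∧ x < X2 ∧ Y1 < y ∧ y < Y2 := by
  have hb' : (1 : ℝ) ≤ b := by exact_mod_cast hb
  have hd' : (1 : ℝ) ≤ d := by exact_mod_cast hd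
  push_cast at hY
  let P : ℤ → Prop := fun x => (x : ℝ) ≤ X1 ∧ ∃ y : ℤ, InL n p x y ∧ Y1 < y ∧ (y : ℝ) < Y2
  have hbdd : ∃ B : ℤ, ∀ z : ℤ, P z → z ≤ B := ⟨⌊X1⌋, fun z hz => Int.le_floor.2 hz.1⟩
  have hinh : ∃ z : ℤ, P z := by
    set y : ℤ := ⌊Y1⌋ + 1 with hy
    have h1 := Int.lt_floor_add_one Y1
    have h2 := Int.floor_le Y1
    set t : ℤ := ⌊(X1 - y * p) / n⌋ with ht
    have h3 : (t : ℝ) ≤ (X1 - y * p) / n := Int.floor_le _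
    have hn' : (0 : ℝ) < n := by exact_mod_cast hn
    rw [le_div_iff₀ hn'] at h3
    refine ⟨y * p + t * n, ?_, y, ?_, ?_, ?_⟩
    · push_cast at *; linarith
    · unfold InL; exact ⟨t, by ring⟩
    · rw [hy]; push_cast; linarith
    · rw [hy]; push_cast; linarith
  obtain ⟨x, ⟨hx1, y, hxy, hy1, hy2⟩, hmax⟩ := Int.exists_greatest_of_bdd hbdd hinh
  by_cases hcase : (y : ℝ) + b < Y2
  · refine ⟨x + a, y + b, hxy.add hu, ?_, ?_, ?_, ?_⟩
    · by_contra hcon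
      have := hmax (x + a) ⟨not_lt.1 hcon, y + b, hxy.add hu, by push_cast; linarith,
        by push_cast; linarith⟩
      linarith
    · have : (a : ℝ) ≤ M := by exact_mod_cast haM
      push_cast; linarith
    · push_cast; linarith
    · push_cast; linarith
  · refine ⟨x + c, y + -d, hxy.add hv, ?_, ?_, ?_, ?_⟩
    · by_contra hcon
      have := hmax (x + c) ⟨not_lt.1 hcon, y + -d, hxy.add hv, by push_cast; linarith,
        by push_cast; linarith⟩
      linarith
    · have : (c : ℝ) ≤ M := by exact_mod_cast hcM
      push_cast; linarith
    · push_cast; linarith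
    · push_cast; linarith

/-- lifted right endpoint -/
noncomputable def lift2 (u v : ℝ) : ℝ := if u ≤ v then v else 1 + v

lemma lift2_sub (u v : ℝ) : lift2 u v - u = perLen u v := by
  unfold lift2 perLen; split_ifs <;> ring

lemma mem_perInt_of_lift {n : ℕ} (hn : 0 < n) {u v : ℝ} (hu : u ∈ Set.Icc (0 : ℝ) 1)
    (hv : v ∈ Set.Icc (0 : ℝ) 1) (x : ℤ) (h1 : n * u < x) (h2 : (x : ℝ) < n * lift2 u v) :
    (((x % (n : ℤ) : ℤ) : ℝ) / n) ∈ perInt u v := by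
  have hn' : (0 : ℝ) < n := by exact_mod_cast hn
  obtain ⟨hu0, hu1⟩ := hu
  obtain ⟨hv0, hv1⟩ := hv
  have hx0 : (0 : ℤ) < x := by
    have : (0 : ℝ) < x := lt_of_le_of_lt (by positivity) h1
    exact_mod_cast this
  unfold lift2 at h2
  unfold perInt
  split_ifs at h2 ⊢ with h
  · have hxn : x < n := by
      have : (x : ℝ) < n := by nlinarith
      exact_mod_cast this
    rw [Int.emod_eq_of_lt hx0.le hxn]
    constructor
    · rw [lt_div_iff₀ hn']; linarith
    · rw [div_lt_iff₀ hn']; linarith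
  · by_cases hxn : x < n
    · rw [Int.emod_eq_of_lt hx0.le hxn]
      right
      constructor
      · rw [lt_div_iff₀ hn']; linarith
      · rw [div_lt_iff₀ hn']
        have : (x : ℝ) < n := by exact_mod_cast hxn
        linarith
    · have h3 : x < 2 * n := by
        have : (x : ℝ) < 2 * n := by nlinarith
        exact_mod_cast this
      have : x % (n : ℤ) = x - n := by
        rw [← Int.sub_emod_right, Int.emod_eq_of_lt (by omega) (by omega)]
      rw [this]
      left
      push_cast
      constructor
      · apply div_nonneg _ hn'.le
        have : (n : ℝ) ≤ x := by exact_mod_cast not_lt.1 hxn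
        linarith
      · rw [div_lt_iff₀ hn']; linarith

lemma fract_lattice {n p k : ℕ} :
    Int.fract ((k : ℝ) * p / n) = (((k * p % n : ℕ)) : ℝ) / n := by
  have := Int.fract_div_natCast_eq_div_natCast_mod (k := ℝ) (m := k * p) (n := n)
  rw [← this]; push_cast; rfl

lemma hit_box {n p : ℕ} {a b c d M : ℤ} (hn : 0 < n) (ha : 0 < a) (hc : 0 < c) (haM : a ≤ M)
    (hcM : c ≤ M)
    (hb : 1 ≤ b) (hd : 1 ≤ d) (hu : InL n p a b) (hv : InL n p c (-d))
    {x₁ x₂ y₁ y₂ : ℝ} (hx1 : x₁ ∈ Set.Icc (0 : ℝ) 1) (hx2 : x₂ ∈ Set.Icc (0 : ℝ) 1)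
    (hy1 : y₁ ∈ Set.Icc (0 : ℝ) 1) (hy2 : y₂ ∈ Set.Icc (0 : ℝ) 1)
    (hX : (M : ℝ) < n * perLen x₁ x₂) (hY : ((b + d : ℤ) : ℝ) < n * perLen y₁ y₂) :
    ∃ q ∈ rank1Lattice n p, q.1 ∈ perInt x₁ x₂ ∧ q.2 ∈ perInt y₁ y₂ := by
  rw [← lift2_sub, mul_sub] at hX hY
  obtain ⟨x, y, hL, h1, h2, h3, h4⟩ := hit (n := n) (by exact_mod_cast hn) ha hc haM hcM hb hd hu hv
    _ _ _ _ hX hY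
  have hnz : (n : ℤ) ≠ 0 := by exact_mod_cast hn.ne'
  have hk0 := Int.emod_nonneg y hnz
  have hkn := Int.emod_lt_of_pos y (b := n) (by exact_mod_cast hn)
  obtain ⟨k, hk⟩ := Int.eq_ofNat_of_zero_le hk0
  refine ⟨_, ⟨k, by omega, rfl⟩, ?_, ?_⟩
  · have := mem_perInt_of_lift hn hx1 hx2 x h1 h2
    simp only
    rw [fract_lattice]
    have h5 : x % (n : ℤ) = ((k * p % n : ℕ) : ℤ) := by
      push_cast
      rw [← hk]
      have : x ≡ y * p [ZMOD n] := (Int.modEq_iff_dvd.2 (by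
        unfold InL at hL; rw [← neg_sub]; exact hL.neg_right))
      rw [Int.ModEq] at this
      rw [this]; exact (Int.ModEq.mul_right _ (Int.mod_modEq y n)).symm
    rw [h5] at this
    rw [Int.cast_natCast] at this
    exact this
  · have := mem_perInt_of_lift hn hy1 hy2 y h3 h4
    rw [hk, Int.cast_natCast] at this
    exact this

lemma fib_InL (m : ℕ) (hm : 2 ≤ m) : ∀ i : ℕ, i + 1 ≤ m →
    InL (Nat.fib m) (Nat.fib (m - 2)) (Nat.fib (m - i)) ((-1) ^ i * Nat.fib i) ∧
    InL (Nat.fib m) (Nat.fib (m - 2)) (Nat.fib (m - (i + 1))) ((-1) ^ (i + 1) * Nat.fib (i + 1)) := by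
  intro i
  induction i with
  | zero =>
    intro _
    obtain ⟨k, rfl⟩ := Nat.exists_eq_add_of_le' hm
    constructor
    · simp [InL]
    · refine ⟨1, ?_⟩
      have := Nat.fib_add_two (n := k)
      simp [this]; ring
  | succ i ih =>
    intro h
    obtain ⟨h1, h2⟩ := ih (by omega)
    refine ⟨h2, ?_⟩
    have := h1.sub h2
    obtain ⟨k, rfl⟩ := Nat.exists_eq_add_of_le' h
    have e1 : k + (i + 1 + 1) - i = k + 2 := by omega
    have e2 : k + (i + 1 + 1) - (i + 1) = k + 1 := by omega
    have e3 : k + (i + 1 + 1) - (i + 1 + 1) = k := by omega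
    rw [e1, e2] at this
    rw [e3]
    convert this using 1
    · rw [Nat.fib_add_two]; push_cast; ring
    · rw [Nat.fib_add_two]; push_cast; ring

lemma fib_hit {m i : ℕ} (hi : 1 ≤ i) (him : i + 2 ≤ m)
    {x₁ x₂ y₁ y₂ : ℝ} (hx1 : x₁ ∈ Set.Icc (0 : ℝ) 1) (hx2 : x₂ ∈ Set.Icc (0 : ℝ) 1)
    (hy1 : y₁ ∈ Set.Icc (0 : ℝ) 1) (hy2 : y₂ ∈ Set.Icc (0 : ℝ) 1)
    (hX : (Nat.fib (m - i) : ℝ) < Nat.fib m * perLen x₁ x₂)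
    (hY : (Nat.fib (i + 2) : ℝ) < Nat.fib m * perLen y₁ y₂) :
    ∃ q ∈ rank1Lattice (Nat.fib m) (Nat.fib (m - 2)), q.1 ∈ perInt x₁ x₂ ∧ q.2 ∈ perInt y₁ y₂ := by
  obtain ⟨h1, h2⟩ := fib_InL m (by omega) i (by omega)
  have hn : 0 < Nat.fib m := Nat.fib_pos.2 (by omega)
  have p1 : 0 < Nat.fib (m - i) := Nat.fib_pos.2 (by omega)
  have p2 : 0 < Nat.fib (m - (i + 1)) := Nat.fib_pos.2 (by omega)
  have p3 : 0 < Nat.fib i := Nat.fib_pos.2 (by omega)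
  have p4 : 0 < Nat.fib (i + 1) := Nat.fib_pos.2 (by omega)
  have p5 : Nat.fib (m - (i + 1)) ≤ Nat.fib (m - i) := Nat.fib_mono (by omega)
  rw [Nat.fib_add_two] at hY
  rcases Nat.even_or_odd i with he | ho
  · rw [he.neg_one_pow, one_mul] at h1
    rw [he.add_one.neg_one_pow, neg_one_mul] at h2
    refine hit_box (M := Nat.fib (m - i)) hn ?_ ?_ ?_ ?_ ?_ ?_ h1 h2 hx1 hx2 hy1 hy2 ?_ ?_
    all_goals first | exact_mod_cast hX | exact_mod_cast hY | omega
  · rw [ho.neg_one_pow, neg_one_mul] at h1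
    rw [ho.add_one.neg_one_pow, one_mul] at h2
    rw [add_comm] at hY
    refine hit_box (M := Nat.fib (m - i)) hn ?_ ?_ ?_ ?_ ?_ ?_ h2 h1 hx1 hx2 hy1 hy2 ?_ ?_
    all_goals first | exact_mod_cast hX | exact_mod_cast hY | omega

lemma fib_area {m i : ℕ} (him : i + 2 ≤ m) :
    Nat.fib (m - i + 1) * Nat.fib (i + 2) ≤ 2 * Nat.fib m := by
  obtain ⟨k, rfl⟩ := Nat.exists_eq_add_of_le' him
  have e1 : k + (i + 2) - i + 1 = (k + 1) + 2 := by omega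
  have e2 : k + (i + 2) = i + (k + 1) + 1 := by omega
  rw [e1, e2, Nat.fib_add i (k + 1), Nat.fib_add_two (n := k + 1), Nat.fib_add_two (n := i)]
  have h1 : Nat.fib i ≤ Nat.fib (i + 1) := Nat.fib_mono (by omega)
  have h2 : Nat.fib (k + 1) ≤ Nat.fib (k + 1 + 1) := Nat.fib_mono (by omega)
  obtain ⟨s, hs⟩ := Nat.exists_eq_add_of_le h1
  obtain ⟨t, ht⟩ := Nat.exists_eq_add_of_le h2
  rw [hs, ht]
  nlinarith [Nat.zero_le (s * t)]

lemma fib_upper {m : ℕ} (hm : 3 ≤ m)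
    {x₁ x₂ y₁ y₂ : ℝ} (hx1 : x₁ ∈ Set.Icc (0 : ℝ) 1) (hx2 : x₂ ∈ Set.Icc (0 : ℝ) 1)
    (hy1 : y₁ ∈ Set.Icc (0 : ℝ) 1) (hy2 : y₂ ∈ Set.Icc (0 : ℝ) 1)
    (hemp : ∀ q ∈ rank1Lattice (Nat.fib m) (Nat.fib (m - 2)),
      ¬ (q.1 ∈ perInt x₁ x₂ ∧ q.2 ∈ perInt y₁ y₂)) :
    perLen x₁ x₂ * perLen y₁ y₂ ≤ 2 / (Nat.fib m : ℝ) := by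
  have hn : (0 : ℝ) < Nat.fib m := by exact_mod_cast Nat.fib_pos.2 (by omega)
  obtain ⟨hx0, hxu⟩ := perLen_bounds hx1 hx2
  obtain ⟨hy0, hyu⟩ := perLen_bounds hy1 hy2
  set n : ℝ := (Nat.fib m : ℝ) with hnd
  set W := perLen x₁ x₂
  set H := perLen y₁ y₂
  suffices h : (n * W) * (n * H) ≤ 2 * n by
    rw [le_div_iff₀ hn]
    have : n * (W * H * n) ≤ n * 2 := by nlinarith
    exact le_of_mul_le_mul_left this hn
  by_cases hW : n * W ≤ 1
  · have : n * H ≤ n := by nlinarith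
    nlinarith [mul_nonneg hn.le hy0, mul_nonneg hn.le hx0]
  push Not at hW
  -- find the least index j with n * W ≤ fib j
  have hex : ∃ j, n * W ≤ (Nat.fib j : ℝ) := ⟨m, by rw [← hnd]; nlinarith⟩
  classical
  set j := Nat.find hex with hj
  have hj1 : n * W ≤ Nat.fib j := Nat.find_spec hex
  have hjm : j ≤ m := Nat.find_min' hex (by rw [← hnd]; nlinarith)
  have hj3 : 3 ≤ j := by
    by_contra hcon
    have : Nat.fib j ≤ Nat.fib 2 := Nat.fib_mono (by omega)
    have : (Nat.fib j : ℝ) ≤ 1 := by exact_mod_cast this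
    linarith
  have hj2 : (Nat.fib (j - 1) : ℝ) < n * W := by
    have := Nat.find_min hex (m := j - 1) (by omega)
    exact not_le.1 this
  have hH : n * H ≤ Nat.fib (m + 1 - j + 2) := by
    by_contra hcon
    push Not at hcon
    obtain ⟨q, hq, hq'⟩ := fib_hit (m := m) (i := m + 1 - j) (by omega) (by omega) hx1 hx2 hy1 hy2
      (by rw [show m - (m + 1 - j) = j - 1 by omega]; exact hj2) hcon
    exact hemp q hq hq'
  have ha := fib_area (m := m) (i := m + 1 - j) (by omega)
  rw [show m - (m + 1 - j) + 1 = j by omega] at ha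
  have ha' : (Nat.fib j : ℝ) * Nat.fib (m + 1 - j + 2) ≤ 2 * n := by
    rw [hnd]; exact_mod_cast ha
  refine le_trans (mul_le_mul hj1 hH (mul_nonneg hn.le hy0) (by positivity)) ha'

lemma lower_bound {n p : ℕ} (hn : 2 ≤ n) (hp : 1 ≤ p) (hpn : p < n) :
    ENNReal.ofReal (2 / (n : ℝ)) ≤ dispT (rank1Lattice n p) := by
  have hn2 : (2 : ℝ) ≤ n := by exact_mod_cast hn
  have hn0 : (0 : ℝ) < n := by linarith
  have hp1 : (1 : ℝ) ≤ p := by exact_mod_cast hp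
  have hpn' : (p : ℝ) < n := by exact_mod_cast hpn
  have hpn0 : (0 : ℝ) < p / n := by positivity
  have hpn1 : (p : ℝ) / n < 1 := by rw [div_lt_one hn0]; exact hpn'
  have hbox : ∀ ε : ℝ, 0 < ε → ε ≤ p / n →
      ENNReal.ofReal ((1 - ε) * (2 / n)) ≤ dispT (rank1Lattice n p) := by
    intro ε he1 he2
    apply le_sSup
    have h2n : (2 : ℝ) / n ≤ 1 := by rw [div_le_one hn0]; exact hn2
    have h2n0 : (0 : ℝ) ≤ 2 / n := by positivity
    refine ⟨p / n, p / n - ε, 0, 2 / n, ⟨hpn0.le, hpn1.le⟩, ⟨by linarith, by linarith⟩,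
      ⟨le_rfl, zero_le_one⟩, ⟨h2n0, h2n⟩, ?_, ?_⟩
    · rintro q ⟨k, hk, rfl⟩ ⟨h1, h2⟩
      simp only at h1 h2
      have hk1 : k = 1 := by
        unfold perInt at h2
        rw [if_pos h2n0] at h2
        obtain ⟨h3, h4⟩ := h2
        rw [div_lt_div_iff_of_pos_right hn0] at h4
        have h3' : (0 : ℝ) < k := by
          by_contra hc
          have : (k : ℝ) / n ≤ 0 := div_nonpos_of_nonpos_of_nonneg (not_lt.1 hc) hn0.le
          linarith
        have h5 : 0 < k := by exact_mod_cast h3'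
        have h6 : k < 2 := by exact_mod_cast h4
        omega
      subst hk1
      rw [fract_lattice, one_mul, Nat.mod_eq_of_lt hpn] at h1
      unfold perInt at h1
      rw [if_neg (by linarith)] at h1
      rcases h1 with h1 | h1
      · have := h1.2; linarith
      · have := h1.1; linarith
    · congr 1
      unfold perLen
      rw [if_neg (by linarith), if_pos h2n0]
      ring
  have htend : Filter.Tendsto (fun ε : ℝ => ENNReal.ofReal ((1 - ε) * (2 / n)))
      (nhdsWithin 0 (Set.Ioi 0)) (nhds (ENNReal.ofReal (2 / (n : ℝ)))) := by
    have hc : Continuous (fun ε : ℝ => ENNReal.ofReal ((1 - ε) * (2 / n))) :=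
      ENNReal.continuous_ofReal.comp (by fun_prop)
    have := (hc.tendsto 0).mono_left (nhdsWithin_le_nhds (s := Set.Ioi 0))
    simpa using this
  refine le_of_tendsto htend ?_
  filter_upwards [Ioc_mem_nhdsGT hpn0] with ε hε
  exact hbox ε hε.1 hε.2

lemma converse_key {n p : ℕ} (hn : 2 ≤ n)
    (hdisp : ∀ x₁ x₂ y₁ y₂ : ℝ, x₁ ∈ Set.Icc (0 : ℝ) 1 → x₂ ∈ Set.Icc (0 : ℝ) 1 →
      y₁ ∈ Set.Icc (0 : ℝ) 1 → y₂ ∈ Set.Icc (0 : ℝ) 1 →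
      (∀ q ∈ rank1Lattice n p, ¬(q.1 ∈ perInt x₁ x₂ ∧ q.2 ∈ perInt y₁ y₂)) →
      perLen x₁ x₂ * perLen y₁ y₂ ≤ 2 / (n : ℝ))
    {a b c d : ℤ} (ha : 1 ≤ a) (hb : 1 ≤ b) (hc : 1 ≤ c) (hd : 1 ≤ d)
    (hdet : a * d + b * c = n)
    (hgen : ∀ x y, InL n p x y → ∃ i j : ℤ, x = i * a + j * c ∧ y = i * b - j * d) :
    (a - c) * (b - d) ≤ 0 := by
  by_contra hcon
  push Not at hcon
  have hn2 : (2 : ℝ) ≤ n := by exact_mod_cast hn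
  have hn0 : (0 : ℝ) < n := by linarith
  have hac : a + c ≤ n := by nlinarith
  have hbd : b + d < n := by
    rcases lt_trichotomy a c with h | h | h
    · nlinarith
    · subst h; simp at hcon
    · nlinarith
  have ra : (1 : ℝ) ≤ a := by exact_mod_cast ha
  have rb : (1 : ℝ) ≤ b := by exact_mod_cast hb
  have rc : (1 : ℝ) ≤ c := by exact_mod_cast hc
  have rd : (1 : ℝ) ≤ d := by exact_mod_cast hd
  have rac : (a : ℝ) + c ≤ n := by exact_mod_cast hac
  have rbd : (b : ℝ) + d < n := by exact_mod_cast hbd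
  have rdet : (a : ℝ) * d + b * c = n := by exact_mod_cast hdet
  have rcon : (0 : ℝ) < (a - c) * (b - d) := by exact_mod_cast hcon
  have e1 : (0 : ℝ) ≤ (a + c) / n := by positivity
  have e2 : ¬ (1 - (d : ℝ) / n ≤ b / n) := by
    intro h
    have : (1 : ℝ) ≤ (b + d) / n := by rw [add_div]; linarith
    rw [one_le_div hn0] at this
    linarith
  have hnb : (b : ℝ) / n ≤ 1 := by rw [div_le_one hn0]; linarith
  have hnd : (d : ℝ) / n ≤ 1 := by rw [div_le_one hn0]; linarith
  have hnb0 : (0 : ℝ) ≤ b / n := by positivity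
  have hnd0 : (0 : ℝ) ≤ d / n := by positivity
  have := hdisp 0 ((a + c) / n) (1 - d / n) (b / n) ⟨le_rfl, zero_le_one⟩
    ⟨e1, by rw [div_le_one hn0]; exact rac⟩ ⟨by linarith, by linarith⟩ ⟨hnb0, hnb⟩ ?_
  · unfold perLen at this
    rw [if_pos e1, if_neg e2] at this
    have e3 : ((a + c) / n - 0) * (1 - (1 - d / n) + b / n) = ((a : ℝ) + c) * (b + d) / n / n := by
      field_simp; ring
    rw [e3, div_le_div_iff_of_pos_right hn0, div_le_iff₀ hn0] at this
    nlinarith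
  · rintro q ⟨k, hk, rfl⟩ ⟨h1, h2⟩
    simp only at h1 h2
    rw [fract_lattice] at h1
    unfold perInt at h1 h2
    rw [if_pos e1] at h1
    rw [if_neg e2] at h2
    set X : ℕ := k * p % n with hX
    obtain ⟨h3, h4⟩ := h1
    rw [div_lt_div_iff_of_pos_right hn0] at h4
    have h3' : (0 : ℤ) < X := by
      rcases Nat.eq_zero_or_pos X with h0 | h0
      · rw [h0] at h3; simp at h3
      · exact_mod_cast h0
    have h4' : (X : ℤ) < a + c := by exact_mod_cast h4
    have hLX : InL n p X k := by
      unfold InL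
      rw [hX]; push_cast
      rw [← Int.modEq_iff_dvd]
      exact (Int.mod_modEq _ _).symm
    have hY : ∃ y : ℤ, InL n p X y ∧ -d < y ∧ y < b := by
      rcases h2 with h2 | h2
      · refine ⟨k, hLX, by omega, ?_⟩
        have := h2.2
        rw [div_lt_div_iff_of_pos_right hn0] at this
        exact_mod_cast this
      · refine ⟨k - n, ?_, ?_, by omega⟩
        · unfold InL at *
          have e : (X : ℤ) - (k - n) * p = (X - k * p) + n * p := by ring
          rw [e]; exact dvd_add hLX (Dvd.intro _ rfl)
        · have := h2.1
          rw [sub_lt_iff_lt_add, ← add_div, one_lt_div hn0] at this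
          have : (n : ℤ) < k + d := by exact_mod_cast this
          omega
    obtain ⟨y, hLy, hy1, hy2⟩ := hY
    obtain ⟨i, j, hi, hj⟩ := hgen _ _ hLy
    rcases le_or_gt i 0 with hi0 | hi0 <;> rcases le_or_gt j 0 with hj0 | hj0 <;> nlinarith

lemma converse_euclid {n p : ℕ} (hn : 2 ≤ n)
    (hdisp : ∀ x₁ x₂ y₁ y₂ : ℝ, x₁ ∈ Set.Icc (0 : ℝ) 1 → x₂ ∈ Set.Icc (0 : ℝ) 1 →
      y₁ ∈ Set.Icc (0 : ℝ) 1 → y₂ ∈ Set.Icc (0 : ℝ) 1 →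
      (∀ q ∈ rank1Lattice n p, ¬(q.1 ∈ perInt x₁ x₂ ∧ q.2 ∈ perInt y₁ y₂)) →
      perLen x₁ x₂ * perLen y₁ y₂ ≤ 2 / (n : ℝ)) (s : ℕ) :
    ∀ a b c d : ℤ, a + c ≤ s → 1 ≤ a → 1 ≤ b → 1 ≤ c → 1 ≤ d → IsCoprime a c →
    a * d + b * c = n →
    (∀ x y, InL n p x y → ∃ i j : ℤ, x = i * a + j * c ∧ y = i * b - j * d) →
    ∃ k : ℕ, 1 ≤ k ∧ ((a = Nat.fib (k + 1) ∧ c = Nat.fib k) ∨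
      (a = Nat.fib k ∧ c = Nat.fib (k + 1))) := by
  induction s with
  | zero => intro a b c d h1 h2 h3 h4; exfalso; push_cast at h1; omega
  | succ s ih =>
    intro a b c d hs ha hb hc hd hcop hdet hgen
    push_cast at hs
    have key := converse_key hn hdisp ha hb hc hd hdet hgen
    rcases lt_trichotomy a c with h | h | h
    · have hg' : ∀ x y, InL n p x y →
          ∃ i j : ℤ, x = i * a + j * (c - a) ∧ y = i * b - j * (b + d) := by
        intro x y hxy
        obtain ⟨i, j, h1, h2⟩ := hgen x y hxy
        exact ⟨i + j, j, by rw [h1]; ring, by rw [h2]; ring⟩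
      have hdet' : a * (b + d) + b * (c - a) = n := by rw [← hdet]; ring
      have key' := converse_key hn hdisp ha hb (by omega : 1 ≤ c - a) (by omega : 1 ≤ b + d)
        hdet' hg'
      have hle : c - a ≤ a := by nlinarith
      obtain ⟨k, hk, h1 | h1⟩ := ih a b (c - a) (b + d) (by omega) ha hb (by omega) (by omega)
        (by simpa [sub_eq_add_neg] using (IsCoprime.add_mul_left_right hcop (-1))) hdet' hg'
      · refine ⟨k + 1, by omega, Or.inr ⟨h1.1, ?_⟩⟩
        rw [Nat.fib_add_two]; push_cast; omega
      · have h2 : Nat.fib k ≤ Nat.fib (k + 1) := Nat.fib_mono (by omega)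
        refine ⟨k + 1, by omega, Or.inr ⟨by omega, ?_⟩⟩
        rw [Nat.fib_add_two]; push_cast; omega
    · subst h
      have : a = 1 := by
        have := isCoprime_self.1 hcop
        rcases Int.isUnit_iff.1 this with h | h <;> omega
      exact ⟨1, le_rfl, Or.inl (by simp [this])⟩
    · have hg' : ∀ x y, InL n p x y →
          ∃ i j : ℤ, x = i * (a - c) + j * c ∧ y = i * (b + d) - j * d := by
        intro x y hxy
        obtain ⟨i, j, h1, h2⟩ := hgen x y hxy
        exact ⟨i, i + j, by rw [h1]; ring, by rw [h2]; ring⟩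
      have hdet' : (a - c) * d + (b + d) * c = n := by rw [← hdet]; ring
      have key' := converse_key hn hdisp (by omega : 1 ≤ a - c) (by omega : 1 ≤ b + d) hc hd
        hdet' hg'
      have hle : a - c ≤ c := by nlinarith
      obtain ⟨k, hk, h1 | h1⟩ := ih (a - c) (b + d) c d (by omega) (by omega) (by omega) hc hd
        (by simpa [sub_eq_add_neg] using (IsCoprime.add_mul_left_left hcop (-1))) hdet' hg'
      · have h2 : Nat.fib k ≤ Nat.fib (k + 1) := Nat.fib_mono (by omega)
        refine ⟨k + 1, by omega, Or.inl ⟨?_, by omega⟩⟩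
        rw [Nat.fib_add_two]; push_cast; omega
      · refine ⟨k + 1, by omega, Or.inl ⟨?_, h1.2⟩⟩
        rw [Nat.fib_add_two]; push_cast; omega

/-- The Fibonacci lattice 𝓕_m = P_{F_m, F_{m−2}} has periodic dispersion 2/F_m,
and (up to the reflection x ↦ 1 − x) Fibonacci lattices are the only rank-1
lattices achieving periodic dispersion 2/n. -/
theorem stmt18 :
    (∀ m : ℕ, 3 ≤ m →
      dispT (rank1Lattice (Nat.fib m) (Nat.fib (m - 2))) =
        ENNReal.ofReal (2 / (Nat.fib m : ℝ))) ∧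
    (∀ n p : ℕ, 2 ≤ n → 1 ≤ p → p < n → Nat.gcd p n = 1 →
      dispT (rank1Lattice n p) = ENNReal.ofReal (2 / (n : ℝ)) →
      ∃ m : ℕ, 3 ≤ m ∧ n = Nat.fib m ∧
        (p = Nat.fib (m - 2) ∨ p = Nat.fib m - Nat.fib (m - 2))) := by
  constructor
  · intro m hm
    apply le_antisymm
    · apply sSup_le
      rintro A ⟨x₁, x₂, y₁, y₂, hx1, hx2, hy1, hy2, hemp, rfl⟩
      exact ENNReal.ofReal_le_ofReal (fib_upper hm hx1 hx2 hy1 hy2 hemp)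
    · obtain ⟨k, rfl⟩ := Nat.exists_eq_add_of_le' hm
      have e : k + 3 - 2 = k + 1 := by omega
      have h1 : Nat.fib (k + 3) = Nat.fib (k + 1) + Nat.fib (k + 2) := Nat.fib_add_two
      have h2 : 0 < Nat.fib (k + 1) := Nat.fib_pos.2 (by omega)
      have h3 : 0 < Nat.fib (k + 2) := Nat.fib_pos.2 (by omega)
      rw [e]
      exact lower_bound (by omega) (by omega) (by omega)
  · intro n p hn hp hpn hgcd hdispT
    have hn0 : (0 : ℝ) < n := by exact_mod_cast (by omega : 0 < n)
    have hdisp : ∀ x₁ x₂ y₁ y₂ : ℝ, x₁ ∈ Set.Icc (0 : ℝ) 1 → x₂ ∈ Set.Icc (0 : ℝ) 1 →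
        y₁ ∈ Set.Icc (0 : ℝ) 1 → y₂ ∈ Set.Icc (0 : ℝ) 1 →
        (∀ q ∈ rank1Lattice n p, ¬(q.1 ∈ perInt x₁ x₂ ∧ q.2 ∈ perInt y₁ y₂)) →
        perLen x₁ x₂ * perLen y₁ y₂ ≤ 2 / (n : ℝ) := by
      intro x₁ x₂ y₁ y₂ hx1 hx2 hy1 hy2 hemp
      rw [← ENNReal.ofReal_le_ofReal_iff (by positivity), ← hdispT]
      exact le_sSup ⟨x₁, x₂, y₁, y₂, hx1, hx2, hy1, hy2, hemp, rfl⟩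
    have hcop : IsCoprime (p : ℤ) ((n : ℤ) - p) := by
      have h0 : IsCoprime (p : ℤ) (n : ℤ) := Nat.isCoprime_iff_coprime.2 hgcd
      simpa [sub_eq_add_neg] using (IsCoprime.add_mul_left_right h0 (-1))
    obtain ⟨k, hk, h⟩ := converse_euclid hn hdisp n p 1 ((n : ℤ) - p) 1 (by omega) (by omega) le_rfl
      (by omega) le_rfl hcop (by ring) (by
        rintro x y ⟨t, ht⟩
        exact ⟨y + t, t, by linear_combination ht, by ring⟩)
    have hf : Nat.fib (k + 2) = Nat.fib k + Nat.fib (k + 1) := Nat.fib_add_two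
    refine ⟨k + 2, by omega, by omega, ?_⟩
    rw [show k + 2 - 2 = k by omega]
    omega
end

section
/- In the two-sided continued fraction setting for irrational Δ > 1 and Δ̃ ∈ (−1, 0), with Λ the lattice generated by (1, 1) and (−Δ, −Δ̃), assume the sequence (aᵢ)ᵢ∈ℤ attains its maximum a = max_{i∈ℤ} aᵢ. Let Λ₁ be the lattice generated by (1, 1) and (−(a+√(a²+4))/2, (√(a²+4)−a)/2), and let Λ₂ be the lattice generated by (1, 1) and (−(a+√(a²+4a))/2, (√(a²+4a)−a)/2) (these are the lattices whose two-sided continued fraction sequences are the constant sequence (a) and the alternating sequence (…,a,1,a,1,…), respectively). Then disp(Λ₁)/det(Λ₁) ≤ disp(Λ)/det(Λ) ≤ disp(Λ₂)/det(Λ₂), where det(Λ₁) = √(a²+4) and det(Λ₂) = √(a²+4a). -/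
/-! ### Good bases of a lattice -/

/-- `Λ` is generated by two vectors of absolute coordinates `(u1,u2)`, `(t1,t2)` lying in
opposite quadrants. -/
def GB (Λ : Set (ℝ × ℝ)) (u1 u2 t1 t2 : ℝ) : Prop :=
  Λ = latticeGen (u1, u2) (-t1, t2) ∨ Λ = latticeGen (t1, t2) (-u1, u2)

lemma GB.symm {Λ : Set (ℝ × ℝ)} {u1 u2 t1 t2 : ℝ} (h : GB Λ u1 u2 t1 t2) :
    GB Λ t1 t2 u1 u2 := Or.symm h

lemma mem_gen {v w p : ℝ × ℝ} : p ∈ latticeGen v w ↔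
    ∃ m n : ℤ, p.1 = m * v.1 + n * w.1 ∧ p.2 = m * v.2 + n * w.2 := by
  simp only [latticeGen, Set.mem_ofPred_eq, Prod.ext_iff, Prod.fst_add, Prod.snd_add,
    Prod.smul_fst, Prod.smul_snd, smul_eq_mul]

lemma GB.step {Λ : Set (ℝ × ℝ)} {u1 u2 t1 t2 : ℝ} (h : GB Λ u1 u2 t1 t2) (j : ℤ) :
    GB Λ u1 u2 (t1 - j * u1) (t2 + j * u2) := by
  rcases h with h | h
  · left
    subst h
    ext p
    rw [mem_gen, mem_gen]
    constructor
    · rintro ⟨m, n, h1, h2⟩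
      refine ⟨m - n * j, n, ?_, ?_⟩
      · push_cast; rw [h1]; ring
      · push_cast; rw [h2]; ring
    · rintro ⟨m, n, h1, h2⟩
      refine ⟨m + n * j, n, ?_, ?_⟩
      · push_cast; rw [h1]; ring
      · push_cast; rw [h2]; ring
  · right
    subst h
    ext p
    rw [mem_gen, mem_gen]
    constructor
    · rintro ⟨m, n, h1, h2⟩
      refine ⟨m, n - m * j, ?_, ?_⟩
      · push_cast; rw [h1]; ring
      · push_cast; rw [h2]; ring
    · rintro ⟨m, n, h1, h2⟩
      refine ⟨m, n + m * j, ?_, ?_⟩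
      · push_cast; rw [h1]; ring
      · push_cast; rw [h2]; ring

lemma le_disp_aux {u1 u2 t1 t2 : ℝ}
    (hu1 : 0 < u1) (hu2 : 0 < u2) (ht1 : 0 < t1) (ht2 : 0 < t2) :
    ENNReal.ofReal ((u1 + t1) * (u2 + t2)) ≤ disp (latticeGen (u1, u2) (-t1, t2)) := by
  apply le_sSup
  refine ⟨-t1, u1, 0, u2 + t2, ⟨by linarith, by linarith, ?_⟩, by congr 1; ring⟩
  intro p hp hbox
  obtain ⟨m, n, h1, h2⟩ := mem_gen.1 hp
  obtain ⟨⟨hx1, hx2⟩, hy1, hy2⟩ := hbox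
  simp only at h1 h2
  rw [h1] at hx1 hx2
  rw [h2] at hy1 hy2
  rcases le_or_gt m 0 with hm | hm <;> rcases le_or_gt n 0 with hn | hn
  · have hm' : (m : ℝ) ≤ 0 := by exact_mod_cast hm
    have hn' : (n : ℝ) ≤ 0 := by exact_mod_cast hn
    nlinarith
  · have hm' : (m : ℝ) ≤ 0 := by exact_mod_cast hm
    have hn' : (1 : ℝ) ≤ n := by exact_mod_cast hn
    nlinarith
  · have hm' : (1 : ℝ) ≤ m := by exact_mod_cast hm
    have hn' : (n : ℝ) ≤ 0 := by exact_mod_cast hn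
    nlinarith
  · have hm' : (1 : ℝ) ≤ m := by exact_mod_cast hm
    have hn' : (1 : ℝ) ≤ n := by exact_mod_cast hn
    nlinarith

lemma GB.le_disp {Λ : Set (ℝ × ℝ)} {u1 u2 t1 t2 : ℝ} (h : GB Λ u1 u2 t1 t2)
    (hu1 : 0 < u1) (hu2 : 0 < u2) (ht1 : 0 < t1) (ht2 : 0 < t2) :
    ENNReal.ofReal ((u1 + t1) * (u2 + t2)) ≤ disp Λ := by
  rcases h with h | h
  · rw [h]; exact le_disp_aux hu1 hu2 ht1 ht2
  · rw [h, add_comm u1, add_comm u2]; exact le_disp_aux ht1 ht2 hu1 hu2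

/-- Upward steps in a vertical strip. -/
lemma strip_up {u1 u2 t1 t2 x1 x2 y1 : ℝ}
    (hu2 : 0 < u2) (ht2 : 0 < t2)
    (huW : u1 < x2 - x1) (htW : t1 < x2 - x1) (hW : x2 - x1 ≤ u1 + t1) (k : ℕ) :
    ∀ m n : ℤ, x1 < m * u1 - n * t1 → m * u1 - n * t1 < x2 → m * u2 + n * t2 ≤ y1 →
      y1 - (m * u2 + n * t2) < k * min u2 t2 →
      ∃ m n : ℤ, x1 < m * u1 - n * t1 ∧ m * u1 - n * t1 < x2 ∧ y1 < m * u2 + n * t2 ∧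
        m * u2 + n * t2 ≤ y1 + u2 + t2 := by
  have hmu := min_le_left u2 t2
  have hmt := min_le_right u2 t2
  induction k with
  | zero => intro m n _ _ h3 h4; simp at h4; linarith
  | succ k ih =>
    intro m n h1 h2 h3 h4
    push_cast at h4
    have key : ∃ m' n' : ℤ, x1 < m' * u1 - n' * t1 ∧ m' * u1 - n' * t1 < x2 ∧
        m * u2 + n * t2 + min u2 t2 ≤ m' * u2 + n' * t2 ∧
        m' * u2 + n' * t2 ≤ m * u2 + n * t2 + u2 + t2 := by
      by_cases c1 : m * u1 - n * t1 + u1 < x2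
      · by_cases c0 : x1 < m * u1 - n * t1 + u1
        · refine ⟨m + 1, n, ?_, ?_, ?_, ?_⟩ <;> push_cast <;> linarith
        · refine ⟨m, n + 1, ?_, ?_, ?_, ?_⟩ <;> push_cast <;> linarith
      · by_cases c2 : x1 < m * u1 - n * t1 - t1
        · refine ⟨m, n + 1, ?_, ?_, ?_, ?_⟩ <;> push_cast <;> linarith
        · refine ⟨m + 1, n + 1, ?_, ?_, ?_, ?_⟩ <;> push_cast <;> linarith
    obtain ⟨m', n', k1, k2, k3, k4⟩ := key
    by_cases c : y1 < m' * u2 + n' * t2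
    · exact ⟨m', n', k1, k2, c, by linarith⟩
    · exact ih m' n' k1 k2 (not_lt.1 c) (by linarith)

/-- Downward steps in a vertical strip. -/
lemma strip_down {u1 u2 t1 t2 x1 x2 y1 : ℝ}
    (hu2 : 0 < u2) (ht2 : 0 < t2)
    (huW : u1 < x2 - x1) (htW : t1 < x2 - x1) (hW : x2 - x1 ≤ u1 + t1) (k : ℕ) :
    ∀ m n : ℤ, x1 < m * u1 - n * t1 → m * u1 - n * t1 < x2 → y1 < m * u2 + n * t2 →
      (m * u2 + n * t2) - y1 < k * min u2 t2 →
      ∃ m n : ℤ, x1 < m * u1 - n * t1 ∧ m * u1 - n * t1 < x2 ∧ y1 < m * u2 + n * t2 ∧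
        m * u2 + n * t2 ≤ y1 + u2 + t2 := by
  have hmu := min_le_left u2 t2
  have hmt := min_le_right u2 t2
  induction k with
  | zero => intro m n _ _ h3 h4; simp at h4; linarith
  | succ k ih =>
    intro m n h1 h2 h3 h4
    push_cast at h4
    have key : ∃ m' n' : ℤ, x1 < m' * u1 - n' * t1 ∧ m' * u1 - n' * t1 < x2 ∧
        m' * u2 + n' * t2 + min u2 t2 ≤ m * u2 + n * t2 ∧
        m * u2 + n * t2 ≤ m' * u2 + n' * t2 + u2 + t2 := by
      by_cases c1 : x1 < m * u1 - n * t1 - u1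
      · by_cases c0 : m * u1 - n * t1 - u1 < x2
        · refine ⟨m - 1, n, ?_, ?_, ?_, ?_⟩ <;> push_cast <;> linarith
        · refine ⟨m, n - 1, ?_, ?_, ?_, ?_⟩ <;> push_cast <;> linarith
      · by_cases c2 : m * u1 - n * t1 + t1 < x2
        · refine ⟨m, n - 1, ?_, ?_, ?_, ?_⟩ <;> push_cast <;> linarith
        · refine ⟨m - 1, n - 1, ?_, ?_, ?_, ?_⟩ <;> push_cast <;> linarith
    obtain ⟨m', n', k1, k2, k3, k4⟩ := key
    by_cases c : y1 < m' * u2 + n' * t2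
    · exact ih m' n' k1 k2 c (by linarith)
    · exact ⟨m, n, h1, h2, h3, by linarith [not_lt.1 c]⟩

lemma strip {u1 u2 t1 t2 x1 x2 y1 : ℝ}
    (hu1 : 0 < u1) (hu2 : 0 < u2) (ht2 : 0 < t2)
    (huW : u1 < x2 - x1) (htW : t1 < x2 - x1) (hW : x2 - x1 ≤ u1 + t1) :
    ∃ m n : ℤ, x1 < m * u1 - n * t1 ∧ m * u1 - n * t1 < x2 ∧ y1 < m * u2 + n * t2 ∧
        m * u2 + n * t2 ≤ y1 + u2 + t2 := by
  have hmin : 0 < min u2 t2 := lt_min hu2 ht2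
  have a1 : x1 < ((⌊x1 / u1⌋ + 1 : ℤ) : ℝ) * u1 - ((0 : ℤ) : ℝ) * t1 := by
    have := Int.lt_floor_add_one (x1 / u1)
    rw [div_lt_iff₀ hu1] at this
    push_cast; linarith
  have a2 : ((⌊x1 / u1⌋ + 1 : ℤ) : ℝ) * u1 - ((0 : ℤ) : ℝ) * t1 < x2 := by
    have := Int.floor_le (x1 / u1)
    rw [le_div_iff₀ hu1] at this
    push_cast; linarith
  generalize (⌊x1 / u1⌋ + 1 : ℤ) = m at a1 a2
  rcases le_or_gt ((m : ℝ) * u2 + ((0 : ℤ) : ℝ) * t2) y1 with h | h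
  · obtain ⟨k, hk⟩ := exists_nat_gt ((y1 - (m * u2 + ((0 : ℤ) : ℝ) * t2)) / min u2 t2)
    rw [div_lt_iff₀ hmin] at hk
    exact strip_up hu2 ht2 huW htW hW k m 0 a1 a2 h hk
  · obtain ⟨k, hk⟩ := exists_nat_gt (((m * u2 + ((0 : ℤ) : ℝ) * t2) - y1) / min u2 t2)
    rw [div_lt_iff₀ hmin] at hk
    exact strip_down hu2 ht2 huW htW hW k m 0 a1 a2 h hk

lemma box_le_aux {u1 u2 t1 t2 x1 x2 y1 y2 : ℝ}
    (hu1 : 0 < u1) (hu2 : 0 < u2) (ht2 : 0 < t2)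
    (huW : u1 < x2 - x1) (htW : t1 < x2 - x1) (hW : x2 - x1 ≤ u1 + t1)
    (hb : isEmptyBox (latticeGen (u1, u2) (-t1, t2)) x1 x2 y1 y2) :
    (x2 - x1) * (y2 - y1) ≤ (u1 + t1) * (u2 + t2) := by
  obtain ⟨hx, hy, he⟩ := hb
  have hH : y2 - y1 ≤ u2 + t2 := by
    by_contra hcon
    obtain ⟨m, n, h1, h2, h3, h4⟩ := strip (y1 := y1) hu1 hu2 ht2 huW htW hW
    refine he (m * u1 - n * t1, m * u2 + n * t2) (mem_gen.2 ⟨m, n, by simp; ring, by simp⟩) ?_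
    exact ⟨⟨h1, h2⟩, h3, by show (m * u2 + n * t2 : ℝ) < y2; linarith⟩
  exact mul_le_mul hW hH (by linarith) (by linarith)

lemma GB.box_le {Λ : Set (ℝ × ℝ)} {u1 u2 t1 t2 x1 x2 y1 y2 : ℝ} (h : GB Λ u1 u2 t1 t2)
    (hu1 : 0 < u1) (hu2 : 0 < u2) (ht1 : 0 < t1) (ht2 : 0 < t2)
    (huW : u1 < x2 - x1) (htW : t1 < x2 - x1) (hW : x2 - x1 ≤ u1 + t1)
    (hb : isEmptyBox Λ x1 x2 y1 y2) :
    (x2 - x1) * (y2 - y1) ≤ (u1 + t1) * (u2 + t2) := by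
  rcases h with h | h
  · rw [h] at hb; exact box_le_aux hu1 hu2 ht2 huW htW hW hb
  · rw [h] at hb
    have := box_le_aux ht1 ht2 hu2 htW huW (by linarith) hb
    linarith

/-! ### Two-sided continued fractions -/

/-- The relations satisfied by a two-sided continued fraction (`d = Δ`, `e = -Δ̃`). -/
structure CF (d e : ℤ → ℝ) (a : ℤ → ℤ) : Prop where
  d1 : ∀ i, 1 < d i
  e0 : ∀ i, 0 < e i
  e1 : ∀ i, e i < 1
  a1 : ∀ i, 1 ≤ a i
  hd : ∀ i, d i = a i + 1 / d (i + 1)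
  he : ∀ i, e (i + 1) = 1 / (a i + e i)

/-- Normalized area. -/
noncomputable def gf (P Q : ℝ) : ℝ := P * Q / (P + Q - 2)

lemma exists_prod (r : ℤ → ℝ) (hr : ∀ i, 0 < r i) :
    ∃ X : ℤ → ℝ, X 0 = 1 ∧ (∀ i, 0 < X i) ∧ ∀ i, X (i + 1) = r i * X i := by
  refine ⟨fun i => (∏ k ∈ Finset.range i.toNat, r k) *
    (∏ k ∈ Finset.range (-i).toNat, (r (-((k : ℤ) + 1)))⁻¹), by simp, ?_, ?_⟩
  · intro i
    exact mul_pos (Finset.prod_pos fun _ _ => hr _)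
      (Finset.prod_pos fun _ _ => inv_pos.2 (hr _))
  · intro i
    rcases le_or_gt 0 i with h | h
    · lift i to ℕ using h
      have e1 : ((i : ℤ) + 1).toNat = i + 1 := by omega
      have e2 : (-((i : ℤ) + 1)).toNat = 0 := by omega
      have e3 : (-(i : ℤ)).toNat = 0 := by omega
      simp only [e1, e2, e3, Finset.prod_range_succ, Int.toNat_natCast, Finset.range_zero,
        Finset.prod_empty]
      ring
    · obtain ⟨n, rfl⟩ : ∃ n : ℕ, i = -((n : ℤ) + 1) := ⟨(-i - 1).toNat, by omega⟩
      have e1 : (-((n : ℤ) + 1) + 1).toNat = 0 := by omega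
      have e2 : (-(-((n : ℤ) + 1) + 1)).toNat = n := by omega
      have e3 : (-((n : ℤ) + 1)).toNat = 0 := by omega
      have e4 : (-(-((n : ℤ) + 1))).toNat = n + 1 := by omega
      simp only [e1, e2, e3, e4, Finset.prod_range_succ, Finset.range_zero, Finset.prod_empty]
      have := (hr (-((n : ℤ) + 1))).ne'
      field_simp

lemma CF.frame {d e : ℤ → ℝ} {a : ℤ → ℤ} (h : CF d e a) :
    ∃ X Y : ℤ → ℝ, X 0 = 1 ∧ (∀ i, 0 < X i) ∧ (∀ i, 0 < Y i) ∧
      (∀ i, X i = d (i + 1) * X (i + 1)) ∧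
      (∀ i, GB (latticeGen (1, 1) (-d 0, e 0)) (X i) (Y i) (d i * X i) (e i * Y i)) ∧
      (∀ i, X i * Y i * (d i + e i) = d 0 + e 0) := by
  have hdp : ∀ i, 0 < d i := fun i => by linarith [h.d1 i]
  obtain ⟨X, hX0, hXp, hX⟩ := exists_prod (fun i => (d (i + 1))⁻¹) (fun i => inv_pos.2 (hdp _))
  obtain ⟨Y, hY0, hYp, hY⟩ := exists_prod (fun i => (e (i + 1))⁻¹)
    (fun i => inv_pos.2 (h.e0 _))
  have hX' : ∀ i, X i = d (i + 1) * X (i + 1) := by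
    intro i; rw [hX]; have := (hdp (i + 1)).ne'; field_simp
  have hY' : ∀ i, Y i = e (i + 1) * Y (i + 1) := by
    intro i; rw [hY]; have := (h.e0 (i + 1)).ne'; field_simp
  have hX2 : ∀ i, X (i + 1) = d i * X i - a i * X i := by
    intro i; rw [hX]
    have := h.hd i
    rw [one_div] at this
    rw [this]; ring
  have hY2 : ∀ i, Y (i + 1) = e i * Y i + a i * Y i := by
    intro i; rw [hY]
    have := h.he i
    rw [this, one_div, inv_inv]; ring
  refine ⟨X, Y, hX0, hXp, hYp, hX', ?_, ?_⟩
  · have hiff : ∀ i, GB (latticeGen (1, 1) (-d 0, e 0)) (X i) (Y i) (d i * X i) (e i * Y i) ↔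
        GB (latticeGen (1, 1) (-d 0, e 0)) (X (i + 1)) (Y (i + 1)) (d (i + 1) * X (i + 1))
          (e (i + 1) * Y (i + 1)) := by
      intro i
      rw [← hX' i, ← hY' i]
      constructor
      · intro hg
        have := (hg.step (a i)).symm
        rwa [← hX2, ← hY2] at this
      · intro hg
        have := hg.symm.step (-(a i))
        rw [hX2, hY2] at this
        convert this using 1 <;> push_cast <;> ring
    intro i
    induction i using Int.induction_on with
    | zero => left; simp [hX0, hY0]
    | succ i ih => exact (hiff _).1 ih
    | pred i ih =>
      rw [hiff]
      simpa using ih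
  · have hiff : ∀ i, X (i + 1) * Y (i + 1) * (d (i + 1) + e (i + 1)) =
        X i * Y i * (d i + e i) := by
      intro i
      have : X (i + 1) * Y (i + 1) * (d (i + 1) + e (i + 1)) =
        (d (i + 1) * X (i + 1)) * Y (i + 1) + (e (i + 1) * Y (i + 1)) * X (i + 1) := by ring
      rw [this, ← hX', ← hY', hX2, hY2]; ring
    intro i
    induction i using Int.induction_on with
    | zero => simp [hX0, hY0]
    | succ i ih => rw [hiff, ih]
    | pred i ih =>
      rw [← ih, ← hiff]
      simp

lemma CF.le_disp {d e : ℤ → ℝ} {a : ℤ → ℤ} (h : CF d e a) (i j : ℤ) (hj0 : 0 ≤ j)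
    (hja : j ≤ a i) :
    ENNReal.ofReal (gf (1 + d i - j) (1 + e i + j)) ≤
      disp (latticeGen (1, 1) (-d 0, e 0)) / ENNReal.ofReal (d 0 + e 0) := by
  obtain ⟨X, Y, hX0, hXp, hYp, hX, hG, hD⟩ := h.frame
  have hD0 : 0 < d 0 + e 0 := by linarith [h.d1 0, h.e0 0]
  have hDi : 0 < d i + e i := by linarith [h.d1 i, h.e0 i]
  rw [ENNReal.le_div_iff_mul_le (Or.inl (by simpa using hD0)) (Or.inl ENNReal.ofReal_ne_top)]
  have hj0' : (0 : ℝ) ≤ j := by exact_mod_cast hj0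
  have hja' : (j : ℝ) ≤ a i := by exact_mod_cast hja
  have hdj : 0 < d i - j := by
    have : 0 < 1 / d (i + 1) := by have := h.d1 (i + 1); positivity
    linarith [h.hd i]
  have hej : 0 < e i + j := by linarith [h.e0 i]
  have := ((hG i).step j).le_disp (hXp i) (hYp i)
    (by have := mul_pos hdj (hXp i); linarith) (by have := mul_pos hej (hYp i); linarith)
  refine le_trans (le_of_eq ?_) this
  rw [← ENNReal.ofReal_mul' hD0.le]
  congr 1
  rw [← hD i, gf]
  have e2 : (1 + d i - j + (1 + e i + j) - 2) = d i + e i := by ring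
  rw [e2]
  have := hDi.ne'
  field_simp
  ring

lemma single_le_disp {D E : ℝ} (hD : 0 < D) (hE : 0 < E) (j : ℤ) (hj0 : 0 ≤ j)
    (hj : (j : ℝ) < D) :
    ENNReal.ofReal (gf (1 + D - j) (1 + E + j)) ≤
      disp (latticeGen (1, 1) (-D, E)) / ENNReal.ofReal (D + E) := by
  have hD0 : 0 < D + E := by linarith
  have hj0' : (0 : ℝ) ≤ j := by exact_mod_cast hj0
  rw [ENNReal.le_div_iff_mul_le (Or.inl (by simpa using hD0)) (Or.inl ENNReal.ofReal_ne_top)]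
  have hG : GB (latticeGen (1, 1) (-D, E)) 1 1 D E := Or.inl rfl
  have := (hG.step j).le_disp one_pos one_pos (by linarith) (by linarith)
  refine le_trans (le_of_eq ?_) this
  rw [← ENNReal.ofReal_mul' hD0.le]
  congr 1
  rw [gf]
  have e2 : (1 + D - j + (1 + E + j) - 2) = D + E := by ring
  rw [e2]
  have := hD0.ne'
  field_simp
  ring

lemma CF.disp_le {d e : ℤ → ℝ} {a : ℤ → ℤ} (h : CF d e a) (c : ENNReal)
    (hc : ∀ i j : ℤ, 0 ≤ j → j ≤ a i →
      ENNReal.ofReal (gf (1 + d i - j) (1 + e i + j)) ≤ c) :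
    disp (latticeGen (1, 1) (-d 0, e 0)) / ENNReal.ofReal (d 0 + e 0) ≤ c := by
  obtain ⟨X, Y, hX0, hXp, hYp, hX, hG, hD⟩ := h.frame
  have hD0 : 0 < d 0 + e 0 := by linarith [h.d1 0, h.e0 0]
  have hdp : ∀ i, 0 < d i := fun i => by linarith [h.d1 i]
  have hXa : ∀ i, X (i + 1) = d i * X i - a i * X i := by
    intro i
    have h1 := h.hd i
    have h2 := hX i
    have h3 := (hdp (i + 1)).ne'
    have : d i - a i = 1 / d (i + 1) := by linarith
    rw [← sub_mul, this, h2]; field_simp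
  -- the total widths
  have hZ1 : ∀ i, X (i + 1) * (1 + d (i + 1)) = X i * (1 + d i - a i) := by
    intro i
    have : X (i + 1) * (1 + d (i + 1)) = X (i + 1) + d (i + 1) * X (i + 1) := by ring
    rw [this, ← hX, hXa]; ring
  have hanti : StrictAnti (fun i : ℤ => X i * (1 + d i)) := by
    apply strictAnti_int_of_succ_lt
    intro i
    rw [hZ1]
    have : (1 : ℝ) ≤ a i := by exact_mod_cast h.a1 i
    have := hXp i
    nlinarith
  have hdbl : ∀ i, 2 * X (i + 2) ≤ X i := by
    intro i
    have e1 := hXa (i + 1)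
    have e2 := hX i
    have e3 : X (i + 1) = d (i + 1 + 1) * X (i + 1 + 1) := hX (i + 1)
    have e4 : i + 2 = i + 1 + 1 := by ring
    rw [e4]
    have h1 : (1 : ℝ) ≤ a (i + 1) := by exact_mod_cast h.a1 (i + 1)
    have h2 := hXp (i + 1)
    have h3 := hXp (i + 1 + 1)
    have h4 := h.d1 (i + 1 + 1)
    nlinarith
  have hlow : ∀ n : ℕ, (2 : ℝ) ^ n * X (2 * n) ≤ 1 := by
    intro n
    induction n with
    | zero => simp [hX0]
    | succ n ih =>
      have := hdbl (2 * n)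
      have e : (2 * ((n + 1 : ℕ) : ℤ)) = 2 * n + 2 := by push_cast; ring
      rw [e, pow_succ]
      have hp : (0 : ℝ) < 2 ^ n := by positivity
      nlinarith
  have hhigh : ∀ n : ℕ, (2 : ℝ) ^ n ≤ X (-(2 * n)) := by
    intro n
    induction n with
    | zero => simp [hX0]
    | succ n ih =>
      have := hdbl (-(2 * n) - 2)
      have e : (-(2 * ((n + 1 : ℕ) : ℤ))) = -(2 * n) - 2 := by push_cast; ring
      rw [e, pow_succ]
      rw [sub_add_cancel] at this
      linarith
  apply ENNReal.div_le_of_le_mul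
  apply sSup_le
  rintro _ ⟨x1, x2, y1, y2, hb, rfl⟩
  have hWp : 0 < x2 - x1 := by linarith [hb.1]
  set W := x2 - x1 with hWdef
  have hex : ∃ i : ℤ, W ≤ X i * (1 + d i) ∧ X i * (1 + d i - a i) < W := by
    have hb1 : ∃ b : ℤ, ∀ z : ℤ, W ≤ X z * (1 + d z) → z ≤ b := by
      obtain ⟨n, hn⟩ := exists_nat_gt (2 / W)
      refine ⟨2 * n + 1, fun z hz => ?_⟩
      by_contra hcon
      have h1 := hanti.antitone (show (2 * (n : ℤ) + 1) ≤ z by omega)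
      have h2 : X (2 * (n : ℤ) + 1) * (1 + d (2 * (n : ℤ) + 1)) ≤ 2 * X (2 * n) := by
        have e1 := hX (2 * n)
        have h3 := h.d1 (2 * n + 1)
        have h4 := hXp (2 * n + 1)
        nlinarith
      have h5 := hlow n
      have h6 : (n : ℝ) < 2 ^ n := by exact_mod_cast Nat.lt_two_pow_self
      rw [div_lt_iff₀ hWp] at hn
      have h7 : W ≤ 2 * X (2 * n) := hz.trans (h1.trans h2)
      have h8 : (0 : ℝ) < 2 ^ n := by positivity
      nlinarith
    have hb2 : ∃ z : ℤ, W ≤ X z * (1 + d z) := by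
      obtain ⟨n, hn⟩ := exists_nat_gt W
      refine ⟨-(2 * n), ?_⟩
      have h6 : (n : ℝ) < 2 ^ n := by exact_mod_cast Nat.lt_two_pow_self
      have := hhigh n
      have := h.d1 (-(2 * n))
      have := hXp (-(2 * n))
      nlinarith
    obtain ⟨i, hi, hmax⟩ := Int.exists_greatest_of_bdd hb1 hb2
    refine ⟨i, hi, ?_⟩
    rw [← hZ1]
    by_contra hcon
    have := hmax (i + 1) (not_lt.1 hcon)
    omega
  obtain ⟨i, hi1, hi2⟩ := hex
  have hx := hXp i
  have hy := hYp i
  set w := W / X i with hw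
  have hWw : W = w * X i := by rw [hw]; field_simp
  have hw1 : w ≤ 1 + d i := by rw [hw, div_le_iff₀ hx]; linarith
  have hw2 : 1 + d i - a i < w := by rw [hw, lt_div_iff₀ hx]; linarith
  obtain ⟨j, hj⟩ : ∃ j : ℤ, j = ⌊d i - w⌋ + 1 := ⟨_, rfl⟩
  have hf1 := Int.floor_le (d i - w)
  have hf2 := Int.lt_floor_add_one (d i - w)
  have hjr : (j : ℝ) = ⌊d i - w⌋ + 1 := by rw [hj]; push_cast; ring
  have hj0 : 0 ≤ j := by
    have : (-1 : ℤ) ≤ ⌊d i - w⌋ := by rw [Int.le_floor]; push_cast; linarith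
    omega
  have hja : j < a i := by
    have : ⌊d i - w⌋ < a i - 1 := by rw [Int.floor_lt]; push_cast; linarith
    omega
  have hj0' : (0 : ℝ) ≤ j := by exact_mod_cast hj0
  have hja' : (j : ℝ) + 1 ≤ a i := by exact_mod_cast hja
  have hdj : 1 < d i - j := by
    have : 0 < 1 / d (i + 1) := by have := hdp (i + 1); positivity
    linarith [h.hd i]
  have hej : 0 < e i + j := by linarith [h.e0 i]
  have hmain := ((hG i).step j).box_le hx hy
    (by have := mul_pos (show 0 < d i - j by linarith) hx; linarith)
    (by have := mul_pos hej hy; linarith)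
    (show X i < W by rw [hWw]; nlinarith) (show _ < W by rw [hWw]; nlinarith)
    (show W ≤ _ by rw [hWw]; nlinarith) hb
  refine le_trans (ENNReal.ofReal_le_ofReal hmain) ?_
  refine le_trans (le_of_eq ?_) (mul_le_mul_left (hc i j hj0 hja.le) _)
  rw [← ENNReal.ofReal_mul' hD0.le]
  congr 1
  have hDi : 0 < d i + e i := by linarith [h.d1 i, h.e0 i]
  rw [← hD i, gf]
  have e2 : (1 + d i - j + (1 + e i + j) - 2) = d i + e i := by ring
  rw [e2]
  have := hDi.ne'
  field_simp
  ring

/-! ### Comparison of the normalized areas -/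

lemma gf_comm (P Q : ℝ) : gf P Q = gf Q P := by
  unfold gf; rw [mul_comm P Q, add_comm P Q]

lemma gf_mono_left {P P' Q : ℝ} (hP : 2 ≤ P) (hPP : P ≤ P') (hQ : 2 ≤ Q) :
    gf P Q ≤ gf P' Q := by
  unfold gf
  rw [div_le_div_iff₀ (by linarith) (by linarith)]
  nlinarith [mul_nonneg (mul_nonneg (sub_nonneg.2 hPP) (show 0 ≤ Q by linarith))
    (sub_nonneg.2 hQ)]

lemma gf_mono {P P' Q Q' : ℝ} (hP : 2 ≤ P) (hPP : P ≤ P') (hQ : 2 ≤ Q) (hQQ : Q ≤ Q') :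
    gf P Q ≤ gf P' Q' := by
  refine (gf_mono_left hP hPP hQ).trans ?_
  rw [gf_comm P' Q, gf_comm P' Q']
  exact gf_mono_left hQ hQQ (by linarith)

lemma gf_shift {p q b s r : ℝ} (hp : 2 ≤ p) (hpq : p ≤ q) (hb0 : 0 < b) (hb1 : b < 1)
    (hs0 : 0 ≤ s) (hs1 : s ≤ 1 - b) (hr0 : 0 ≤ r) (hr : r ≤ b ^ 2 * s) :
    gf (p + b) (q + b) ≤ gf (p + b + s) (q + b - r) := by
  unfold gf
  have hb2 : b ^ 2 ≤ 1 := by nlinarith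
  have hrs : r ≤ s := hr.trans (by nlinarith)
  rw [div_le_div_iff₀ (by linarith) (by nlinarith)]
  obtain ⟨P, hP⟩ : ∃ P, P = p + b := ⟨_, rfl⟩
  obtain ⟨Q, hQ⟩ : ∃ Q, Q = q + b := ⟨_, rfl⟩
  rw [← hP, ← hQ]
  have hPQ : P ≤ Q := by linarith
  have hP2 : 2 + b ≤ P := by linarith
  have hQ2 : 2 + b ≤ Q := by linarith
  have key : 0 ≤ s * (Q * (Q - 2)) - r * (P * (P - 2)) - s * r * (P + Q - 2) := by
    have k1 : P * (P - 2) ≤ Q * (Q - 2) := by nlinarith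
    have k2 : r * (P * (P - 2)) ≤ r * (Q * (Q - 2)) := mul_le_mul_of_nonneg_left k1 hr0
    have k3 : s * r * (P + Q - 2) ≤ s * r * (2 * (Q - 1)) :=
      mul_le_mul_of_nonneg_left (by linarith) (mul_nonneg hs0 hr0)
    have k4 : 2 * b ^ 2 * (Q - 1) ≤ Q * (Q - 2) * (1 + b) := by
      have m1 : Q * b ≤ Q * (Q - 2) := mul_le_mul_of_nonneg_left (by linarith) (by linarith)
      have m2 : Q * b * (1 + b) ≤ Q * (Q - 2) * (1 + b) :=
        mul_le_mul_of_nonneg_right m1 (by linarith)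
      have m3 : 0 ≤ Q * b * (1 - b) :=
        mul_nonneg (mul_nonneg (by linarith) hb0.le) (by linarith)
      nlinarith
    have k5 : r * (Q * (Q - 2)) ≤ b ^ 2 * s * (Q * (Q - 2)) :=
      mul_le_mul_of_nonneg_right hr (mul_nonneg (by linarith) (by linarith))
    have k6 : s * r * (2 * (Q - 1)) ≤ s * (b ^ 2 * (1 - b)) * (2 * (Q - 1)) := by
      apply mul_le_mul_of_nonneg_right _ (by linarith)
      apply mul_le_mul_of_nonneg_left _ hs0
      refine hr.trans (mul_le_mul_of_nonneg_left hs1 (by positivity))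
    have k7 : s * (1 - b) * (2 * b ^ 2 * (Q - 1)) ≤ s * (1 - b) * (Q * (Q - 2) * (1 + b)) :=
      mul_le_mul_of_nonneg_left k4 (mul_nonneg hs0 (by linarith))
    nlinarith
  nlinarith

/-- For partial quotient at least two, the extreme indices are dominated by interior ones. -/
lemma gf_interior {n : ℤ} (hn : 2 ≤ n) {x y : ℝ} (hx0 : 0 < x) (hx1 : x < 1) (hy0 : 0 < y)
    (hy1 : y < 1) (j : ℤ) (hj0 : 0 ≤ j) (hjn : j ≤ n) :
    ∃ k : ℤ, 1 ≤ k ∧ k ≤ n - 1 ∧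
      gf (1 + (n + x) - j) (1 + y + j) ≤ gf (1 + (n + x) - k) (1 + y + k) := by
  have hn' : (2 : ℝ) ≤ n := by exact_mod_cast hn
  by_cases c0 : j = 0
  · refine ⟨1, le_rfl, by omega, ?_⟩
    subst c0
    unfold gf
    push_cast
    apply div_le_div₀ _ _ (by linarith) (by linarith)
    · apply mul_nonneg <;> linarith
    · nlinarith
  by_cases c1 : j = n
  · refine ⟨n - 1, by omega, le_rfl, ?_⟩
    subst c1
    unfold gf
    push_cast
    apply div_le_div₀ _ _ (by linarith) (by linarith)
    · apply mul_nonneg <;> linarith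
    · nlinarith
  exact ⟨j, by omega, by omega, le_rfl⟩

lemma theta_bound {z : ℤ → ℝ} {b : ℤ → ℤ} {A : ℤ} {θ : ℝ} (hz0 : ∀ i, 0 < z i)
    (hz1 : ∀ i, z i < 1) (hb1 : ∀ i, 1 ≤ b i) (hbA : ∀ i, b i ≤ A)
    (hz : ∀ i, z i = 1 / (b i + z (i + 1))) (hθ0 : 0 < θ) (hθ : θ ^ 2 + A * θ = A) (i : ℤ) :
    z i ≤ θ := by
  have hA : (1 : ℝ) ≤ A := by exact_mod_cast (hb1 0).trans (hbA 0)
  have hbdd : BddAbove (Set.range z) := ⟨1, by rintro _ ⟨i, rfl⟩; exact (hz1 i).le⟩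
  obtain ⟨M, hM⟩ : ∃ M, M = sSup (Set.range z) := ⟨_, rfl⟩
  have hle : ∀ i, z i ≤ M := fun i => by rw [hM]; exact le_csSup hbdd ⟨i, rfl⟩
  have hM0 : 0 < M := (hz0 0).trans_le (hle 0)
  have hMM : M ≤ (A + M) / (A + M + 1) := by
    conv_lhs => rw [hM]
    apply csSup_le (Set.range_nonempty z)
    rintro _ ⟨i, rfl⟩
    have h1 : (1 : ℝ) / (A + M) ≤ z (i + 1) := by
      rw [hz (i + 1)]
      have : (b (i + 1) : ℝ) ≤ A := by exact_mod_cast hbA _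
      have h3 : (1 : ℝ) ≤ b (i + 1) := by exact_mod_cast hb1 _
      have h4 := hz0 (i + 1 + 1)
      exact one_div_le_one_div_of_le (by linarith) (by linarith [hle (i + 1 + 1)])
    have h3 : (1 : ℝ) ≤ b i := by exact_mod_cast hb1 _
    have h5 : 0 < (1 : ℝ) / (A + M) := by positivity
    rw [hz i]
    calc 1 / (b i + z (i + 1)) ≤ 1 / (1 + 1 / (A + M)) :=
          one_div_le_one_div_of_le (by linarith) (by linarith)
      _ = (A + M) / (A + M + 1) := by field_simp
  rw [le_div_iff₀ (by linarith)] at hMM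
  refine (hle i).trans ?_
  by_contra hcon
  push Not at hcon
  nlinarith

lemma step_back {A b : ℤ} (hb : b ≤ A) (hb1 : 1 ≤ b) {β y y' : ℝ} (hβ0 : 0 < β)
    (hβ : β = 1 / (A + β)) (hy' : 0 < y') (hy'1 : y' < 1) (hy : y = 1 / (b + y'))
    (hlt : y < β) : b = A ∧ β < y' ∧ β - y = y * β * (y' - β) := by
  have hb1' : (1 : ℝ) ≤ b := by exact_mod_cast hb1
  have hA1' : (1 : ℝ) ≤ A := by exact_mod_cast hb1.trans hb
  have h1 : (A : ℝ) + β < b + y' := by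
    rw [hy] at hlt
    conv at hlt => rhs; rw [hβ]
    rwa [one_div_lt_one_div (by linarith) (by linarith)] at hlt
  have hbA : b = A := by
    have : (A : ℝ) < b + 1 := by linarith
    have : A < b + 1 := by exact_mod_cast this
    omega
  subst hbA
  refine ⟨rfl, by linarith, ?_⟩
  have e1 : y * (b + y') = 1 := by rw [hy]; field_simp
  have e2 : β * (b + β) = 1 := by
    rw [eq_div_iff (by linarith)] at hβ; exact hβ
  linear_combination (-β) * e1 + y * e2

/-- The good position property. -/
def Good (β x y : ℝ) : Prop :=
  (β ≤ x ∧ β ≤ y) ∨ (β ≤ x ∧ y ≤ β ∧ β - y ≤ β ^ 2 * (x - β)) ∨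
    (β ≤ y ∧ x ≤ β ∧ β - x ≤ β ^ 2 * (y - β))

lemma good_le {A : ℤ} {β x y : ℝ} (hβ0 : 0 < β) (hβ1 : β < 1) (hx1 : x < 1) (hy1 : y < 1)
    (hg : Good β x y) (j : ℤ) (hj1 : 1 ≤ j) (hjA : j ≤ A - 1) :
    ∃ k : ℤ, 0 ≤ k ∧ k ≤ A ∧
      gf (1 + (A + β) - j) (1 + β + j) ≤ gf (1 + (A + x) - k) (1 + y + k) := by
  have hj1' : (1 : ℝ) ≤ j := by exact_mod_cast hj1
  have hjA' : (j : ℝ) ≤ A - 1 := by exact_mod_cast hjA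
  have hsw : gf (1 + (A + β) - j) (1 + β + j) =
      gf (1 + (A + β) - ((A - j : ℤ) : ℝ)) (1 + β + ((A - j : ℤ) : ℝ)) := by
    rw [gf_comm]; push_cast; congr 1 <;> ring
  -- index with the large part on the right / left
  rcases hg with ⟨h1, h2⟩ | ⟨h1, h2, h3⟩ | ⟨h1, h2, h3⟩
  · exact ⟨j, by omega, by omega, gf_mono (by linarith) (by linarith) (by linarith) (by linarith)⟩
  · have main : ∀ k : ℤ, 1 ≤ k → k ≤ A - 1 → A - k ≤ k →
        gf (1 + (A + β) - k) (1 + β + k) ≤ gf (1 + (A + x) - k) (1 + y + k) := by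
      intro k hk1 hk2 hk3
      have hk1' : (1 : ℝ) ≤ k := by exact_mod_cast hk1
      have hk2' : (k : ℝ) ≤ A - 1 := by exact_mod_cast hk2
      have hk3' : (A : ℝ) - k ≤ k := by exact_mod_cast hk3
      have := gf_shift (p := 1 + A - k) (q := 1 + k) (b := β) (s := x - β) (r := β - y)
        (by linarith) (by linarith) hβ0 hβ1 (by linarith) (by linarith) (by linarith) h3
      convert this using 2 <;> ring
    rcases le_total (A - j) j with h | h
    · exact ⟨j, by omega, by omega, main j hj1 hjA h⟩
    · exact ⟨A - j, by omega, by omega, hsw.trans_le (main _ (by omega) (by omega) (by omega))⟩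
  · have main : ∀ k : ℤ, 1 ≤ k → k ≤ A - 1 → k ≤ A - k →
        gf (1 + (A + β) - k) (1 + β + k) ≤ gf (1 + (A + x) - k) (1 + y + k) := by
      intro k hk1 hk2 hk3
      have hk1' : (1 : ℝ) ≤ k := by exact_mod_cast hk1
      have hk2' : (k : ℝ) ≤ A - 1 := by exact_mod_cast hk2
      have hk3' : (k : ℝ) ≤ A - k := by exact_mod_cast hk3
      have := gf_shift (p := 1 + k) (q := 1 + A - k) (b := β) (s := y - β) (r := β - x)
        (by linarith) (by linarith) hβ0 hβ1 (by linarith) (by linarith) (by linarith) h3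
      rw [gf_comm, gf_comm (1 + (A + x) - k)]
      convert this using 2 <;> ring
    rcases le_total j (A - j) with h | h
    · exact ⟨j, by omega, by omega, main j hj1 hjA h⟩
    · exact ⟨A - j, by omega, by omega, hsw.trans_le (main _ (by omega) (by omega) (by omega))⟩

lemma CF.x_rec {d e : ℤ → ℝ} {a : ℤ → ℤ} (h : CF d e a) (i : ℤ) :
    1 / d i = 1 / (a i + 1 / d (i + 1)) := by rw [← h.hd i]

lemma CF.x_pos {d e : ℤ → ℝ} {a : ℤ → ℤ} (h : CF d e a) (i : ℤ) : 0 < 1 / d i := by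
  have := h.d1 i
  positivity

lemma CF.x_lt {d e : ℤ → ℝ} {a : ℤ → ℤ} (h : CF d e a) (i : ℤ) : 1 / d i < 1 := by
  have := h.d1 i
  rw [div_lt_one (by linarith)]; exact this

lemma CF.exists_good {d e : ℤ → ℝ} {a : ℤ → ℤ} (h : CF d e a) {A : ℤ} {β : ℝ} (hβ0 : 0 < β)
    (hβ : β = 1 / (A + β)) (hub : ∀ i, a i ≤ A) (hatt : ∃ i, a i = A) :
    ∃ i, a i = A ∧ Good β (1 / d (i + 1)) (e i) := by
  obtain ⟨i, hi⟩ := hatt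
  have hA : (1 : ℝ) ≤ A := by exact_mod_cast hi ▸ h.a1 i
  have back : ∀ x : ℝ, 0 < x → 1 / (A + x) < β → β < x := by
    intro x hx hlt
    have hlt2 := hlt
    conv at hlt2 => rhs; rw [hβ]
    rw [one_div_lt_one_div (by linarith) (by linarith)] at hlt2
    linarith
  have back' : ∀ x : ℝ, 0 < x → β < 1 / (A + x) → x < β := by
    intro x hx hlt
    have hlt2 := hlt
    conv at hlt2 => lhs; rw [hβ]
    rw [one_div_lt_one_div (by linarith) (by linarith)] at hlt2
    linarith
  have hdiff : ∀ x : ℝ, 0 < x → β - 1 / (A + x) = 1 / (A + x) * β * (x - β) := by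
    intro x hx
    have e2 : β * (A + β) = 1 := by
      rw [eq_div_iff (by linarith)] at hβ; exact hβ
    have : (A + x) ≠ 0 := by linarith
    field_simp
    linear_combination e2
  have hx0 := h.x_pos (i + 1)
  have hy0 := h.e0 i
  -- previous and next positions
  have hyprev : e i = 1 / (a (i - 1) + e (i - 1)) := by
    have := h.he (i - 1); rwa [sub_add_cancel] at this
  have hxprev : 1 / d (i - 1 + 1) = 1 / (A + 1 / d (i + 1)) := by
    rw [sub_add_cancel, h.x_rec i, hi]
  have hynext : e (i + 1) = 1 / (A + e i) := by rw [h.he i, hi]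
  have hxnext := h.x_rec (i + 1)
  rcases le_or_gt β (1 / d (i + 1)) with cx | cx <;> rcases le_or_gt β (e i) with cy | cy
  · exact ⟨i, hi, Or.inl ⟨cx, cy⟩⟩
  · obtain ⟨s1, s2, s3⟩ := step_back (hub _) (h.a1 _) hβ0 hβ (h.e0 _) (h.e1 _) hyprev cy
    rcases le_or_gt (e (i - 1)) (1 / d (i + 1)) with c | c
    · refine ⟨i, hi, Or.inr (Or.inl ⟨cx, cy.le, ?_⟩)⟩
      rw [s3]
      have m1 : e i * β ≤ β ^ 2 := by nlinarith
      exact mul_le_mul m1 (by linarith) (by linarith) (by positivity)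
    · refine ⟨i - 1, s1, Or.inr (Or.inr ⟨s2.le, ?_, ?_⟩)⟩
      · rw [hxprev]; by_contra hc; linarith [back' _ hx0 (not_le.1 hc)]
      · have hle : 1 / (A + 1 / d (i + 1)) ≤ β := by
          by_contra hc; linarith [back' _ hx0 (not_le.1 hc)]
        rw [hxprev, hdiff _ hx0]
        exact mul_le_mul (by nlinarith) (by linarith) (by linarith) (by positivity)
  · obtain ⟨s1, s2, s3⟩ := step_back (hub _) (h.a1 _) hβ0 hβ (h.x_pos _) (h.x_lt _) hxnext cx
    rcases le_or_gt (1 / d (i + 1 + 1)) (e i) with c | c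
    · refine ⟨i, hi, Or.inr (Or.inr ⟨cy, cx.le, ?_⟩)⟩
      rw [s3]
      have m1 : 1 / d (i + 1) * β ≤ β ^ 2 := by nlinarith
      exact mul_le_mul m1 (by linarith) (by linarith) (by positivity)
    · have hle : e (i + 1) ≤ β := by
        rw [hynext]; by_contra hc; linarith [back' _ hy0 (not_le.1 hc)]
      refine ⟨i + 1, s1, Or.inr (Or.inl ⟨s2.le, hle, ?_⟩)⟩
      rw [hynext, hdiff _ hy0, ← hynext]
      exact mul_le_mul (by nlinarith) (by linarith) (by linarith) (by positivity)
  · obtain ⟨s1, s2, s3⟩ := step_back (hub _) (h.a1 _) hβ0 hβ (h.e0 _) (h.e1 _) hyprev cy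
    refine ⟨i - 1, s1, Or.inl ⟨?_, s2.le⟩⟩
    rw [hxprev]; by_contra hc; linarith [back _ hx0 (not_le.1 hc)]

lemma CF.x_le {d e : ℤ → ℝ} {a : ℤ → ℤ} (h : CF d e a) {A : ℤ} {θ : ℝ} (hθ0 : 0 < θ)
    (hθ : θ ^ 2 + A * θ = A) (hub : ∀ i, a i ≤ A) (i : ℤ) : 1 / d i ≤ θ :=
  theta_bound (z := fun i => 1 / d i) (b := a) h.x_pos h.x_lt h.a1 hub h.x_rec hθ0 hθ i

lemma CF.y_le {d e : ℤ → ℝ} {a : ℤ → ℤ} (h : CF d e a) {A : ℤ} {θ : ℝ} (hθ0 : 0 < θ)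
    (hθ : θ ^ 2 + A * θ = A) (hub : ∀ i, a i ≤ A) (i : ℤ) : e i ≤ θ := by
  have := theta_bound (z := fun i => e (-i)) (b := fun i => a (-i - 1)) (A := A)
    (fun i => h.e0 _) (fun i => h.e1 _) (fun i => h.a1 _) (fun i => hub _)
    (fun i => by
      have := h.he (-i - 1)
      rw [sub_add_cancel] at this
      rw [this, show -(i + 1) = -i - 1 by ring]) hθ0 hθ (-i)
  simpa using this

/-- If all partial quotients are one, everything is golden. -/
lemma CF.golden {d e : ℤ → ℝ} {a : ℤ → ℤ} (h : CF d e a) {θ : ℝ} (hθ0 : 0 < θ)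
    (hθ : θ ^ 2 + θ = 1) (hub : ∀ i, a i ≤ 1) (i : ℤ) : 1 / d (i + 1) = θ ∧ e i = θ ∧ a i = 1 := by
  have ha : ∀ i, a i = 1 := fun i => le_antisymm (hub i) (h.a1 i)
  have hx := h.x_le (A := 1) hθ0 (by push_cast; linarith) hub
  have hy := h.y_le (A := 1) hθ0 (by push_cast; linarith) hub
  have hθ' : 1 / (1 + θ) = θ := by
    rw [div_eq_iff (by linarith)]; linarith
  refine ⟨le_antisymm (hx _) ?_, le_antisymm (hy _) ?_, ha i⟩
  · rw [h.x_rec (i + 1), ha]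
    conv_lhs => rw [← hθ']
    have := h.x_pos (i + 1 + 1)
    push_cast
    exact one_div_le_one_div_of_le (by linarith) (by linarith [hx (i + 1 + 1)])
  · have := h.he (i - 1)
    rw [sub_add_cancel, ha] at this
    rw [this]
    conv_lhs => rw [← hθ']
    have := h.e0 (i - 1)
    push_cast
    exact one_div_le_one_div_of_le (by linarith) (by linarith [hy (i - 1)])

lemma CF.lower {d e : ℤ → ℝ} {a : ℤ → ℤ} (h : CF d e a) {A : ℤ} {β : ℝ} (hβ0 : 0 < β)
    (hβ : β ^ 2 + A * β = 1) (hub : ∀ i, a i ≤ A) (hatt : ∃ i, a i = A) :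
    disp (latticeGen (1, 1) (-(A + β), β)) / ENNReal.ofReal (A + β + β) ≤
      disp (latticeGen (1, 1) (-d 0, e 0)) / ENNReal.ofReal (d 0 + e 0) := by
  have hA : 1 ≤ A := (h.a1 0).trans (hub 0)
  have hA' : (1 : ℝ) ≤ A := by exact_mod_cast hA
  have hβ1 : β < 1 := by nlinarith
  have hβe : β = 1 / (A + β) := by rw [eq_div_iff (by linarith)]; linarith
  have h1 : CF (fun _ => (A : ℝ) + β) (fun _ => β) (fun _ => A) :=
    ⟨fun _ => by linarith, fun _ => hβ0, fun _ => hβ1, fun _ => hA,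
      fun _ => by rw [← hβe], fun _ => hβe⟩
  refine h1.disp_le _ ?_
  intro i j hj0 hjA
  rcases hA.eq_or_lt with c | c
  · obtain ⟨g1, g2, g3⟩ := h.golden hβ0 (by rw [← c] at hβ; push_cast at hβ; linarith)
      (by rw [c]; exact hub) 0
    have := h.le_disp 0 j hj0 (by omega)
    convert this using 4
    · rw [h.hd 0, g1, g3, c]
    · rw [g2]
  · obtain ⟨i0, hi0, hg⟩ := h.exists_good hβ0 hβe hub hatt
    obtain ⟨k, hk1, hk2, hk⟩ := gf_interior (n := A) (by omega) hβ0 hβ1 hβ0 hβ1 j hj0 hjA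
    obtain ⟨l, hl1, hl2, hl⟩ := good_le (A := A) hβ0 hβ1 (h.x_lt _) (h.e1 _) hg k hk1 hk2
    have := h.le_disp i0 l hl1 (by omega)
    refine le_trans (ENNReal.ofReal_le_ofReal (hk.trans hl)) ?_
    rwa [h.hd i0, hi0] at this

lemma CF.upper {d e : ℤ → ℝ} {a : ℤ → ℤ} (h : CF d e a) {A : ℤ} {θ : ℝ} (hθ0 : 0 < θ)
    (hθ : θ ^ 2 + A * θ = A) (hub : ∀ i, a i ≤ A) :
    disp (latticeGen (1, 1) (-d 0, e 0)) / ENNReal.ofReal (d 0 + e 0) ≤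
      disp (latticeGen (1, 1) (-(A + θ), θ)) / ENNReal.ofReal (A + θ + θ) := by
  have hA : 1 ≤ A := (h.a1 0).trans (hub 0)
  have hA' : (1 : ℝ) ≤ A := by exact_mod_cast hA
  refine h.disp_le _ ?_
  intro i j hj0 hja
  have S := fun (k : ℤ) (hk0 : 0 ≤ k) (hkA : k ≤ A) =>
    single_le_disp (D := A + θ) (E := θ) (by linarith) hθ0 k hk0
      (by have : (k : ℝ) ≤ A := by exact_mod_cast hkA
          linarith)
  rw [h.hd i]
  have hx := h.x_le hθ0 hθ hub (i + 1)
  have hy := h.y_le hθ0 hθ hub i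
  have hx0 := h.x_pos (i + 1)
  have hx1 := h.x_lt (i + 1)
  have hy0 := h.e0 i
  have hy1 := h.e1 i
  rcases hA.eq_or_lt with c | c
  · obtain ⟨g1, g2, g3⟩ := h.golden hθ0 (by rw [← c] at hθ; push_cast at hθ; linarith)
      (by rw [c]; exact hub) i
    have := S j hj0 (hja.trans (hub i))
    rw [g1, g2, g3]
    rwa [← c] at this ⊢
  have c' : (2 : ℝ) ≤ A := by exact_mod_cast c
  rcases (h.a1 i).eq_or_lt with c1 | c1
  · refine le_trans (ENNReal.ofReal_le_ofReal ?_) (S 1 (by omega) (by omega))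
    have t1 : gf (1 + (a i + 1 / d (i + 1)) - j) (1 + e i + j) ≤ 2 := by
      rw [← c1] at hja ⊢
      generalize 1 / d (i + 1) = x at *
      generalize e i = y at *
      unfold gf
      rw [div_le_iff₀ (by push_cast; linarith)]
      have : j = 0 ∨ j = 1 := by omega
      rcases this with rfl | rfl <;> push_cast <;> nlinarith
    have t2 : 2 ≤ gf (2 + θ) (2 + θ) := by
      unfold gf
      rw [le_div_iff₀ (by linarith)]
      nlinarith
    have t3 : gf (2 + θ) (2 + θ) ≤ gf (1 + (A + θ) - ((1 : ℤ) : ℝ)) (1 + θ + ((1 : ℤ) : ℝ)) := by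
      push_cast
      exact gf_mono (by linarith) (by linarith) (by linarith) (by linarith)
    exact t1.trans (t2.trans t3)
  · obtain ⟨k, hk1, hk2, hk⟩ := gf_interior (n := a i) (by omega) hx0 hx1 hy0 hy1 j hj0 hja
    refine le_trans (ENNReal.ofReal_le_ofReal (hk.trans ?_))
      (S k (by omega) (by have := hub i; omega))
    have hk1' : (1 : ℝ) ≤ k := by exact_mod_cast hk1
    have hk2' : (k : ℝ) ≤ a i - 1 := by exact_mod_cast hk2
    have hai : (a i : ℝ) ≤ A := by exact_mod_cast hub i
    exact gf_mono (by linarith) (by linarith) (by linarith) (by linarith)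

/-- Tight bounds on the normalized dispersion of a lattice in terms of the maximum
a of its two-sided continued fraction sequence: the lattice Λ₁ with constant
sequence (a) (generated by (1,1) and (−(a+√(a²+4))/2, (√(a²+4)−a)/2), determinant
√(a²+4)) gives a lower bound, and the lattice Λ₂ with alternating sequence
(…,a,1,a,1,…) (generated by (1,1) and (−(a+√(a²+4a))/2, (√(a²+4a)−a)/2),
determinant √(a²+4a)) gives an upper bound:
disp(Λ₁)/det(Λ₁) ≤ disp(Λ)/det(Λ) ≤ disp(Λ₂)/det(Λ₂), where det(Λ) = Δ−Δ̃. -/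
theorem stmt19
    (Δ Δt : ℝ) (hΔirr : Irrational Δ) (hΔtirr : Irrational Δt)
    (hΔ1 : 1 < Δ) (hΔtmem : Δt ∈ Set.Ioo (-1 : ℝ) 0)
    (a : ℤ → ℤ) (Δs Δts : ℤ → ℝ)
    (h0 : Δs 0 = Δ) (h0t : Δts 0 = Δt)
    (hpos : ∀ i : ℤ, 0 ≤ i → a i = ⌊Δs i⌋ ∧ Δs (i + 1) = 1 / (Δs i - a i) ∧
      Δts (i + 1) = -1 / (a i - Δts i))
    (hneg : ∀ i : ℤ, i ≤ 0 → a (i - 1) = ⌊-1 / Δts i⌋ ∧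
      Δts (i - 1) = a (i - 1) + 1 / Δts i ∧ Δs (i - 1) = a (i - 1) + 1 / Δs i)
    (A : ℤ) (hub : ∀ i : ℤ, a i ≤ A) (hatt : ∃ i : ℤ, a i = A) :
    disp (latticeGen (1, 1)
          (-(((A : ℝ) + Real.sqrt ((A : ℝ) ^ 2 + 4)) / 2),
            (Real.sqrt ((A : ℝ) ^ 2 + 4) - (A : ℝ)) / 2)) /
        ENNReal.ofReal (Real.sqrt ((A : ℝ) ^ 2 + 4)) ≤
      disp (latticeGen (1, 1) (-Δ, -Δt)) / ENNReal.ofReal (Δ - Δt) ∧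
    disp (latticeGen (1, 1) (-Δ, -Δt)) / ENNReal.ofReal (Δ - Δt) ≤
      disp (latticeGen (1, 1)
          (-(((A : ℝ) + Real.sqrt ((A : ℝ) ^ 2 + 4 * (A : ℝ))) / 2),
            (Real.sqrt ((A : ℝ) ^ 2 + 4 * (A : ℝ)) - (A : ℝ)) / 2)) /
        ENNReal.ofReal (Real.sqrt ((A : ℝ) ^ 2 + 4 * (A : ℝ))) := by
  obtain ⟨ht1, ht2⟩ := hΔtmem
  -- forward facts
  have hfwd : ∀ n : ℕ, 1 < Δs n ∧ Irrational (Δs n) ∧ -1 < Δts n ∧ Δts n < 0 := by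
    intro n
    induction n with
    | zero => simp only [Nat.cast_zero, h0, h0t]; exact ⟨hΔ1, hΔirr, ht1, ht2⟩
    | succ n ih =>
      obtain ⟨i1, i2, i3, i4⟩ := ih
      obtain ⟨p1, p2, p3⟩ := hpos n (by omega)
      have hfl := Int.floor_le (Δs n)
      have hfl2 := Int.lt_floor_add_one (Δs n)
      rw [← p1] at hfl hfl2
      have hne : Δs n ≠ a n := i2.ne_int _
      have hlt : (a n : ℝ) < Δs n := lt_of_le_of_ne hfl hne.symm
      have ha1 : 1 ≤ a n := by rw [p1, Int.le_floor]; push_cast; linarith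
      have ha1' : (1 : ℝ) ≤ a n := by exact_mod_cast ha1
      push_cast
      refine ⟨?_, ?_, ?_, ?_⟩
      · rw [p2, lt_div_iff₀ (by linarith)]; linarith
      · rw [p2, one_div]; exact (i2.sub_intCast _).inv
      · rw [p3, lt_div_iff₀ (by linarith)]; linarith
      · rw [p3]; exact div_neg_of_neg_of_pos (by norm_num) (by linarith)
  have hbwd : ∀ n : ℕ, 1 < Δs (-n) ∧ Irrational (Δts (-n)) ∧ -1 < Δts (-n) ∧ Δts (-n) < 0 := by
    intro n
    induction n with
    | zero => simp only [Nat.cast_zero, neg_zero, h0, h0t]; exact ⟨hΔ1, hΔtirr, ht1, ht2⟩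
    | succ n ih =>
      obtain ⟨i1, i2, i3, i4⟩ := ih
      obtain ⟨p1, p2, p3⟩ := hneg (-n) (by omega)
      have e1 : (-((n + 1 : ℕ) : ℤ)) = -n - 1 := by push_cast; ring
      rw [e1]
      have hfl := Int.floor_le (-1 / Δts (-n))
      have hfl2 := Int.lt_floor_add_one (-1 / Δts (-n))
      rw [← p1] at hfl hfl2
      have hirr : Irrational (-1 / Δts (-n)) := by
        rw [neg_div, one_div]; exact i2.inv.neg
      have hlt : (a (-n - 1) : ℝ) < -1 / Δts (-n) := lt_of_le_of_ne hfl (hirr.ne_int _).symm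
      have hgt : 1 < -1 / Δts (-n) := by rw [lt_div_iff_of_neg i4]; linarith
      have ha1 : 1 ≤ a (-n - 1) := by rw [p1, Int.le_floor]; push_cast; linarith
      have ha1' : (1 : ℝ) ≤ a (-n - 1) := by exact_mod_cast ha1
      have hx : 0 < 1 / Δs (-n) := by positivity
      rw [neg_div] at hfl hfl2 hlt
      refine ⟨?_, ?_, ?_, ?_⟩
      · rw [p3]; linarith
      · rw [p2, one_div]; exact i2.inv.intCast_add _
      · rw [p2]; linarith
      · rw [p2]; linarith
  have hall : ∀ i : ℤ, 1 < Δs i ∧ -1 < Δts i ∧ Δts i < 0 := by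
    intro i
    rcases Int.eq_nat_or_neg i with ⟨n, rfl | rfl⟩
    · exact ⟨(hfwd n).1, (hfwd n).2.2⟩
    · exact ⟨(hbwd n).1, (hbwd n).2.2⟩
  have hrec : ∀ i : ℤ, 1 ≤ a i ∧ Δs i = a i + 1 / Δs (i + 1) ∧
      -Δts (i + 1) = 1 / (a i + -Δts i) := by
    intro i
    rcases le_or_gt 0 i with hi | hi
    · obtain ⟨p1, p2, p3⟩ := hpos i hi
      refine ⟨?_, ?_, ?_⟩
      · rw [p1, Int.le_floor]; push_cast; linarith [(hall i).1]
      · rw [p2, one_div_one_div]; ring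
      · rw [p3, neg_div, neg_neg, ← sub_eq_add_neg]
    · obtain ⟨p1, p2, p3⟩ := hneg (i + 1) (by omega)
      rw [add_sub_cancel_right] at p1 p2 p3
      obtain ⟨-, q1, q2⟩ := hall (i + 1)
      refine ⟨?_, p3, ?_⟩
      · rw [p1, Int.le_floor]; push_cast; rw [le_div_iff_of_neg q2]; linarith
      · have : (a i : ℝ) + -Δts i = -(1 / Δts (i + 1)) := by rw [p2]; ring
        rw [this, one_div_neg_eq_neg_one_div, one_div_one_div]
  have hCF : CF Δs (fun i => -Δts i) a :=
    ⟨fun i => (hall i).1, fun i => by simpa using (hall i).2.2,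
      fun i => by simpa using neg_lt_neg (hall i).2.1, fun i => (hrec i).1,
      fun i => (hrec i).2.1, fun i => (hrec i).2.2⟩
  have hA : (1 : ℝ) ≤ A := by exact_mod_cast (hrec 0).1.trans (hub 0)
  constructor
  · have hs : Real.sqrt ((A : ℝ) ^ 2 + 4) ^ 2 = (A : ℝ) ^ 2 + 4 := Real.sq_sqrt (by positivity)
    have hs0 := Real.sqrt_nonneg ((A : ℝ) ^ 2 + 4)
    generalize Real.sqrt ((A : ℝ) ^ 2 + 4) = s at *
    have := hCF.lower (A := A) (β := (s - A) / 2) (by nlinarith) (by linarith) hub hatt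
    rw [h0, h0t, ← sub_eq_add_neg] at this
    convert this using 5 <;> ring
  · have hs : Real.sqrt ((A : ℝ) ^ 2 + 4 * A) ^ 2 = (A : ℝ) ^ 2 + 4 * A :=
      Real.sq_sqrt (by positivity)
    have hs0 := Real.sqrt_nonneg ((A : ℝ) ^ 2 + 4 * A)
    generalize Real.sqrt ((A : ℝ) ^ 2 + 4 * A) = s at *
    have := hCF.upper (A := A) (θ := (s - A) / 2) (by nlinarith) (by linarith) hub
    rw [h0, h0t, ← sub_eq_add_neg] at this
    convert this using 5 <;> ring
end
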